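/- arXiv:1209.3867 — 7 statements merged into one kernel-verified Lean document; each statement's English description precedes it below -/
import Mathlib

section
/- For all integers j, k ≥ 0, the (j+k)-th moment of the Chernoff density satisfies ∫_ℝ x^(j+k) f(x) dx = ((−1)^j/(2πi)) ∫_{−i∞}^{i∞} (d^j/dz^j)(1/Ai)(z) · (d^k/dz^k)(1/Ai)(z) dz, i.e. it equals ((−1)^j/(2π)) ∫_ℝ (d^j/dz^j)(1/Ai)(iy) · (d^k/dz^k)(1/Ai)(iy) dy. -/
open Complex FourierTransform SchwartzMap MeasureTheory

section Schwartz

/-- The Fourier transform turns derivatives of a Schwartz function into powers of `2πiξ`. -/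
lemma SchwartzMap.exists_iteratedDeriv_fourier (G : 𝓢(ℝ, ℂ)) (j : ℕ) :
    ∃ D : 𝓢(ℝ, ℂ), (∀ t, D t = iteratedDeriv j G t) ∧
      ∀ ξ : ℝ, 𝓕 D ξ = (2 * Real.pi * I * ξ) ^ j * 𝓕 G ξ := by
  induction j with
  | zero => exact ⟨G, by simp, by simp⟩
  | succ j ih =>
    obtain ⟨D, hD, hF⟩ := ih
    refine ⟨derivCLM ℂ ℂ D, fun t => ?_, fun ξ => ?_⟩
    · rw [derivCLM_apply, iteratedDeriv_succ]
      exact congrArg (fun f => deriv f t) (funext hD)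
    · have h : 𝓕 (deriv D) = fun x : ℝ => (2 * Real.pi * I * x) • 𝓕 (D : ℝ → ℂ) x :=
        Real.fourier_deriv D.integrable D.differentiable (derivCLM ℂ ℂ D).integrable
      have h1 : 𝓕 (derivCLM ℂ ℂ D) ξ = 𝓕 (deriv D) ξ := rfl
      rw [h1, h]
      simp only [smul_eq_mul, ← fourier_coe]
      rw [hF]
      ring

/-- A Parseval identity for products of derivatives of a Schwartz function. -/
lemma SchwartzMap.integral_iteratedDeriv_mul_iteratedDeriv (G : 𝓢(ℝ, ℂ)) (j k : ℕ) :
    ∫ t : ℝ, iteratedDeriv j G t * iteratedDeriv k G t =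
      I ^ (j + k) * (-1) ^ j *
        ∫ ξ : ℝ, (2 * Real.pi * ξ : ℂ) ^ (j + k) * (𝓕 G ξ * 𝓕 G (-ξ)) := by
  obtain ⟨D, hD, hDF⟩ := G.exists_iteratedDeriv_fourier j
  obtain ⟨E, hE, hEF⟩ := G.exists_iteratedDeriv_fourier k
  have h := integral_fourier_mul_eq (𝓕⁻ D) E
  rw [FourierTransform.fourier_fourierInv_eq] at h
  simp_rw [← hD, ← hE, h]
  rw [← integral_const_mul]
  refine integral_congr_ae (.of_forall fun ξ => ?_)
  have h2 : 𝓕⁻ D ξ = 𝓕 D (-ξ) := rfl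
  simp only [h2, hDF, hEF]
  push_cast
  have : (2 * Real.pi * I * (-ξ : ℂ)) ^ j = I ^ j * (-1) ^ j * (2 * Real.pi * ξ : ℂ) ^ j := by
    rw [← mul_pow, ← mul_pow]; ring
  rw [this]
  have : (2 * Real.pi * I * (ξ : ℂ)) ^ k = I ^ k * (2 * Real.pi * ξ : ℂ) ^ k := by
    rw [← mul_pow]; ring
  rw [this]
  ring

end Schwartz

section Comparison

lemma nonneg_of_hasDerivAt_nonneg {φ φ' : ℝ → ℝ} (h : ∀ y, HasDerivAt φ (φ' y) y)
    (h' : ∀ y, 0 ≤ y → 0 ≤ φ' y) (h0 : 0 ≤ φ 0) {y : ℝ} (hy : 0 ≤ y) : 0 ≤ φ y := by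
  have hm : MonotoneOn φ (Set.Ici 0) := by
    refine monotoneOn_of_deriv_nonneg (convex_Ici 0)
      (fun x _ => (h x).continuousAt.continuousWithinAt)
      (fun x _ => (h x).differentiableAt.differentiableWithinAt) fun x hx => ?_
    rw [(h x).deriv]
    exact h' x (interior_subset hx)
  exact h0.trans (hm (Set.mem_Ici.2 le_rfl) (Set.mem_Ici.2 hy) hy)

lemma le_of_hasDerivAt_pow_le {φ φ' : ℝ → ℝ} (h : ∀ y, HasDerivAt φ (φ' y) y) {c : ℝ} {m : ℕ}
    (h' : ∀ y, 0 ≤ y → c * y ^ m ≤ φ' y) (h0 : 0 ≤ φ 0) {y : ℝ} (hy : 0 ≤ y) :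
    c / (m + 1) * y ^ (m + 1) ≤ φ y := by
  have hd : ∀ y, HasDerivAt (fun y => φ y - c / (m + 1) * y ^ (m + 1)) (φ' y - c * y ^ m) y := by
    intro y
    have h1 := (h y).sub ((hasDerivAt_pow (m + 1) y).const_mul (c / (m + 1)))
    refine h1.congr_deriv ?_
    have : (m + 1 : ℝ) ≠ 0 := by positivity
    push_cast
    field_simp
  have := nonneg_of_hasDerivAt_nonneg hd (fun y hy => sub_nonneg.2 (h' y hy)) (by simpa using h0) hy
  linarith

variable {v d p Q : ℝ → ℝ} (hv : ∀ y, HasDerivAt v (d y) y)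
  (hd : ∀ y, HasDerivAt d (2 * p y) y) (hp : ∀ y, HasDerivAt p (2 * y * Q y) y)
  (hQ : ∀ y, HasDerivAt Q (y * v y) y) (hv_nonneg : ∀ y, 0 ≤ v y) (hp_nonneg : ∀ y, 0 ≤ p y)
  (hv0 : 0 < v 0) (hd0 : 0 ≤ d 0) (hQ0 : 0 ≤ Q 0)

include hv hd hp_nonneg hd0 in
lemma airySystem_le_of_nonneg {y : ℝ} (hy : 0 ≤ y) : 0 ≤ d y ∧ v 0 ≤ v y := by
  have hdn : ∀ y, 0 ≤ y → 0 ≤ d y := fun y hy =>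
    nonneg_of_hasDerivAt_nonneg hd (fun y _ => by linarith [hp_nonneg y]) hd0 hy
  refine ⟨hdn y hy, ?_⟩
  have := nonneg_of_hasDerivAt_nonneg (fun y => (hv y).sub_const (v 0)) hdn (by simp) hy
  linarith

include hv hd hp hQ hp_nonneg hv0 hd0 hQ0 in
lemma airySystem_exists_pow_le (n : ℕ) : ∃ C : ℝ, ∀ y, 0 ≤ y → y ^ n ≤ C * v y := by
  have key : ∀ n : ℕ, ∃ c : ℝ, 0 < c ∧ ∀ y, 0 ≤ y → c * y ^ (6 * n) ≤ v y := by
    intro n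
    induction n with
    | zero =>
      exact ⟨v 0, hv0, fun y hy => by
        simpa using (airySystem_le_of_nonneg hv hd hp_nonneg hd0 hy).2⟩
    | succ n ih =>
      obtain ⟨c, hc, h⟩ := ih
      have h1 := fun y hy => le_of_hasDerivAt_pow_le hQ (c := c) (m := 6 * n + 1) (y := y)
        (fun y hy => by
          rw [pow_succ]; nlinarith [mul_le_mul_of_nonneg_left (h y hy) hy]) hQ0 hy
      set c1 := c / ((6 * n + 1 : ℕ) + 1 : ℝ) with hc1
      have hc1' : 0 < c1 := by positivity
      have h2 := fun y hy => le_of_hasDerivAt_pow_le hp (c := 2 * c1) (m := 6 * n + 3) (y := y)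
        (fun y hy => by
          have := mul_le_mul_of_nonneg_left (h1 y hy) hy
          calc 2 * c1 * y ^ (6 * n + 3) = 2 * (y * (c1 * y ^ (6 * n + 1 + 1))) := by ring
            _ ≤ 2 * (y * Q y) := by linarith
            _ = _ := by ring) (hp_nonneg 0) hy
      set c2 := 2 * c1 / ((6 * n + 3 : ℕ) + 1 : ℝ) with hc2
      have hc2' : 0 < c2 := by positivity
      have h3 := fun y hy => le_of_hasDerivAt_pow_le hd (c := 2 * c2) (m := 6 * n + 4) (y := y)
        (fun y hy => by
          have := h2 y hy
          linarith) hd0 hy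
      set c3 := 2 * c2 / ((6 * n + 4 : ℕ) + 1 : ℝ) with hc3
      have hc3' : 0 < c3 := by positivity
      have h4 := fun y hy => le_of_hasDerivAt_pow_le hv (c := c3) (m := 6 * n + 5) (y := y)
        (fun y hy => h3 y hy) hv0.le hy
      exact ⟨c3 / ((6 * n + 5 : ℕ) + 1 : ℝ), by positivity, h4⟩
  obtain ⟨c, hc, h⟩ := key n
  refine ⟨1 / v 0 + 1 / c, fun y hy => ?_⟩
  have h1 := (airySystem_le_of_nonneg hv hd hp_nonneg hd0 hy).2
  have h2 : y ^ (6 * n) ≤ 1 / c * v y := by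
    rw [one_div, inv_mul_eq_div, le_div_iff₀ hc]; linarith [h y hy]
  have h3 : 1 ≤ 1 / v 0 * v y := by
    rw [one_div, inv_mul_eq_div, le_div_iff₀ hv0]; linarith
  have h4 : y ^ n ≤ 1 + y ^ (6 * n) := by
    rcases le_total y 1 with h | h
    · linarith [pow_le_one₀ (n := n) hy h, pow_nonneg hy (6 * n)]
    · linarith [pow_le_pow_right₀ h (show n ≤ 6 * n by omega)]
  linarith

include hv hd hp hQ hv_nonneg hp_nonneg hv0 hd0 hQ0 in
lemma airySystem_exists_le_mul :
    ∃ C : ℝ, 0 ≤ C ∧ ∀ y, 0 ≤ y → p y ≤ C ^ 2 * (1 + y ^ 2) ^ 2 * v y := by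
  have hdn := fun y hy => (airySystem_le_of_nonneg hv hd hp_nonneg hd0 (y := y) hy).1
  have h1 : ∀ y, 0 ≤ y → Q y ≤ Q 0 + y ^ 2 / 2 * v y := by
    intro y hy
    have := nonneg_of_hasDerivAt_nonneg (φ := fun y => Q 0 + y ^ 2 / 2 * v y - Q y)
      (φ' := fun y => y ^ 2 / 2 * d y) (fun y => by
        have := ((((hasDerivAt_pow 2 y).div_const 2).mul (hv y)).const_add (Q 0)).sub (hQ y)
        refine this.congr_deriv ?_
        push_cast
        ring) (fun y hy => by have := hdn y hy; positivity) (by simp) hy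
    linarith
  have h2 : ∀ y, 0 ≤ y → p y ≤ p 0 + y ^ 2 * Q y := by
    intro y hy
    have := nonneg_of_hasDerivAt_nonneg (φ := fun y => p 0 + y ^ 2 * Q y - p y)
      (φ' := fun y => y ^ 3 * v y) (fun y => by
        have := (((hasDerivAt_pow 2 y).mul (hQ y)).const_add (p 0)).sub (hp y)
        refine this.congr_deriv ?_
        push_cast
        ring) (fun y hy => by have := hv_nonneg y; positivity) (by simp) hy
    linarith
  have hp0 := hp_nonneg 0
  set K := p 0 / v 0 + Q 0 / v 0 + 1 with hK
  have hK0 : 0 ≤ K := by positivity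
  refine ⟨√K, Real.sqrt_nonneg _, fun y hy => ?_⟩
  rw [Real.sq_sqrt hK0]
  have hvy := (airySystem_le_of_nonneg hv hd hp_nonneg hd0 hy).2
  have e1 : p 0 ≤ p 0 / v 0 * v y := by
    rw [div_mul_eq_mul_div, le_div_iff₀ hv0]; gcongr
  have e2 : Q 0 ≤ Q 0 / v 0 * v y := by
    rw [div_mul_eq_mul_div, le_div_iff₀ hv0]; gcongr
  have e3 : p y ≤ p 0 / v 0 * v y + y ^ 2 * (Q 0 / v 0 * v y + y ^ 2 / 2 * v y) := by
    refine (h2 y hy).trans (add_le_add e1 ?_)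
    gcongr
    exact (h1 y hy).trans (by linarith)
  have a1 : 0 ≤ p 0 / v 0 := by positivity
  have a2 : 0 ≤ Q 0 / v 0 := by positivity
  generalize p 0 / v 0 = A at *
  generalize Q 0 / v 0 = B at *
  have : 0 ≤ v y := hv_nonneg y
  calc p y ≤ _ := e3
    _ = (A + y ^ 2 * (B + y ^ 2 / 2)) * v y := by ring
    _ ≤ _ := by
      gcongr
      rw [hK]
      have : 0 ≤ y ^ 2 := by positivity
      generalize y ^ 2 = s at *
      nlinarith [mul_nonneg a1 this, mul_nonneg a2 this, mul_nonneg a1 (mul_nonneg this this),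
        mul_nonneg a2 (mul_nonneg this this), mul_nonneg this this]

end Comparison

section Axis

variable {A : ℂ → ℂ} (hA : Differentiable ℂ A) (hA' : Differentiable ℂ (deriv A))
  (hode : ∀ z, deriv (deriv A) z = z * A z)

lemma hasDerivAt_comp_I_mul {h : ℂ → ℂ} {h' : ℂ} {σ t : ℝ}
    (hh : HasDerivAt h h' (I * (σ * t : ℝ))) :
    HasDerivAt (fun t : ℝ => h (I * (σ * t : ℝ))) (σ * I * h') t := by
  have h1 : HasDerivAt (fun t : ℝ => I * ((σ * t : ℝ) : ℂ)) (I * σ) t := by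
    have := (((hasDerivAt_id t).const_mul σ).ofReal_comp).const_mul I
    simpa using this
  have := HasDerivAt.comp t hh h1
  exact this.congr_deriv (by ring)

lemma hasDerivAt_re_comp {w : ℝ → ℂ} {w' : ℂ} {t : ℝ} (h : HasDerivAt w w' t) :
    HasDerivAt (fun t => (w t).re) w'.re t :=
  reCLM.hasFDerivAt.comp_hasDerivAt t h

lemma hasDerivAt_im_comp {w : ℝ → ℂ} {w' : ℂ} {t : ℝ} (h : HasDerivAt w w' t) :
    HasDerivAt (fun t => (w t).im) w'.im t :=
  imCLM.hasFDerivAt.comp_hasDerivAt t h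

include hA hA' hode in
/-- Along each half of the imaginary axis, a solution of the Airy equation with real initial data of
opposite signs grows faster than any power and has polynomially bounded logarithmic derivative. -/
lemma airy_halfAxis_bounds {a b : ℝ} (ha : 0 < a) (hb : b ≤ 0) (hA0 : A 0 = a)
    (hA'0 : deriv A 0 = b) {σ : ℝ} (hσ : σ * σ = 1) :
    (∀ n : ℕ, ∃ C : ℝ, ∀ y : ℝ, 0 ≤ y → y ^ n ≤ C * ‖A (I * (σ * y : ℝ))‖ ^ 2) ∧
      ∃ C : ℝ, 0 ≤ C ∧ ∀ y : ℝ, 0 ≤ y → ‖deriv A (I * (σ * y : ℝ))‖ ^ 2 ≤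
        C ^ 2 * (1 + y ^ 2) ^ 2 * ‖A (I * (σ * y : ℝ))‖ ^ 2 := by
  set w : ℝ → ℂ := fun y => A (I * (σ * y : ℝ)) with hw_def
  set u : ℝ → ℂ := fun y => σ * I * deriv A (I * (σ * y : ℝ)) with hu_def
  have hw : ∀ y, HasDerivAt w (u y) y := fun y => hasDerivAt_comp_I_mul (hA _).hasDerivAt
  have hu : ∀ y, HasDerivAt u (-(σ * I * y * w y)) y := fun y => by
    have := (hasDerivAt_comp_I_mul (hA' (I * (σ * y : ℝ))).hasDerivAt).const_mul (σ * I : ℂ)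
    refine this.congr_deriv ?_
    have hσ' : (σ : ℂ) * σ = 1 := by exact_mod_cast hσ
    rw [hode]
    simp only [hw_def]
    push_cast
    linear_combination (σ * I * y * A (I * (σ * y)) : ℂ) * (I * I * hσ' + I_mul_I)
  have hwr := fun y => hasDerivAt_re_comp (hw y)
  have hwi := fun y => hasDerivAt_im_comp (hw y)
  have hur := fun y => hasDerivAt_re_comp (hu y)
  have hui := fun y => hasDerivAt_im_comp (hu y)
  have hnu : ∀ y, ‖deriv A (I * (σ * y : ℝ))‖ ^ 2 = (u y).re ^ 2 + (u y).im ^ 2 := fun y => by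
    have h1 : ‖u y‖ ^ 2 = ‖deriv A (I * (σ * y : ℝ))‖ ^ 2 := by
      rw [hu_def]
      simp only [norm_mul, norm_I, norm_real, Real.norm_eq_abs, mul_one, mul_pow, sq_abs]
      rw [sq σ, hσ, one_mul]
    rw [← h1, Complex.sq_norm, normSq_apply]; ring
  have hnw : ∀ y, ‖A (I * (σ * y : ℝ))‖ ^ 2 = (w y).re ^ 2 + (w y).im ^ 2 := fun y => by
    rw [Complex.sq_norm, normSq_apply]; ring
  have hw0 : w 0 = a := by simp [hw_def, hA0]
  have hu0 : u 0 = σ * I * b := by simp [hu_def, hA'0]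
  simp_rw [hnu, hnw]
  have hv : ∀ y, HasDerivAt (fun y => (w y).re ^ 2 + (w y).im ^ 2)
      (2 * ((w y).re * (u y).re + (w y).im * (u y).im)) y := fun y => by
    refine (((hwr y).pow 2).add ((hwi y).pow 2)).congr_deriv ?_
    push_cast; ring
  have hd : ∀ y, HasDerivAt (fun y => 2 * ((w y).re * (u y).re + (w y).im * (u y).im))
      (2 * ((u y).re ^ 2 + (u y).im ^ 2)) y := fun y => by
    refine ((((hwr y).mul (hur y)).add ((hwi y).mul (hui y))).const_mul 2).congr_deriv ?_
    simp; ring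
  have hp : ∀ y, HasDerivAt (fun y => (u y).re ^ 2 + (u y).im ^ 2)
      (2 * y * (-σ * ((w y).re * (u y).im - (w y).im * (u y).re))) y := fun y => by
    refine (((hur y).pow 2).add ((hui y).pow 2)).congr_deriv ?_
    simp; ring
  have hQ : ∀ y, HasDerivAt (fun y => -σ * ((w y).re * (u y).im - (w y).im * (u y).re))
      (y * ((w y).re ^ 2 + (w y).im ^ 2)) y := fun y => by
    refine ((((hwr y).mul (hui y)).sub ((hwi y).mul (hur y))).const_mul (-σ)).congr_deriv ?_
    simp
    linear_combination (y * ((w y).re ^ 2 + (w y).im ^ 2)) * hσ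
  have hv0 : 0 < (w 0).re ^ 2 + (w 0).im ^ 2 := by rw [hw0]; simp; positivity
  have hd0 : 0 ≤ 2 * ((w 0).re * (u 0).re + (w 0).im * (u 0).im) := by rw [hw0, hu0]; simp
  have hQ0 : 0 ≤ -σ * ((w 0).re * (u 0).im - (w 0).im * (u 0).re) := by
    rw [hw0, hu0]
    simp
    nlinarith [mul_nonneg ha.le (neg_nonneg.2 hb)]
  exact ⟨airySystem_exists_pow_le hv hd hp hQ (fun y => by positivity) hv0 hd0 hQ0,
    airySystem_exists_le_mul hv hd hp hQ (fun y => by positivity) (fun y => by positivity)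
      hv0 hd0 hQ0⟩

include hA hA' hode in
lemma airy_axis_bounds {a b : ℝ} (ha : 0 < a) (hb : b ≤ 0) (hA0 : A 0 = a)
    (hA'0 : deriv A 0 = b) (hne : ∀ t : ℝ, A (I * t) ≠ 0) :
    (∀ n : ℕ, ∃ C : ℝ, ∀ t : ℝ, |t| ^ n * ‖(A (I * t))⁻¹‖ ≤ C) ∧
      ∃ C : ℝ, 0 ≤ C ∧ ∀ t : ℝ, ‖deriv A (I * t) / A (I * t)‖ ≤ C * (1 + |t| ^ 2) := by
  obtain ⟨h1, C1, hC1, h1'⟩ := airy_halfAxis_bounds hA hA' hode ha hb hA0 hA'0 (σ := 1) (by simp)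
  obtain ⟨h2, C2, hC2, h2'⟩ := airy_halfAxis_bounds hA hA' hode ha hb hA0 hA'0 (σ := -1) (by simp)
  refine ⟨fun n => ?_, max C1 C2, le_max_of_le_left hC1, fun t => ?_⟩
  · obtain ⟨D1, hD1⟩ := h1 (2 * n)
    obtain ⟨D2, hD2⟩ := h2 (2 * n)
    refine ⟨√(max D1 D2), fun t => Real.le_sqrt_of_sq_le ?_⟩
    have hpos : 0 < ‖A (I * t)‖ := norm_pos_iff.2 (hne t)
    rw [norm_inv, ← div_eq_mul_inv, div_pow, div_le_iff₀ (by positivity), ← pow_mul, mul_comm n]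
    rcases le_total 0 t with ht | ht
    · have := hD1 t ht
      rw [one_mul] at this
      rw [abs_of_nonneg ht]
      exact this.trans (by gcongr; exact le_max_left _ _)
    · have := hD2 (-t) (by linarith)
      rw [neg_one_mul, neg_neg] at this
      rw [abs_of_nonpos ht]
      exact this.trans (by gcongr; exact le_max_right _ _)
  · have hpos : 0 < ‖A (I * t)‖ := norm_pos_iff.2 (hne t)
    rw [norm_div, div_le_iff₀ hpos]
    refine le_of_sq_le_sq ?_ (by positivity)
    rw [mul_pow, mul_pow]
    rcases le_total 0 t with ht | ht
    · have := h1' t ht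
      rw [one_mul] at this
      rw [abs_of_nonneg ht]
      exact this.trans (by gcongr; exact le_max_left _ _)
    · have := h2' (-t) (by linarith)
      rw [neg_one_mul, neg_neg] at this
      rw [abs_of_nonpos ht]
      exact this.trans (by gcongr; exact le_max_right _ _)

end Axis

section Reciprocal

/-- The functions `P(z, A'/A) / A` with `P` polynomial. When `A` solves the Airy equation, they are
stable under differentiation away from the zeros of `A`. -/
inductive IsAiryReciprocal (A : ℂ → ℂ) : (ℂ → ℂ) → Prop
  | inv : IsAiryReciprocal A fun z => (A z)⁻¹
  | id_mul {h : ℂ → ℂ} : IsAiryReciprocal A h → IsAiryReciprocal A fun z => z * h z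
  | logDeriv_mul {h : ℂ → ℂ} : IsAiryReciprocal A h →
      IsAiryReciprocal A fun z => deriv A z / A z * h z
  | add {h k : ℂ → ℂ} : IsAiryReciprocal A h → IsAiryReciprocal A k →
      IsAiryReciprocal A fun z => h z + k z
  | neg {h : ℂ → ℂ} : IsAiryReciprocal A h → IsAiryReciprocal A fun z => -h z

namespace IsAiryReciprocal

variable {A : ℂ → ℂ}

lemma exists_hasDerivAt (hA : Differentiable ℂ A) (hA' : Differentiable ℂ (deriv A))
    (hode : ∀ z, deriv (deriv A) z = z * A z) {h : ℂ → ℂ} (hh : IsAiryReciprocal A h) :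
    ∃ h' : ℂ → ℂ, IsAiryReciprocal A h' ∧ ∀ z, A z ≠ 0 → HasDerivAt h (h' z) z := by
  induction hh with
  | inv =>
    refine ⟨_, inv.logDeriv_mul.neg, fun z hz => ?_⟩
    refine ((hA z).hasDerivAt.inv hz).congr_deriv ?_
    field_simp
  | id_mul hh ih =>
    obtain ⟨h', hh', H⟩ := ih
    refine ⟨_, hh.add hh'.id_mul, fun z hz => ?_⟩
    exact ((hasDerivAt_id z).mul (H z hz)).congr_deriv (by simp)
  | logDeriv_mul hh ih =>
    obtain ⟨h', hh', H⟩ := ih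
    refine ⟨_, (hh.id_mul.add hh.logDeriv_mul.logDeriv_mul.neg).add hh'.logDeriv_mul,
      fun z hz => ?_⟩
    refine (((hA' z).hasDerivAt.div (hA z).hasDerivAt hz).mul (H z hz)).congr_deriv ?_
    rw [hode]
    simp only [Pi.div_apply]
    field_simp
    ring
  | add _ _ ih₁ ih₂ =>
    obtain ⟨h', hh', H⟩ := ih₁
    obtain ⟨k', hk', K⟩ := ih₂
    exact ⟨_, hh'.add hk', fun z hz => (H z hz).add (K z hz)⟩
  | neg _ ih =>
    obtain ⟨h', hh', H⟩ := ih
    exact ⟨_, hh'.neg, fun z hz => (H z hz).neg⟩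

lemma exists_pow_mul_norm_le (hinv : ∀ n : ℕ, ∃ C : ℝ, ∀ t : ℝ, |t| ^ n * ‖(A (I * t))⁻¹‖ ≤ C)
    {C₀ : ℝ} (hlog : ∀ t : ℝ, ‖deriv A (I * t) / A (I * t)‖ ≤ C₀ * (1 + |t| ^ 2))
    (hC₀ : 0 ≤ C₀) {h : ℂ → ℂ} (hh : IsAiryReciprocal A h) (n : ℕ) :
    ∃ C : ℝ, ∀ t : ℝ, |t| ^ n * ‖h (I * t)‖ ≤ C := by
  induction hh generalizing n with
  | inv => exact hinv n
  | id_mul _ ih =>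
    obtain ⟨C, hC⟩ := ih (n + 1)
    refine ⟨C, fun t => le_of_eq_of_le ?_ (hC t)⟩
    simp only [norm_mul, norm_I, norm_real, Real.norm_eq_abs]
    ring
  | @logDeriv_mul h _ ih =>
    obtain ⟨C, hC⟩ := ih n
    obtain ⟨D, hD⟩ := ih (n + 2)
    refine ⟨C₀ * (C + D), fun t => ?_⟩
    rw [norm_mul]
    calc |t| ^ n * (‖deriv A (I * t) / A (I * t)‖ * ‖h (I * t)‖)
        ≤ |t| ^ n * ((C₀ * (1 + |t| ^ 2)) * ‖h (I * t)‖) := by gcongr; exact hlog t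
      _ = C₀ * (|t| ^ n * ‖h (I * t)‖ + |t| ^ (n + 2) * ‖h (I * t)‖) := by ring
      _ ≤ _ := by gcongr; exacts [hC t, hD t]
  | @add h k _ _ ih₁ ih₂ =>
    obtain ⟨C, hC⟩ := ih₁ n
    obtain ⟨D, hD⟩ := ih₂ n
    refine ⟨C + D, fun t => ?_⟩
    calc |t| ^ n * ‖h (I * t) + k (I * t)‖
        ≤ |t| ^ n * (‖h (I * t)‖ + ‖k (I * t)‖) := by gcongr; exact norm_add_le _ _
      _ ≤ _ := by rw [mul_add]; exact add_le_add (hC t) (hD t)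
  | neg _ ih => simpa using ih n

lemma exists_iteratedDeriv_eq (hA : Differentiable ℂ A) (hA' : Differentiable ℂ (deriv A))
    (hode : ∀ z, deriv (deriv A) z = z * A z) (j : ℕ) :
    ∃ h, IsAiryReciprocal A h ∧
      ∀ z, A z ≠ 0 → iteratedDeriv j (fun z => 1 / A z) z = h z := by
  induction j with
  | zero => exact ⟨_, inv, by simp⟩
  | succ j ih =>
    obtain ⟨h, hh, H⟩ := ih
    obtain ⟨h', hh', H'⟩ := hh.exists_hasDerivAt hA hA' hode
    refine ⟨h', hh', fun z hz => ?_⟩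
    rw [iteratedDeriv_succ, ← (H' z hz).deriv]
    refine Filter.EventuallyEq.deriv_eq ?_
    filter_upwards [hA.continuous.continuousAt.eventually_ne hz] with x hx using H x hx

end IsAiryReciprocal

lemma iteratedDeriv_one_div_airy_comp_I_mul {A : ℂ → ℂ} (hA : Differentiable ℂ A)
    (hA' : Differentiable ℂ (deriv A)) (hode : ∀ z, deriv (deriv A) z = z * A z)
    (hne : ∀ t : ℝ, A (I * t) ≠ 0) (j : ℕ) :
    (iteratedDeriv j fun t : ℝ => 1 / A (I * t)) =
        (fun t : ℝ => I ^ j * iteratedDeriv j (fun z => 1 / A z) (I * t)) ∧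
      Differentiable ℝ (fun t : ℝ => I ^ j * iteratedDeriv j (fun z => 1 / A z) (I * t)) := by
  have hd : ∀ (j : ℕ) (t : ℝ),
      HasDerivAt (fun t : ℝ => I ^ j * iteratedDeriv j (fun z => 1 / A z) (I * t))
        (I ^ (j + 1) * iteratedDeriv (j + 1) (fun z => 1 / A z) (I * t)) t := by
    intro j t
    obtain ⟨h, hh, H⟩ := IsAiryReciprocal.exists_iteratedDeriv_eq hA hA' hode j
    obtain ⟨h', -, H'⟩ := hh.exists_hasDerivAt hA hA' hode
    have h1 : DifferentiableAt ℂ (iteratedDeriv j fun z => 1 / A z) (I * t) := by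
      refine (H' _ (hne t)).differentiableAt.congr_of_eventuallyEq ?_
      filter_upwards [hA.continuous.continuousAt.eventually_ne (hne t)] with x hx using H x hx
    have h2 := hasDerivAt_comp_I_mul (σ := 1) (t := t) (by rw [one_mul]; exact h1.hasDerivAt)
    rw [iteratedDeriv_succ]
    simp only [one_mul, ofReal_one] at h2
    exact (h2.const_mul (I ^ j)).congr_deriv (by ring)
  refine ⟨?_, fun t => (hd j t).differentiableAt⟩
  induction j with
  | zero => simp
  | succ j ih =>
    rw [iteratedDeriv_succ, ih]
    exact funext fun t => (hd j t).deriv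

/-- The reciprocal of an Airy function on the imaginary axis is a Schwartz function. -/
lemma exists_schwartzMap_one_div_airy {A : ℂ → ℂ} (hA : Differentiable ℂ A)
    (hA' : Differentiable ℂ (deriv A)) (hode : ∀ z, deriv (deriv A) z = z * A z)
    {a b : ℝ} (ha : 0 < a) (hb : b ≤ 0) (hA0 : A 0 = a) (hA'0 : deriv A 0 = b)
    (hne : ∀ t : ℝ, A (I * t) ≠ 0) :
    ∃ G : 𝓢(ℝ, ℂ), ∀ t : ℝ, G t = 1 / A (I * t) := by
  have key := iteratedDeriv_one_div_airy_comp_I_mul hA hA' hode hne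
  obtain ⟨hinv, C₀, hC₀, hlog⟩ := airy_axis_bounds hA hA' hode ha hb hA0 hA'0 hne
  refine ⟨⟨fun t : ℝ => 1 / A (I * t), ?_, fun k n => ?_⟩, fun t => rfl⟩
  · refine contDiff_of_differentiable_iteratedDeriv fun m _ => ?_
    rw [(key m).1]
    exact (key m).2
  · obtain ⟨h, hh, H⟩ := IsAiryReciprocal.exists_iteratedDeriv_eq hA hA' hode n
    obtain ⟨C, hC⟩ := hh.exists_pow_mul_norm_le hinv hlog hC₀ k
    refine ⟨C, fun t => le_of_eq_of_le ?_ (hC t)⟩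
    rw [norm_iteratedFDeriv_eq_norm_iteratedDeriv, (key n).1, norm_mul, norm_pow, norm_I,
      one_pow, one_mul, H _ (hne t), Real.norm_eq_abs]

end Reciprocal


theorem chernoff_moment_formula_integration_by_parts (Ai : ℂ → ℂ)
    (hAi_d1 : Differentiable ℂ Ai)
    (hAi_d2 : Differentiable ℂ (deriv Ai))
    (hAi_ode : ∀ z : ℂ, deriv (deriv Ai) z = z * Ai z)
    (hAi_0 : Ai 0 = (3 : ℂ) ^ (-(2 : ℂ) / 3) / Complex.Gamma (2 / 3))
    (hAi_0' : deriv Ai 0 = -(3 : ℂ) ^ (-(1 : ℂ) / 3) / Complex.Gamma (1 / 3))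
    (hAi_zeros : ∀ z : ℂ, Ai z = 0 → ∃ x : ℝ, x < 0 ∧ z = (x : ℂ))
    (g : ℝ → ℝ)
    (hg : ∀ x : ℝ, (g x : ℂ) =
      (1 / (2 * (Real.pi : ℂ))) *
        ∫ t : ℝ, Complex.exp (-(Complex.I * t * x)) * ((Real.sqrt 2 : ℂ) / Ai (Complex.I * t)))
    (f : ℝ → ℝ)
    (hf : ∀ x : ℝ, f x = (1 / 2) * g x * g (-x)) :
    ∀ j k : ℕ,
      ((∫ x : ℝ, x ^ (j + k) * f x : ℝ) : ℂ) =
        ((-1 : ℂ) ^ j / (2 * (Real.pi : ℂ))) *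
          ∫ y : ℝ,
            iteratedDeriv j (fun z : ℂ => 1 / Ai z) (Complex.I * y) *
              iteratedDeriv k (fun z : ℂ => 1 / Ai z) (Complex.I * y) := by
  have hne : ∀ t : ℝ, Ai (I * t) ≠ 0 := by
    intro t h
    obtain ⟨x, hx, h⟩ := hAi_zeros _ h
    have := congrArg re h
    simp at this
    exact hx.ne this.symm
  have h3 : ∀ r : ℝ, ((3 ^ r : ℝ) : ℂ) = (3 : ℂ) ^ (r : ℂ) := fun r => by
    rw [ofReal_cpow (by norm_num)]; norm_num
  obtain ⟨G, hG⟩ := exists_schwartzMap_one_div_airy hAi_d1 hAi_d2 hAi_ode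
    (a := 3 ^ (-(2 : ℝ) / 3) / Real.Gamma (2 / 3)) (b := -3 ^ (-(1 : ℝ) / 3) / Real.Gamma (1 / 3))
    (div_pos (by positivity) (Real.Gamma_pos_of_pos (by norm_num)))
    (div_nonpos_of_nonpos_of_nonneg (neg_nonpos.2 (by positivity))
      (Real.Gamma_pos_of_pos (by norm_num)).le)
    (by rw [hAi_0, ofReal_div, h3, ← Gamma_ofReal]; push_cast; rfl)
    (by rw [hAi_0', ofReal_div, ofReal_neg, h3, ← Gamma_ofReal]; push_cast; rfl) hne
  have hGfun : (G : ℝ → ℂ) = fun t : ℝ => 1 / Ai (I * t) := funext hG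
  have hpi : (Real.pi : ℂ) ≠ 0 := ofReal_ne_zero.2 Real.pi_ne_zero
  have hgF : ∀ x : ℝ, (g x : ℂ) = Real.sqrt 2 / (2 * Real.pi) * 𝓕 G ((2 * Real.pi)⁻¹ * x) := by
    intro x
    rw [hg, fourier_coe, Real.fourier_real_eq_integral_exp_smul, ← integral_const_mul,
      ← integral_const_mul]
    refine integral_congr_ae (.of_forall fun t => ?_)
    simp only [hG, smul_eq_mul]
    have : ((-2 * Real.pi * t * ((2 * Real.pi)⁻¹ * x) : ℝ) : ℂ) * I = -(I * t * x) := by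
      push_cast
      field_simp
    rw [this]
    ring
  intro j k
  have hs : (Real.sqrt 2 : ℂ) * Real.sqrt 2 = 2 := by
    rw [← ofReal_mul, Real.mul_self_sqrt (by norm_num)]; norm_num
  set H : ℝ → ℂ := fun ξ => (2 * Real.pi * ξ : ℂ) ^ (j + k) * (𝓕 G ξ * 𝓕 G (-ξ)) with hH
  have hL : ((∫ x : ℝ, x ^ (j + k) * f x : ℝ) : ℂ) = 1 / (2 * Real.pi) * ∫ ξ, H ξ := by
    have h1 : ∀ x : ℝ, ((x ^ (j + k) * f x : ℝ) : ℂ) =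
        1 / (2 * Real.pi) ^ 2 * H ((2 * Real.pi)⁻¹ * x) := by
      intro x
      rw [hf, hH]
      push_cast
      rw [hgF, hgF, mul_neg]
      have : 2 * (Real.pi : ℂ) * ((2 * (Real.pi : ℂ))⁻¹ * x) = x := by field_simp
      rw [this]
      linear_combination (x ^ (j + k) * (1 / 2 * (1 / (2 * Real.pi)) ^ 2 *
        𝓕 G ((2 * Real.pi)⁻¹ * x) * 𝓕 G (-((2 * Real.pi)⁻¹ * x))) : ℂ) * hs
    rw [← integral_complex_ofReal]
    simp_rw [h1]
    rw [integral_const_mul, Measure.integral_comp_mul_left H, inv_inv,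
      abs_of_pos Real.two_pi_pos, real_smul]
    push_cast
    field_simp
  have hR := G.integral_iteratedDeriv_mul_iteratedDeriv j k
  have hit := fun j => (iteratedDeriv_one_div_airy_comp_I_mul hAi_d1 hAi_d2 hAi_ode hne j).1
  rw [hGfun, hit, hit] at hR
  have hR' : ∫ y : ℝ, iteratedDeriv j (fun z : ℂ => 1 / Ai z) (I * y) *
      iteratedDeriv k (fun z : ℂ => 1 / Ai z) (I * y) = (-1) ^ j * ∫ ξ, H ξ := by
    have hI : (I ^ (j + k) : ℂ) ≠ 0 := pow_ne_zero _ I_ne_zero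
    apply mul_left_cancel₀ hI
    rw [← mul_assoc, ← hR, ← integral_const_mul]
    refine integral_congr_ae (.of_forall fun t => ?_)
    simp only
    ring
  rw [hL, hR']
  have : ((-1 : ℂ) ^ j) * (-1) ^ j = 1 := by rw [← mul_pow]; norm_num
  linear_combination (-(1 / (2 * Real.pi)) * ∫ ξ, H ξ : ℂ) * this
end

section
/- One has (1/(2πi)) ∫_{−i∞}^{i∞} dz/Ai(z)² = 1, i.e. (1/(2π)) ∫_ℝ dy/Ai(iy)² = 1. -/
namespace AiryIntegral

open Set Filter Topology MeasureTheory

/-- The integrand `s ^ k * exp (-s ^ 3 / 3 - w * s)`. -/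
noncomputable def cubicKernel (k : ℕ) (w : ℂ) (s : ℝ) : ℂ :=
  (s : ℂ) ^ k * Complex.exp (-(s : ℂ) ^ 3 / 3 - w * s)

/-- The `k`-th moment on `(0, ∞)` of the weight `exp (-s ^ 3 / 3 - w * s)`. -/
noncomputable def cubicMoment (k : ℕ) (w : ℂ) : ℂ :=
  ∫ s in Ioi (0 : ℝ), cubicKernel k w s

lemma continuous_cubicKernel (k : ℕ) (w : ℂ) : Continuous (cubicKernel k w) := by
  unfold cubicKernel
  fun_prop

lemma norm_cubicKernel (k : ℕ) (w : ℂ) {s : ℝ} (hs : 0 ≤ s) :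
    ‖cubicKernel k w s‖ = s ^ k * Real.exp (-s ^ 3 / 3 - w.re * s) := by
  have h : (-(s : ℂ) ^ 3 / 3 - w * s).re = -s ^ 3 / 3 - w.re * s := by
    have : (-(s : ℂ) ^ 3 / 3) = ((-s ^ 3 / 3 : ℝ) : ℂ) := by push_cast; ring
    rw [this, Complex.sub_re, Complex.ofReal_re, Complex.re_mul_ofReal]
  rw [cubicKernel, norm_mul, norm_pow, Complex.norm_exp, h, Complex.norm_real,
    Real.norm_of_nonneg hs]

lemma linear_sub_cubic_le {M s : ℝ} (hM : 0 ≤ M) (hs : 0 ≤ s) :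
    M * s - s ^ 3 / 3 ≤ M * (3 * M + 1) := by
  rcases le_total s (3 * M + 1) with h | h
  · nlinarith [pow_nonneg hs 3, mul_le_mul_of_nonneg_left h hM]
  · have h1 : 3 * M ≤ s ^ 2 := by nlinarith
    nlinarith [mul_le_mul_of_nonneg_left h1 hs, mul_nonneg hM hM]

lemma norm_cubicKernel_le (k : ℕ) {w : ℂ} {R : ℝ} (hw : ‖w‖ ≤ R) {s : ℝ} (hs : 0 ≤ s) :
    ‖cubicKernel k w s‖ ≤
      k.factorial * Real.exp ((R + 2) * (3 * (R + 2) + 1)) * Real.exp (-1 * s) := by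
  have hR : 0 ≤ R + 2 := by linarith [norm_nonneg w]
  have h1 : s ^ k ≤ k.factorial * Real.exp s := by
    have := Real.pow_div_factorial_le_exp s hs k
    rwa [div_le_iff₀' (by positivity)] at this
  have h2 : -w.re * s ≤ R * s :=
    mul_le_mul_of_nonneg_right
      ((neg_le_abs _).trans ((Complex.abs_re_le_norm w).trans hw)) hs
  have h3 := linear_sub_cubic_le hR hs
  rw [norm_cubicKernel k w hs]
  calc s ^ k * Real.exp (-s ^ 3 / 3 - w.re * s)
      ≤ (k.factorial * Real.exp s) *
          Real.exp ((R + 2) * (3 * (R + 2) + 1) + -2 * s) := by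
        gcongr
        linarith
    _ = _ := by
        rw [mul_assoc, mul_assoc, ← Real.exp_add, ← Real.exp_add]
        ring_nf

lemma integrableOn_cubicKernel (k : ℕ) (w : ℂ) :
    IntegrableOn (cubicKernel k w) (Ioi 0) := by
  refine Integrable.mono' ((exp_neg_integrableOn_Ioi 0 one_pos).const_mul
    (k.factorial * Real.exp ((‖w‖ + 2) * (3 * (‖w‖ + 2) + 1))))
    (continuous_cubicKernel k w).aestronglyMeasurable ?_
  exact (ae_restrict_iff' measurableSet_Ioi).2
    (.of_forall fun s hs => norm_cubicKernel_le k le_rfl (le_of_lt hs))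

lemma hasDerivAt_cubicMoment (k : ℕ) (w : ℂ) :
    HasDerivAt (cubicMoment k) (-cubicMoment (k + 1) w) w := by
  have key := hasDerivAt_integral_of_dominated_loc_of_deriv_le
    (μ := volume.restrict (Ioi (0 : ℝ))) (F := cubicKernel k)
    (F' := fun w s => -cubicKernel (k + 1) w s) (x₀ := w)
    (bound := fun s => (k + 1).factorial *
      Real.exp ((‖w‖ + 1 + 2) * (3 * (‖w‖ + 1 + 2) + 1)) * Real.exp (-1 * s))
    (Metric.ball_mem_nhds w one_pos)
    (.of_forall fun z => (continuous_cubicKernel k z).aestronglyMeasurable)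
    (integrableOn_cubicKernel k w)
    (continuous_cubicKernel (k + 1) w).neg.aestronglyMeasurable
    ((ae_restrict_iff' measurableSet_Ioi).2 (.of_forall fun s hs z hz => ?_))
    ((exp_neg_integrableOn_Ioi 0 one_pos).const_mul _)
    (.of_forall fun s z _ => ?_)
  · have h := key.2
    rw [integral_neg] at h
    exact h
  · rw [norm_neg]
    refine norm_cubicKernel_le (k + 1) ?_ (le_of_lt hs)
    have h1 : ‖z - w‖ < 1 := mem_ball_iff_norm.1 hz
    linarith [norm_le_norm_add_norm_sub' z w]
  · have h1 : HasDerivAt (fun z : ℂ => -(s : ℂ) ^ 3 / 3 - z * s) (-(s : ℂ)) z := by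
      simpa using ((hasDerivAt_id z).mul_const (s : ℂ)).const_sub (-(s : ℂ) ^ 3 / 3)
    refine (h1.cexp.const_mul ((s : ℂ) ^ k)).congr_deriv ?_
    simp only [cubicKernel]
    ring

lemma cubicMoment_two_add (w : ℂ) : cubicMoment 2 w + w * cubicMoment 0 w = 1 := by
  have hder : ∀ s ∈ Ici (0 : ℝ), HasDerivAt (cubicKernel 0 w)
      (-(cubicKernel 2 w s + w * cubicKernel 0 w s)) s := by
    intro s _
    have h0 : HasDerivAt (fun s : ℂ => -s ^ 3 / 3 - w * s) (-(s : ℂ) ^ 2 - w) (s : ℂ) := by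
      have := ((hasDerivAt_pow 3 (s : ℂ)).neg.div_const 3).sub
        ((hasDerivAt_id (s : ℂ)).const_mul w)
      refine this.congr_deriv ?_
      push_cast
      simp
      ring
    have h1 := (h0.cexp.const_mul ((s : ℂ) ^ 0)).comp_ofReal
    refine (h1.congr_deriv ?_).congr_of_eventuallyEq (.of_forall fun t => ?_)
    · simp only [cubicKernel]
      ring
    · simp [cubicKernel]
  have hint : IntegrableOn (fun s => cubicKernel 2 w s + w * cubicKernel 0 w s) (Ioi 0) :=
    (integrableOn_cubicKernel 2 w).add ((integrableOn_cubicKernel 0 w).const_mul w)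
  have hlim : Tendsto (cubicKernel 0 w) atTop (𝓝 0) := by
    refine squeeze_zero_norm' ((eventually_ge_atTop 0).mono fun s hs =>
      norm_cubicKernel_le 0 le_rfl hs) ?_
    rw [← mul_zero (Nat.factorial 0 * Real.exp ((‖w‖ + 2) * (3 * (‖w‖ + 2) + 1)))]
    refine Tendsto.const_mul _ ?_
    simpa using Real.tendsto_exp_neg_atTop_nhds_zero
  have h := integral_Ioi_of_hasDerivAt_of_tendsto' hder hint.neg hlim
  rw [integral_neg, integral_add (integrableOn_cubicKernel 2 w)
    ((integrableOn_cubicKernel 0 w).const_mul w), integral_const_mul] at h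
  have h0 : cubicKernel 0 w 0 = 1 := by simp [cubicKernel]
  rw [h0, zero_sub, neg_inj] at h
  exact h

lemma norm_cubicMoment_zero_le {w : ℂ} (hw : 0 ≤ w.re) :
    ‖cubicMoment 0 w‖ ≤ ∫ s in Ioi (0 : ℝ), ‖cubicKernel 0 0 s‖ := by
  refine (norm_integral_le_integral_norm _).trans
    (setIntegral_mono_on (integrableOn_cubicKernel 0 w).norm
      (integrableOn_cubicKernel 0 0).norm measurableSet_Ioi fun s hs => ?_)
  have hs' : 0 ≤ s := le_of_lt hs
  rw [norm_cubicKernel 0 w hs', norm_cubicKernel 0 0 hs']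
  refine mul_le_mul_of_nonneg_left (Real.exp_le_exp.2 ?_) (pow_nonneg hs' 0)
  rw [Complex.zero_re]
  nlinarith

lemma cubicMoment_at_zero (k : ℕ) :
    cubicMoment k 0 =
      (((3 : ℝ) ^ (((k : ℝ) + 1) / 3) / 3 * Real.Gamma (((k : ℝ) + 1) / 3) : ℝ) : ℂ) := by
  have h := integral_rpow_mul_exp_neg_mul_rpow (p := 3) (q := k) (b := 1 / 3)
    (by norm_num) (by linarith [Nat.cast_nonneg (α := ℝ) k]) (by norm_num)
  have h3 : ((1 : ℝ) / 3) ^ (-((k : ℝ) + 1) / 3) = 3 ^ (((k : ℝ) + 1) / 3) := by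
    rw [one_div, Real.inv_rpow (by norm_num), ← Real.rpow_neg (by norm_num)]
    ring_nf
  rw [h3, ← mul_div_assoc, mul_one] at h
  rw [← h, cubicMoment, ← integral_complex_ofReal]
  refine integral_congr_ae (.of_forall fun s => ?_)
  have : (s : ℝ) ^ (3 : ℝ) = s ^ 3 := by exact_mod_cast Real.rpow_natCast s 3
  simp only [cubicKernel, this, Real.rpow_natCast]
  push_cast
  ring_nf

lemma le_of_hasDerivAt_nonneg {f f' : ℝ → ℝ} (hf : ∀ x, HasDerivAt f (f' x) x)
    (hf' : ∀ x, 0 ≤ x → 0 ≤ f' x) {y : ℝ} (hy : 0 ≤ y) : f 0 ≤ f y := by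
  refine monotoneOn_of_deriv_nonneg (convex_Ici 0)
    (fun x _ => (hf x).continuousAt.continuousWithinAt)
    (fun x _ => (hf x).differentiableAt.differentiableWithinAt)
    (fun x hx => ?_) self_mem_Ici hy hy
  rw [interior_Ici] at hx
  rw [(hf x).deriv]
  exact hf' x (le_of_lt hx)

/-- Along a ray of the imaginary axis, the squared modulus of a solution of the Airy equation with
real initial values of opposite signs grows at least quadratically. -/
lemma growth_of_system {u v u₁ v₁ : ℝ → ℝ} {σ p q : ℝ} (hσ : σ ^ 2 = 1) (hp : 0 < p) (hq : 0 < q)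
    (hu : ∀ y, HasDerivAt u (u₁ y) y) (hv : ∀ y, HasDerivAt v (v₁ y) y)
    (hu₁ : ∀ y, HasDerivAt u₁ (σ * y * v y) y) (hv₁ : ∀ y, HasDerivAt v₁ (-(σ * y * u y)) y)
    (hu0 : u 0 = p) (hv0 : v 0 = 0) (hu₁0 : u₁ 0 = 0) (hv₁0 : v₁ 0 = -(σ * q))
    {y : ℝ} (hy : 0 ≤ y) : p ^ 2 + q ^ 2 * y ^ 2 ≤ u y ^ 2 + v y ^ 2 := by
  have hh : ∀ y, 0 ≤ y → 0 ≤ σ * (v y * u₁ y - u y * v₁ y) := by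
    intro y hy
    have := le_of_hasDerivAt_nonneg (f := fun y => σ * (v y * u₁ y - u y * v₁ y))
      (f' := fun y => y * (u y ^ 2 + v y ^ 2))
      (fun x => ((((hv x).mul (hu₁ x)).sub ((hu x).mul (hv₁ x))).const_mul σ).congr_deriv (by
        linear_combination x * (u x ^ 2 + v x ^ 2) * hσ))
      (fun x hx => by positivity) hy
    simp only [hu0, hv0, hu₁0, hv₁0] at this
    nlinarith [mul_pos hp hq]
  have hk : ∀ y, 0 ≤ y → q ^ 2 ≤ u₁ y ^ 2 + v₁ y ^ 2 := by
    intro y hy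
    have := le_of_hasDerivAt_nonneg (f := fun y => u₁ y ^ 2 + v₁ y ^ 2)
      (f' := fun y => 2 * (y * (σ * (v y * u₁ y - u y * v₁ y))))
      (fun x => (((hu₁ x).pow 2).add ((hv₁ x).pow 2)).congr_deriv (by
        push_cast
        ring))
      (fun x hx => mul_nonneg two_pos.le (mul_nonneg hx (hh x hx))) hy
    simp only [hu₁0, hv₁0] at this
    nlinarith
  have hm : ∀ y, 0 ≤ y → q ^ 2 * y ≤ u y * u₁ y + v y * v₁ y := by
    intro y hy
    have := le_of_hasDerivAt_nonneg (f := fun y => u y * u₁ y + v y * v₁ y - q ^ 2 * y)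
      (f' := fun y => u₁ y ^ 2 + v₁ y ^ 2 - q ^ 2)
      (fun x => ((((hu x).mul (hu₁ x)).add ((hv x).mul (hv₁ x))).sub
        ((hasDerivAt_id x).const_mul (q ^ 2))).congr_deriv (by ring))
      (fun x hx => sub_nonneg.2 (hk x hx)) hy
    simp only [hv0, hu₁0] at this
    linarith
  have := le_of_hasDerivAt_nonneg (f := fun y => u y ^ 2 + v y ^ 2 - q ^ 2 * y ^ 2)
    (f' := fun y => 2 * (u y * u₁ y + v y * v₁ y - q ^ 2 * y))
    (fun x => ((((hu x).pow 2).add ((hv x).pow 2)).sub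
      ((hasDerivAt_pow 2 x).const_mul (q ^ 2))).congr_deriv (by
        push_cast
        ring))
    (fun x hx => mul_nonneg two_pos.le (sub_nonneg.2 (hm x hx))) hy
  simp only [hu0, hv0] at this
  linarith

/-- `w'' = z w` for an entire function `w` with derivative `w₁`. -/
structure IsAirySolution (w w₁ : ℂ → ℂ) : Prop where
  hasDerivAt : ∀ z, HasDerivAt w (w₁ z) z
  hasDerivAt_deriv : ∀ z, HasDerivAt w₁ (z * w z) z

lemma IsAirySolution.wronskian_eq {w w₁ x x₁ : ℂ → ℂ} (hw : IsAirySolution w w₁)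
    (hx : IsAirySolution x x₁) (z : ℂ) :
    x₁ z * w z - x z * w₁ z = x₁ 0 * w 0 - x 0 * w₁ 0 := by
  have hd : ∀ z, HasDerivAt (fun z => x₁ z * w z - x z * w₁ z) 0 z := fun z =>
    (((hx.hasDerivAt_deriv z).mul (hw.hasDerivAt z)).sub
      ((hx.hasDerivAt z).mul (hw.hasDerivAt_deriv z))).congr_deriv (by ring)
  exact is_const_of_deriv_eq_zero (fun z => (hd z).differentiableAt) (fun z => (hd z).deriv) z 0

lemma hasDerivAt_comp_mul_ofReal {f : ℂ → ℂ} {f' : ℂ} (τ : ℂ) (y : ℝ)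
    (hf : HasDerivAt f f' (τ * y)) : HasDerivAt (fun y : ℝ => f (τ * y)) (τ * f') y := by
  have h : HasDerivAt (fun y : ℝ => τ * (y : ℂ)) τ y := by
    simpa using ((hasDerivAt_id (y : ℂ)).const_mul τ).comp_ofReal
  exact (hf.comp y h).congr_deriv (mul_comm _ _)

lemma IsAirySolution.growth {w w₁ : ℂ → ℂ} (hw : IsAirySolution w w₁) {σ p q : ℝ}
    (hσ : σ ^ 2 = 1) (hp : 0 < p) (hq : 0 < q) (h0 : w 0 = p) (h1 : w₁ 0 = -q)
    {y : ℝ} (hy : 0 ≤ y) : p ^ 2 + q ^ 2 * y ^ 2 ≤ ‖w (σ * Complex.I * y)‖ ^ 2 := by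
  have hre : ∀ {f : ℝ → ℂ} {f' : ℂ} {y : ℝ}, HasDerivAt f f' y →
      HasDerivAt (fun y => (f y).re) f'.re y := fun h =>
    Complex.reCLM.hasFDerivAt.comp_hasDerivAt _ h
  have him : ∀ {f : ℝ → ℂ} {f' : ℂ} {y : ℝ}, HasDerivAt f f' y →
      HasDerivAt (fun y => (f y).im) f'.im y := fun h =>
    Complex.imCLM.hasFDerivAt.comp_hasDerivAt _ h
  set τ : ℂ := σ * Complex.I with hτ
  have hτ2 : τ * τ = -1 := by
    have : (σ : ℂ) ^ 2 = 1 := by exact_mod_cast hσ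
    rw [hτ]
    linear_combination (σ : ℂ) ^ 2 * Complex.I_sq - this
  have d0 := fun y : ℝ => hasDerivAt_comp_mul_ofReal τ y (hw.hasDerivAt (τ * y))
  have d1 : ∀ y : ℝ, HasDerivAt (fun y : ℝ => τ * w₁ (τ * y))
      (-(σ * Complex.I * y * w (τ * y))) y := fun y =>
    ((hasDerivAt_comp_mul_ofReal τ y (hw.hasDerivAt_deriv (τ * y))).const_mul τ).congr_deriv (by
      rw [← hτ]
      linear_combination τ * y * w (τ * y) * hτ2)
  rw [← Complex.normSq_eq_norm_sq, Complex.normSq_apply, ← sq, ← sq]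
  refine growth_of_system (u := fun y : ℝ => (w (τ * y)).re) (v := fun y : ℝ => (w (τ * y)).im)
    hσ hp hq (fun y => hre (d0 y)) (fun y => him (d0 y))
    (fun y => (hre (d1 y)).congr_deriv ?_) (fun y => (him (d1 y)).congr_deriv ?_)
    ?_ ?_ ?_ ?_ hy
  all_goals simp [hτ, h0, h1]

/-- Integral of `1 / w ^ 2` over a ray of the imaginary axis, in terms of a second solution that is
bounded on this ray. -/
lemma IsAirySolution.integral_ray {w w₁ x x₁ : ℂ → ℂ} (hw : IsAirySolution w w₁)
    (hx : IsAirySolution x x₁) {σ p q C : ℝ}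
    (hσ : σ ^ 2 = 1) (hp : 0 < p) (hq : 0 < q) (h0 : w 0 = p) (h1 : w₁ 0 = -q)
    (hC : ∀ y : ℝ, 0 ≤ y → ‖x (σ * Complex.I * y)‖ ≤ C) :
    IntegrableOn (fun y : ℝ => 1 / w (σ * Complex.I * y) ^ 2) (Ioi 0) ∧
    σ * Complex.I * (x₁ 0 * p + x 0 * q) *
      ∫ y in Ioi (0 : ℝ), 1 / w (σ * Complex.I * y) ^ 2 = -(x 0 / p) := by
  have hgrow := fun (y : ℝ) (hy : 0 ≤ y) => hw.growth hσ hp hq h0 h1 hy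
  set τ : ℂ := σ * Complex.I with hτ
  have hpos : ∀ y : ℝ, 0 ≤ y → 0 < ‖w (τ * y)‖ ^ 2 := fun y hy =>
    lt_of_lt_of_le (by positivity) (hgrow y hy)
  have hne : ∀ y : ℝ, 0 ≤ y → w (τ * y) ≠ 0 := fun y hy h => by
    have := hpos y hy
    simp [h] at this
  have hwc : Continuous fun y : ℝ => w (τ * y) :=
    continuous_iff_continuousAt.2 fun y =>
      (hasDerivAt_comp_mul_ofReal τ y (hw.hasDerivAt (τ * y))).continuousAt
  have hint : IntegrableOn (fun y : ℝ => 1 / w (τ * y) ^ 2) (Ioi 0) := by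
    obtain ⟨c, hc, hcp, hcq⟩ : ∃ c : ℝ, 0 < c ∧ c ≤ p ^ 2 ∧ c ≤ q ^ 2 :=
      ⟨min (p ^ 2) (q ^ 2), by positivity, min_le_left _ _, min_le_right _ _⟩
    refine Integrable.mono' (g := fun y : ℝ => c⁻¹ * (1 + y ^ 2)⁻¹)
      (integrable_inv_one_add_sq.const_mul _).integrableOn ?_ ?_
    · exact (ContinuousOn.div continuousOn_const (hwc.pow 2).continuousOn
        fun y hy => pow_ne_zero 2 (hne y (le_of_lt hy))).aestronglyMeasurable measurableSet_Ioi
    · refine (ae_restrict_iff' measurableSet_Ioi).2 (.of_forall fun y hy => ?_)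
      rw [norm_div, norm_one, norm_pow, one_div, ← mul_inv]
      refine inv_anti₀ (by positivity) (le_trans ?_ (hgrow y (le_of_lt hy)))
      nlinarith [mul_le_mul_of_nonneg_right hcq (sq_nonneg y)]
  refine ⟨hint, ?_⟩
  have hder : ∀ y ∈ Ici (0 : ℝ), HasDerivAt (fun y : ℝ => x (τ * y) / w (τ * y))
      (τ * (x₁ 0 * p + x 0 * q) * (1 / w (τ * y) ^ 2)) y := by
    intro y hy
    refine ((hasDerivAt_comp_mul_ofReal τ y (hx.hasDerivAt (τ * y))).div
      (hasDerivAt_comp_mul_ofReal τ y (hw.hasDerivAt (τ * y))) (hne y hy)).congr_deriv ?_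
    have hW := hw.wronskian_eq hx (τ * y)
    rw [h0, h1] at hW
    rw [mul_one_div]
    congr 1
    linear_combination τ * hW
  have hlim : Tendsto (fun y : ℝ => x (τ * y) / w (τ * y)) atTop (𝓝 0) := by
    have hb : ∀ y : ℝ, 0 < y → ‖x (τ * y) / w (τ * y)‖ ≤ C / q / y := by
      intro y hy
      have h2 : q * y ≤ ‖w (τ * y)‖ := by
        refine abs_le_of_sq_le_sq' ?_ (norm_nonneg _) |>.2
        have := hgrow y hy.le
        nlinarith [sq_nonneg p]
      rw [norm_div, div_div]
      have hC0 : 0 ≤ C := (norm_nonneg _).trans (hC y hy.le)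
      exact div_le_div₀ hC0 (hC y hy.le) (by positivity) h2
    exact squeeze_zero_norm' ((eventually_gt_atTop 0).mono hb)
      (tendsto_const_nhds.div_atTop tendsto_id)
  have h := integral_Ioi_of_hasDerivAt_of_tendsto' hder (hint.const_mul _) hlim
  rw [integral_const_mul] at h
  rw [h]
  simp [h0]

lemma isAirySolution_cubicPair {a b : ℂ} (ha : a ^ 3 = -1) (hb : b ^ 3 = -1) :
    IsAirySolution (fun z => a * cubicMoment 0 (a * z) - b * cubicMoment 0 (b * z))
      (fun z => b ^ 2 * cubicMoment 1 (b * z) - a ^ 2 * cubicMoment 1 (a * z)) := by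
  have hd : ∀ (k : ℕ) (c z : ℂ), HasDerivAt (fun z => cubicMoment k (c * z))
      (-c * cubicMoment (k + 1) (c * z)) z := fun k c z =>
    ((hasDerivAt_cubicMoment k (c * z)).comp z
      ((hasDerivAt_id z).const_mul c)).congr_deriv (by simp [mul_comm])
  refine ⟨fun z => ?_, fun z => ?_⟩
  · exact (((hd 0 a z).const_mul a).sub ((hd 0 b z).const_mul b)).congr_deriv (by ring)
  · refine (((hd 1 b z).const_mul (b ^ 2)).sub ((hd 1 a z).const_mul (a ^ 2))).congr_deriv ?_
    linear_combination cubicMoment 2 (a * z) * ha - cubicMoment 2 (b * z) * hb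
      - cubicMoment_two_add (a * z) + cubicMoment_two_add (b * z)

lemma norm_cubicPair_le {a b z : ℂ} (ha : 0 ≤ (a * z).re) (hb : 0 ≤ (b * z).re) :
    ‖a * cubicMoment 0 (a * z) - b * cubicMoment 0 (b * z)‖ ≤
      (‖a‖ + ‖b‖) * ∫ s in Ioi (0 : ℝ), ‖cubicKernel 0 0 s‖ := by
  refine (norm_sub_le _ _).trans ?_
  rw [norm_mul, norm_mul, add_mul]
  have h1 := norm_cubicMoment_zero_le ha
  have h2 := norm_cubicMoment_zero_le hb
  gcongr

lemma sqrt_three_mul_Gamma_mul_Gamma :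
    √3 * (Real.Gamma (1 / 3) * Real.Gamma (2 / 3)) = 2 * Real.pi := by
  have h := Real.Gamma_mul_Gamma_one_sub (1 / 3)
  rw [show (1 : ℝ) - 1 / 3 = 2 / 3 by norm_num,
    show Real.pi * (1 / 3) = Real.pi / 3 by ring, Real.sin_pi_div_three] at h
  rw [h]
  field_simp

/-- The integral of `1 / Ai ^ 2` over half of the imaginary axis. -/
lemma IsAirySolution.integral_airy_ray {w w₁ : ℂ → ℂ} (hw : IsAirySolution w w₁)
    (h0 : w 0 = (((3 : ℝ) ^ (-(2 : ℝ) / 3) / Real.Gamma (2 / 3) : ℝ) : ℂ))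
    (h1 : w₁ 0 = -(((3 : ℝ) ^ (-(1 : ℝ) / 3) / Real.Gamma (1 / 3) : ℝ) : ℂ))
    {σ : ℝ} (hσ : σ ^ 2 = 1) :
    IntegrableOn (fun y : ℝ => 1 / w (σ * Complex.I * y) ^ 2) (Ioi 0) ∧
    ∫ y in Ioi (0 : ℝ), 1 / w (σ * Complex.I * y) ^ 2 =
      Real.pi + σ * Complex.I * (Real.pi * √3 : ℝ) := by
  have hΓ := sqrt_three_mul_Gamma_mul_Gamma
  have hk0 := cubicMoment_at_zero 0
  have hk1 := cubicMoment_at_zero 1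
  norm_num at hk0 hk1
  have hg1 : 0 < Real.Gamma (1 / 3) := Real.Gamma_pos_of_pos (by norm_num)
  have hg2 : 0 < Real.Gamma (2 / 3) := Real.Gamma_pos_of_pos (by norm_num)
  have hr : 0 < (3 : ℝ) ^ ((1 : ℝ) / 3) := by positivity
  have hr3 : ((3 : ℝ) ^ ((1 : ℝ) / 3)) ^ 3 = 3 := by
    rw [← Real.rpow_natCast, ← Real.rpow_mul (by norm_num)]
    norm_num
  have hr2 : (3 : ℝ) ^ ((2 : ℝ) / 3) = ((3 : ℝ) ^ ((1 : ℝ) / 3)) ^ 2 := by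
    rw [← Real.rpow_natCast, ← Real.rpow_mul (by norm_num)]
    norm_num
  rw [neg_div, Real.rpow_neg (by norm_num)] at h0 h1
  rw [hr2] at h0 hk1
  set r : ℝ := (3 : ℝ) ^ ((1 : ℝ) / 3)
  set g₁ : ℝ := Real.Gamma (1 / 3)
  set g₂ : ℝ := Real.Gamma (2 / 3)
  obtain ⟨p, hp⟩ : ∃ p : ℝ, p = (r ^ 2)⁻¹ / g₂ := ⟨_, rfl⟩
  obtain ⟨q, hq⟩ : ∃ q : ℝ, q = r⁻¹ / g₁ := ⟨_, rfl⟩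
  obtain ⟨m₀, hm₀⟩ : ∃ m : ℝ, m = r / 3 * g₁ := ⟨_, rfl⟩
  obtain ⟨m₁, hm₁⟩ : ∃ m : ℝ, m = r ^ 2 / 3 * g₂ := ⟨_, rfl⟩
  have hp0 : 0 < p := by rw [hp]; positivity
  have hq0 : 0 < q := by rw [hq]; positivity
  have hpm : (p * (2 * Real.pi) : ℂ) = (√3 : ℝ) * m₀ := by
    have : p * (2 * Real.pi) = √3 * m₀ := by
      rw [hp, hm₀]
      field_simp
      linear_combination -3 * hΓ - √3 * g₁ * g₂ * hr3
    exact_mod_cast this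
  have hqm : (q * (2 * Real.pi) : ℂ) = (√3 : ℝ) * m₁ := by
    have : q * (2 * Real.pi) = √3 * m₁ := by
      rw [hq, hm₁]
      field_simp
      linear_combination -3 * hΓ - √3 * g₁ * g₂ * hr3
    exact_mod_cast this
  have hmm : (3 * (√3 : ℝ) * (m₀ * m₁) : ℂ) = 2 * Real.pi := by
    have : 3 * √3 * (m₀ * m₁) = 2 * Real.pi := by
      rw [hm₀, hm₁]
      linear_combination hΓ + √3 * g₁ * g₂ / 3 * hr3
    exact_mod_cast this
  replace hk0 : cubicMoment 0 0 = m₀ := by rw [hk0, hm₀]; push_cast; ring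
  replace hk1 : cubicMoment 1 0 = m₁ := by rw [hk1, hm₁]; push_cast; ring
  rw [← hp] at h0
  rw [← hq] at h1
  have hσc : (σ : ℂ) ^ 2 = 1 := by exact_mod_cast hσ
  have h3 : ((√3 : ℝ) : ℂ) ^ 2 = 3 := by
    exact_mod_cast Real.sq_sqrt (by norm_num : (0 : ℝ) ≤ 3)
  have hI := Complex.I_sq
  have hπ : (2 * Real.pi : ℂ) ≠ 0 := by exact_mod_cast Real.two_pi_pos.ne'
  have hpc : (p : ℂ) ≠ 0 := by exact_mod_cast hp0.ne'
  have h3c : ((√3 : ℝ) : ℂ) ≠ 0 := by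
    exact_mod_cast (Real.sqrt_pos.2 (by norm_num : (0 : ℝ) < 3)).ne'
  obtain ⟨b, hb⟩ : ∃ b : ℂ, b = (1 - σ * Complex.I * (√3 : ℝ)) / 2 := ⟨_, rfl⟩
  have hb2 : b ^ 2 = b - 1 := by
    rw [hb]
    linear_combination (Complex.I ^ 2 * ((√3 : ℝ) : ℂ) ^ 2 / 4) * hσc
      + ((√3 : ℝ) : ℂ) ^ 2 / 4 * hI - h3 / 4
  have hb3 : b ^ 3 = -1 := by linear_combination (b + 1) * hb2
  obtain ⟨hint, hJ⟩ := hw.integral_ray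
    (isAirySolution_cubicPair (a := -1) (by norm_num) hb3) hσ hp0 hq0 h0 h1
    (fun y hy => norm_cubicPair_le (by simp) (by
      have : b * (σ * Complex.I * y) =
          ((√3 / 2 * y : ℝ) : ℂ) + ((σ * y / 2 : ℝ) : ℂ) * Complex.I := by
        rw [hb]
        push_cast
        linear_combination -((√3 : ℝ) : ℂ) * y / 2 * (Complex.I ^ 2 * hσc + hI)
      rw [this]
      simp
      positivity))
  refine ⟨hint, ?_⟩
  set J := ∫ y in Ioi (0 : ℝ), 1 / w (σ * Complex.I * y) ^ 2
  simp only [mul_zero, hk0, hk1] at hJ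
  have hW : (b ^ 2 * m₁ - (-1) ^ 2 * m₁) * p + (-1 * m₀ - b * m₀) * (q : ℂ) = -1 := by
    refine mul_right_cancel₀ hπ ?_
    linear_combination (b ^ 2 - 1) * m₁ * hpm - (1 + b) * m₀ * hqm - hmm
      + (√3 : ℝ) * m₀ * m₁ * hb2
  rw [hW, eq_comm, ← neg_div, div_eq_iff hpc] at hJ
  have he : (σ * Complex.I) ^ 2 = -1 := by rw [mul_pow, hσc, hI, one_mul]
  rw [hb] at hJ
  generalize (σ * Complex.I : ℂ) = e at he hJ ⊢
  refine mul_right_cancel₀ (mul_ne_zero hpc hπ) ?_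
  push_cast
  linear_combination 2 * Real.pi * (-e) * hJ + 2 * Real.pi * J * p * he
    - (Real.pi + e * Real.pi * (√3 : ℝ)) * hpm - e * Real.pi * m₀ * h3
    - Real.pi * m₀ * (√3 : ℝ) * he

theorem integral_eq {w w₁ : ℂ → ℂ} (hw : IsAirySolution w w₁)
    (h0 : w 0 = (((3 : ℝ) ^ (-(2 : ℝ) / 3) / Real.Gamma (2 / 3) : ℝ) : ℂ))
    (h1 : w₁ 0 = -(((3 : ℝ) ^ (-(1 : ℝ) / 3) / Real.Gamma (1 / 3) : ℝ) : ℂ)) :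
    ∫ y : ℝ, 1 / w (Complex.I * y) ^ 2 = 2 * (Real.pi : ℂ) := by
  obtain ⟨hip, hp⟩ := hw.integral_airy_ray h0 h1 (σ := 1) (by norm_num)
  obtain ⟨him, hm⟩ := hw.integral_airy_ray h0 h1 (σ := -1) (by norm_num)
  have hneg : (fun y : ℝ => 1 / w (((-1 : ℝ) : ℂ) * Complex.I * y) ^ 2) =
      fun y : ℝ => (fun y : ℝ => 1 / w (Complex.I * y) ^ 2) (-y) := by
    ext y
    simp
  rw [hneg] at him hm
  rw [integral_comp_neg_Ioi 0 (fun y : ℝ => 1 / w (Complex.I * y) ^ 2), neg_zero] at hm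
  simp only [Complex.ofReal_one, one_mul] at hip hp
  have him' : IntegrableOn (fun y : ℝ => 1 / w (Complex.I * y) ^ 2) (Iic 0) := by
    rw [integrableOn_Iic_iff_integrableOn_Iio]
    simpa using him.comp_neg
  rw [← intervalIntegral.integral_Iic_add_Ioi him' hip, hm, hp]
  push_cast
  ring

end AiryIntegral

theorem airy_inverse_square_integral_eq_one (Ai : ℂ → ℂ)
    (hAi_d1 : Differentiable ℂ Ai)
    (hAi_d2 : Differentiable ℂ (deriv Ai))
    (hAi_ode : ∀ z : ℂ, deriv (deriv Ai) z = z * Ai z)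
    (hAi_0 : Ai 0 = (3 : ℂ) ^ (-(2 : ℂ) / 3) / Complex.Gamma (2 / 3))
    (hAi_0' : deriv Ai 0 = -(3 : ℂ) ^ (-(1 : ℂ) / 3) / Complex.Gamma (1 / 3))
    (hAi_zeros : ∀ z : ℂ, Ai z = 0 → ∃ x : ℝ, x < 0 ∧ z = (x : ℂ)) :
    (1 / (2 * (Real.pi : ℂ))) * ∫ y : ℝ, 1 / (Ai (Complex.I * y)) ^ 2 = 1 := by
  have hw : AiryIntegral.IsAirySolution Ai (deriv Ai) :=
    ⟨fun z => (hAi_d1 z).hasDerivAt, fun z => hAi_ode z ▸ (hAi_d2 z).hasDerivAt⟩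
  rw [AiryIntegral.integral_eq hw]
  · have : (Real.pi : ℂ) ≠ 0 := by exact_mod_cast Real.pi_ne_zero
    field_simp
  · rw [hAi_0, Complex.ofReal_div, Complex.ofReal_cpow (by norm_num), ← Complex.Gamma_ofReal]
    push_cast
    rfl
  · rw [hAi_0', Complex.ofReal_div, Complex.ofReal_cpow (by norm_num), ← Complex.Gamma_ofReal,
      neg_div]
    push_cast
    rfl
end

section
/- For all integers j, k ≥ 0 and ℓ > k, one has j·I(j−1, k, ℓ) + k·I(j+1, k−1, ℓ−1) − ℓ·I(j, k+1, ℓ+1) = 0, where by convention I(j', k', ℓ') = 0 whenever j' < 0 or k' < 0. -/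
/-- The contour integral `I(j,k,ℓ)` along the imaginary axis:
`(1/(2πi)) ∫_{-i∞}^{i∞} z^j · Ai'(z)^k / Ai(z)^ℓ dz = (1/(2π)) ∫_ℝ (iy)^j · Ai'(iy)^k / Ai(iy)^ℓ dy`. -/
noncomputable def airyI (Ai : ℂ → ℂ) (j k l : ℕ) : ℂ :=
  (1 / (2 * (Real.pi : ℂ))) *
    ∫ y : ℝ, (Complex.I * y) ^ j * (deriv Ai (Complex.I * y)) ^ k / (Ai (Complex.I * y)) ^ l

/-- Growth of real solutions of the system `p'' = y q`, `q'' = -y p`, the real form of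
`w'' = -i y w`. -/
theorem rotated_airy_growth {p q p₁ q₁ : ℝ → ℝ}
    (hp : ∀ y, HasDerivAt p (p₁ y) y) (hq : ∀ y, HasDerivAt q (q₁ y) y)
    (hp₁ : ∀ y, HasDerivAt p₁ (y * q y) y) (hq₁ : ∀ y, HasDerivAt q₁ (-(y * p y)) y)
    (hR0 : 0 ≤ p 0 * p₁ 0 + q 0 * q₁ 0) (hS0 : 0 < q 0 * p₁ 0 - p 0 * q₁ 0) :
    ∃ K : ℝ, 0 < K ∧ ∀ y : ℝ, 1 ≤ y →
      p₁ y ^ 2 + q₁ y ^ 2 ≤ (K * y ^ 2) ^ 2 * (p y ^ 2 + q y ^ 2) ∧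
      Real.exp y ≤ K * y ^ 2 * (p y ^ 2 + q y ^ 2) := by
  set u : ℝ → ℝ := fun y => p y ^ 2 + q y ^ 2 with hu
  set v : ℝ → ℝ := fun y => p₁ y ^ 2 + q₁ y ^ 2 with hv
  set R : ℝ → ℝ := fun y => p y * p₁ y + q y * q₁ y with hR
  set S : ℝ → ℝ := fun y => q y * p₁ y - p y * q₁ y with hS
  have u_nonneg : ∀ y, 0 ≤ u y := fun y => by positivity
  have v_nonneg : ∀ y, 0 ≤ v y := fun y => by positivity
  have identity : ∀ y, R y ^ 2 + S y ^ 2 = u y * v y := fun y => by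
    simp only [hu, hv, hR, hS]; ring
  have du : ∀ y, HasDerivAt u (2 * R y) y := fun y => by
    refine (((hp y).pow 2).add ((hq y).pow 2)).congr_deriv ?_
    simp only [hR]; push_cast; ring
  have dv : ∀ y, HasDerivAt v (2 * y * S y) y := fun y => by
    refine (((hp₁ y).pow 2).add ((hq₁ y).pow 2)).congr_deriv ?_
    simp only [hS]; push_cast; ring
  have dR : ∀ y, HasDerivAt R (v y) y := fun y => by
    refine (((hp y).mul (hp₁ y)).add ((hq y).mul (hq₁ y))).congr_deriv ?_
    simp only [hv]; ring
  have dS : ∀ y, HasDerivAt S (y * u y) y := fun y => by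
    refine (((hq y).mul (hp₁ y)).sub ((hp y).mul (hq₁ y))).congr_deriv ?_
    simp only [hu]; ring
  have cont : ∀ {f f' : ℝ → ℝ}, (∀ y, HasDerivAt f (f' y) y) → ∀ s, ContinuousOn f s :=
    fun h s y _ => (h y).continuousAt.continuousWithinAt
  have S_pos : ∀ y, 0 ≤ y → 0 < S y := fun y hy => by
    have : MonotoneOn S (Set.Ici 0) := by
      refine monotoneOn_of_hasDerivWithinAt_nonneg (convex_Ici 0) (cont dS _)
        (fun x _ => (dS x).hasDerivWithinAt) fun x hx => ?_
      rw [interior_Ici, Set.mem_Ioi] at hx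
      exact mul_nonneg hx.le (u_nonneg x)
    exact hS0.trans_le (this Set.self_mem_Ici hy hy)
  have uv_pos : ∀ y, 0 ≤ y → 0 < u y * v y := fun y hy => by
    rw [← identity]
    have := S_pos y hy
    positivity
  have u_pos : ∀ y, 0 ≤ y → 0 < u y := fun y hy =>
    pos_of_mul_pos_left (uv_pos y hy) (v_nonneg y)
  have v_pos : ∀ y, 0 ≤ y → 0 < v y := fun y hy =>
    pos_of_mul_pos_right (uv_pos y hy) (u_nonneg y)
  have R_pos : ∀ y, 0 < y → 0 < R y := fun y hy => by
    have : StrictMonoOn R (Set.Ici 0) := by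
      refine strictMonoOn_of_hasDerivWithinAt_pos (convex_Ici 0) (cont dR _)
        (fun x _ => (dR x).hasDerivWithinAt) fun x hx => ?_
      rw [interior_Ici, Set.mem_Ioi] at hx
      exact v_pos x hx.le
    exact lt_of_le_of_lt hR0 (this Set.self_mem_Ici hy.le hy)
  set n : ℝ → ℝ := fun y => Real.sqrt (1 + v y / u y) with hn
  have n_sq : ∀ y, n y ^ 2 = 1 + v y / u y := fun y =>
    Real.sq_sqrt (add_nonneg zero_le_one (div_nonneg (v_nonneg y) (u_nonneg y)))
  have n_pos : ∀ y, 0 < n y := fun y =>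
    Real.sqrt_pos.2 (add_pos_of_pos_of_nonneg one_pos (div_nonneg (v_nonneg y) (u_nonneg y)))
  have v_le : ∀ y, 0 ≤ y → v y ≤ n y ^ 2 * u y := fun y hy => by
    have := u_pos y hy
    rw [n_sq, add_mul, div_mul_cancel₀ _ this.ne']
    linarith
  have dn : ∀ y, 0 ≤ y → HasDerivAt (fun x => n x - x ^ 2 / 2)
      ((2 * y * S y * u y - v y * (2 * R y)) / u y ^ 2 / (2 * n y) - y) y := fun y hy => by
    have hpos : (1 + v y / u y) ≠ 0 := by rw [← n_sq]; exact (pow_pos (n_pos y) 2).ne'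
    refine (((((dv y).div (du y) (u_pos y hy).ne').const_add 1).sqrt hpos).sub
      (((hasDerivAt_id y).pow 2).div_const 2)).congr_deriv ?_
    simp [hn]
  have n_le : ∀ y, 0 ≤ y → n y ≤ n 0 + y ^ 2 / 2 := fun y hy => by
    have : AntitoneOn (fun x => n x - x ^ 2 / 2) (Set.Ici 0) := by
      refine antitoneOn_of_hasDerivWithinAt_nonpos (convex_Ici 0)
        (fun x hx => (dn x hx).continuousAt.continuousWithinAt)
        (fun x hx => (dn x (interior_subset hx)).hasDerivWithinAt) fun x hx => ?_
      rw [interior_Ici, Set.mem_Ioi] at hx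
      have hux := u_pos x hx.le
      have hSn : S x ≤ n x * u x := by
        refine abs_le_of_sq_le_sq' ?_ (by have := n_pos x; positivity) |>.2
        nlinarith [identity x, v_le x hx.le, sq_nonneg (R x)]
      have := n_pos x
      rw [sub_nonpos, div_div, div_le_iff₀ (by positivity)]
      have h1 : 0 ≤ v x * R x := mul_nonneg (v_nonneg x) (R_pos x hx).le
      have h2 : x * u x * S x ≤ x * u x * (n x * u x) :=
        mul_le_mul_of_nonneg_left hSn (by positivity)
      nlinarith
    have h := this Set.self_mem_Ici hy hy
    simp only at h
    linarith
  set c : ℝ := R 1 * S 1 * Real.exp (-2) with hc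
  have c_pos : 0 < c := by
    have := R_pos 1 one_pos
    have := S_pos 1 zero_le_one
    positivity
  have RS_ge : ∀ y, 1 ≤ y → c * Real.exp (2 * y) ≤ R y * S y := fun y hy => by
    have dRS : ∀ y, HasDerivAt (fun x => R x * S x * Real.exp (-2 * x))
        ((v y * S y + R y * (y * u y) - 2 * (R y * S y)) * Real.exp (-2 * y)) y := fun y => by
      refine (((dR y).mul (dS y)).mul ((hasDerivAt_id y).const_mul (-2)).exp).congr_deriv ?_
      simp only [Pi.mul_apply, id]
      ring
    have mono : MonotoneOn (fun x => R x * S x * Real.exp (-2 * x)) (Set.Ici 1) := by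
      refine monotoneOn_of_hasDerivWithinAt_nonneg (convex_Ici 1) (cont dRS _)
        (fun x _ => (dRS x).hasDerivWithinAt) fun x hx => ?_
      rw [interior_Ici, Set.mem_Ioi] at hx
      have hx0 : 0 < x := one_pos.trans hx
      have hRx := R_pos x hx0
      have hSx := S_pos x hx0.le
      refine mul_nonneg ?_ (Real.exp_pos _).le
      rw [sub_nonneg]
      have hux := u_nonneg x
      have hvx := v_nonneg x
      refine abs_le_of_sq_le_sq' ?_ (by positivity) |>.2
      have h1 : u x * v x ≤ x * (u x * v x) := le_mul_of_one_le_left (by positivity) hx.le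
      have h2 : 2 * (R x * S x) ≤ x * (u x * v x) := by
        nlinarith [identity x, sq_nonneg (R x - S x)]
      have h3 : R x * S x * (2 * (R x * S x)) ≤ R x * S x * (x * (u x * v x)) :=
        mul_le_mul_of_nonneg_left h2 (by positivity)
      nlinarith [sq_nonneg (v x * S x - R x * (x * u x)), mul_pos hRx hSx]
    have h := mono Set.self_mem_Ici hy hy
    simp only at h
    have h' := mul_le_mul_of_nonneg_right h (Real.exp_pos (2 * y)).le
    rw [mul_assoc (R y * S y), ← Real.exp_add] at h'
    simpa [hc] using h'
  set M : ℝ := n 0 + 1 with hM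
  have hM1 : 1 ≤ M := by have := n_pos 0; linarith
  have n_le' : ∀ y, 1 ≤ y → n y ≤ M * y ^ 2 := fun y hy => by
    have h1 := n_le y (by linarith)
    have h2 : 1 ≤ y ^ 2 := one_le_pow₀ hy
    have := n_pos 0
    nlinarith
  refine ⟨max M (M / Real.sqrt c), lt_max_of_lt_left (by linarith), fun y hy => ⟨?_, ?_⟩⟩
  · have hy0 : 0 ≤ y := by linarith
    refine (v_le y hy0).trans (mul_le_mul_of_nonneg_right ?_ (u_nonneg y))
    refine pow_le_pow_left₀ (n_pos y).le ((n_le' y hy).trans ?_) 2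
    exact mul_le_mul_of_nonneg_right (le_max_left _ _) (by positivity)
  · have hy0 : 0 ≤ y := by linarith
    have hsc : 0 < Real.sqrt c := Real.sqrt_pos.2 c_pos
    have huy := u_pos y hy0
    have hny := n_pos y
    have key : Real.sqrt c * Real.exp y ≤ n y * u y := by
      refine abs_le_of_sq_le_sq' ?_ (by positivity) |>.2
      have h2 : (Real.sqrt c * Real.exp y) ^ 2 = c * Real.exp (2 * y) := by
        rw [mul_pow, Real.sq_sqrt c_pos.le, ← Real.exp_nat_mul]; norm_num
      rw [h2]
      have h3 : u y * v y ≤ u y * (n y ^ 2 * u y) :=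
        mul_le_mul_of_nonneg_left (v_le y hy0) huy.le
      nlinarith [RS_ge y hy, identity y, sq_nonneg (R y - S y), mul_pos (R_pos y (by linarith)) (S_pos y hy0)]
    have h4 : Real.exp y ≤ M / Real.sqrt c * y ^ 2 * u y := by
      have h5 : n y * u y ≤ M * y ^ 2 * u y := mul_le_mul_of_nonneg_right (n_le' y hy) huy.le
      have h6 : M / Real.sqrt c * y ^ 2 * u y = M * y ^ 2 * u y / Real.sqrt c := by ring
      rw [h6, le_div_iff₀ hsc]
      linarith
    refine h4.trans ?_
    gcongr
    exact le_max_right _ _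

/-- On the half-lines `{i σ y : y > 0}`, `σ = ±1`, a solution of Airy's equation that is positive
and has negative derivative at the origin grows exponentially, and its logarithmic derivative is
at most polynomial. -/
theorem airy_growth_imaginary_axis {A : ℂ → ℂ} (h₁ : Differentiable ℂ A)
    (h₂ : Differentiable ℂ (deriv A)) (ode : ∀ z, deriv (deriv A) z = z * A z)
    {a b : ℝ} (ha : 0 < a) (hb : b < 0) (hA : A 0 = a) (hA' : deriv A 0 = b)
    {σ : ℝ} (hσ : σ ^ 2 = 1) :
    ∃ K : ℝ, 0 < K ∧ ∀ y : ℝ, 1 ≤ y →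
      ‖deriv A (Complex.I * (σ * y : ℝ))‖ ≤ K * y ^ 2 * ‖A (Complex.I * (σ * y : ℝ))‖ ∧
      Real.exp y ≤ K * y ^ 2 * ‖A (Complex.I * (σ * y : ℝ))‖ ^ 2 := by
  have inner : ∀ y : ℝ, HasDerivAt (fun y : ℝ => Complex.I * ((σ * y : ℝ) : ℂ))
      (Complex.I * σ) y := fun y => by
    have h := ((hasDerivAt_id y).const_mul σ).ofReal_comp.const_mul Complex.I
    simpa using h
  have dA : ∀ y : ℝ, HasDerivAt (fun y : ℝ => A (Complex.I * (σ * y : ℝ)))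
      (deriv A (Complex.I * (σ * y : ℝ)) * (Complex.I * σ)) y := fun y =>
    (h₁ _).hasDerivAt.comp y (inner y)
  have dA' : ∀ y : ℝ, HasDerivAt (fun y : ℝ => deriv A (Complex.I * (σ * y : ℝ)))
      (-(y * A (Complex.I * (σ * y : ℝ)))) y := fun y => by
    refine ((h₂ _).hasDerivAt.comp y (inner y)).congr_deriv ?_
    have hσ' : (σ : ℂ) ^ 2 = 1 := by exact_mod_cast hσ
    rw [ode]
    push_cast
    linear_combination (-(y * A (Complex.I * (σ * y)))) * hσ' +
      σ ^ 2 * y * A (Complex.I * (σ * y)) * Complex.I_sq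
  have re_deriv : ∀ {f : ℝ → ℂ} {f' : ℂ} {y : ℝ}, HasDerivAt f f' y →
      HasDerivAt (fun y => (f y).re) f'.re y := fun h =>
    (Complex.reCLM.hasFDerivAt.comp_hasDerivAt _ h)
  have im_deriv : ∀ {f : ℝ → ℂ} {f' : ℂ} {y : ℝ}, HasDerivAt f f' y →
      HasDerivAt (fun y => (f y).im) f'.im y := fun h =>
    (Complex.imCLM.hasFDerivAt.comp_hasDerivAt _ h)
  obtain ⟨K, hK, h⟩ := rotated_airy_growth
    (p := fun y => (A (Complex.I * (σ * y : ℝ))).re)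
    (q := fun y => σ * (A (Complex.I * (σ * y : ℝ))).im)
    (p₁ := fun y => -(σ * (deriv A (Complex.I * (σ * y : ℝ))).im))
    (q₁ := fun y => (deriv A (Complex.I * (σ * y : ℝ))).re)
    (fun y => (re_deriv (dA y)).congr_deriv (by simp [mul_comm]))
    (fun y => ((im_deriv (dA y)).const_mul σ).congr_deriv (by
      simp only [Complex.mul_im, Complex.mul_re, Complex.I_re, Complex.I_im, Complex.ofReal_re,
        Complex.ofReal_im]
      linear_combination (deriv A (Complex.I * (σ * y : ℝ))).re * hσ))
    (fun y => ((im_deriv (dA' y)).const_mul σ).neg.congr_deriv (by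
      simp only [Complex.neg_im, Complex.im_ofReal_mul]
      ring))
    (fun y => (re_deriv (dA' y)).congr_deriv (by simp))
    (by simp [hA, hA']) (by simp [hA, hA']; exact mul_neg_of_pos_of_neg ha hb)
  refine ⟨K, hK, fun y hy => ?_⟩
  have hnorm : ∀ z : ℂ, ‖z‖ ^ 2 = z.re ^ 2 + z.im ^ 2 := fun z => by
    rw [Complex.sq_norm, Complex.normSq_apply]; ring
  obtain ⟨hv, hu⟩ := h y hy
  simp only [neg_sq, mul_pow σ, hσ, one_mul, ← hnorm] at hv hu
  rw [add_comm, ← hnorm, ← mul_pow] at hv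
  exact ⟨abs_le_of_sq_le_sq' hv (by positivity) |>.2, hu⟩

theorem isBigO_airy_quotient {A : ℂ → ℂ} {σ K : ℝ} (hK : 0 < K)
    (h : ∀ y : ℝ, 1 ≤ y →
      ‖deriv A (Complex.I * (σ * y : ℝ))‖ ≤ K * y ^ 2 * ‖A (Complex.I * (σ * y : ℝ))‖ ∧
      Real.exp y ≤ K * y ^ 2 * ‖A (Complex.I * (σ * y : ℝ))‖ ^ 2)
    (hσ : |σ| = 1) (j k : ℕ) {l : ℕ} (hkl : k < l) :
    (fun y : ℝ => (Complex.I * (σ * y : ℝ)) ^ j * (deriv A (Complex.I * (σ * y : ℝ))) ^ k /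
      (A (Complex.I * (σ * y : ℝ))) ^ l) =O[Filter.atTop]
      fun y => Real.exp (-(1 / 8 : ℝ) * y) := by
  obtain ⟨m, rfl⟩ : ∃ m, l = k + (m + 1) := ⟨l - k - 1, by omega⟩
  have ev1 := (isLittleO_pow_exp_pos_mul_atTop 2 (b := 1 / 2) (by norm_num)).bound
    (inv_pos.2 hK)
  have ev2 := (isLittleO_pow_exp_pos_mul_atTop (j + 2 * k) (b := 1 / 8) (by norm_num)).bound
    one_pos
  refine Asymptotics.IsBigO.of_bound (K ^ k) ?_
  filter_upwards [ev1, ev2, Filter.eventually_ge_atTop 1] with y hy1 hy2 hy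
  obtain ⟨hd, he⟩ := h y hy
  set α := ‖A (Complex.I * (σ * y : ℝ))‖ with hα
  have hα0 : 0 ≤ α := norm_nonneg _
  have hy0 : 0 < y := by linarith
  rw [Real.norm_of_nonneg (by positivity), Real.norm_of_nonneg (by positivity)] at hy1 hy2
  have hα1 : Real.exp (1 / 4 * y) ≤ α := by
    refine abs_le_of_sq_le_sq' ?_ hα0 |>.2
    rw [← Real.exp_nat_mul]
    have hsplit : Real.exp y = Real.exp (1 / 2 * y) * Real.exp (1 / 2 * y) := by
      rw [← Real.exp_add]; ring_nf
    have hh : K * y ^ 2 ≤ Real.exp (1 / 2 * y) := by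
      rwa [inv_mul_eq_div, le_div_iff₀' hK] at hy1
    have e := Real.exp_pos (1 / 2 * y)
    have : Real.exp (1 / 2 * y) * Real.exp (1 / 2 * y) ≤ Real.exp (1 / 2 * y) * α ^ 2 := by
      rw [← hsplit]
      exact he.trans (mul_le_mul_of_nonneg_right hh (by positivity))
    have := le_of_mul_le_mul_left this e
    refine le_trans (le_of_eq ?_) this
    push_cast; ring_nf
  have hα_one : 1 ≤ α := (Real.one_le_exp (by positivity)).trans hα1
  have hα_pos : 0 < α := by linarith
  have hnum : ‖Complex.I * ((σ * y : ℝ) : ℂ)‖ = y := by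
    rw [norm_mul, Complex.norm_I, one_mul, Complex.norm_real, Real.norm_eq_abs, abs_mul, hσ,
      one_mul, abs_of_pos hy0]
  rw [norm_div, norm_mul, norm_pow, norm_pow, norm_pow, hnum, ← hα,
    Real.norm_of_nonneg (Real.exp_pos _).le, div_le_iff₀ (by positivity)]
  have hm : Real.exp (1 / 4 * y) ≤ α ^ (m + 1) :=
    hα1.trans (le_self_pow₀ hα_one (Nat.succ_ne_zero m))
  have hexp : Real.exp (-(1 / 8) * y) * Real.exp (1 / 4 * y) = Real.exp (1 / 8 * y) := by
    rw [← Real.exp_add]; ring_nf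
  calc y ^ j * ‖deriv A (Complex.I * (σ * y : ℝ))‖ ^ k
      ≤ y ^ j * (K * y ^ 2 * α) ^ k := by gcongr
    _ = K ^ k * y ^ (j + 2 * k) * α ^ k := by rw [mul_pow, mul_pow, ← pow_mul]; ring
    _ ≤ K ^ k * Real.exp (1 / 8 * y) * α ^ k := by rw [one_mul] at hy2; gcongr
    _ = K ^ k * (Real.exp (-(1 / 8) * y) * Real.exp (1 / 4 * y)) * α ^ k := by rw [hexp]
    _ ≤ K ^ k * (Real.exp (-(1 / 8) * y) * α ^ (m + 1)) * α ^ k := by gcongr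
    _ = K ^ k * Real.exp (-(1 / 8) * y) * α ^ (k + (m + 1)) := by rw [pow_add]; ring

theorem integrable_of_isBigO_exp_neg_abs {f : ℝ → ℂ} (hf : Continuous f) {b : ℝ} (hb : 0 < b)
    (hpos : f =O[Filter.atTop] fun y => Real.exp (-b * y))
    (hneg : (fun y => f (-y)) =O[Filter.atTop] fun y => Real.exp (-b * y)) :
    MeasureTheory.Integrable f := by
  have half : ∀ {g : ℝ → ℂ}, Continuous g → g =O[Filter.atTop] (fun y => Real.exp (-b * y)) →
      MeasureTheory.IntegrableOn g (Set.Ioi 0) := fun hg ho =>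
    (MeasureTheory.integrable_norm_iff hg.aestronglyMeasurable).1
      (integrable_of_isBigO_exp_neg hb hg.norm.continuousOn ho.norm_left)
  have h : MeasureTheory.IntegrableOn (fun y => f (- -y)) (Set.Iio 0) :=
    MeasureTheory.IntegrableOn.comp_neg_Iio (f := fun y => f (-y))
      (by rw [neg_zero]; exact half (hf.comp continuous_neg) hneg)
  rw [← MeasureTheory.integrableOn_univ, ← Set.Iic_union_Ioi (a := (0 : ℝ)),
    MeasureTheory.integrableOn_union, integrableOn_Iic_iff_integrableOn_Iio]
  exact ⟨by simpa only [neg_neg] using h, half hf hpos⟩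

theorem hasDerivAt_airy_quotient {A : ℂ → ℂ} (h₁ : Differentiable ℂ A)
    (h₂ : Differentiable ℂ (deriv A)) (ode : ∀ z, deriv (deriv A) z = z * A z)
    (ne_zero : ∀ y : ℝ, A (Complex.I * y) ≠ 0) (j k : ℕ) {l : ℕ} (hl : 0 < l) (y : ℝ) :
    HasDerivAt (fun y : ℝ => (Complex.I * y) ^ j * (deriv A (Complex.I * y)) ^ k /
        (A (Complex.I * y)) ^ l)
      (Complex.I * ((j : ℂ) * ((Complex.I * y) ^ (j - 1) * (deriv A (Complex.I * y)) ^ k /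
          (A (Complex.I * y)) ^ l) +
        (k : ℂ) * ((Complex.I * y) ^ (j + 1) * (deriv A (Complex.I * y)) ^ (k - 1) /
          (A (Complex.I * y)) ^ (l - 1)) -
        (l : ℂ) * ((Complex.I * y) ^ j * (deriv A (Complex.I * y)) ^ (k + 1) /
          (A (Complex.I * y)) ^ (l + 1)))) y := by
  have line : HasDerivAt (fun y : ℝ => Complex.I * (y : ℂ)) Complex.I y := by
    simpa using (hasDerivAt_id y).ofReal_comp.const_mul Complex.I
  have hne := ne_zero y
  have d1 := (h₁ (Complex.I * y)).hasDerivAt.comp y line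
  have d2 := (h₂ (Complex.I * y)).hasDerivAt.comp y line
  rw [ode] at d2
  refine (((line.pow j).mul (d2.pow k)).div (d1.pow l) (pow_ne_zero l hne)).congr_deriv ?_
  obtain ⟨m, rfl⟩ : ∃ m, l = m + 1 := ⟨l - 1, by omega⟩
  simp only [Function.comp_apply, Pi.mul_apply, Pi.pow_apply, Nat.add_sub_cancel]
  generalize deriv A (Complex.I * y) = D at *
  generalize A (Complex.I * y) = a at *
  field_simp
  ring

theorem airyI_recursion (Ai : ℂ → ℂ)
    (hAi_d1 : Differentiable ℂ Ai)
    (hAi_d2 : Differentiable ℂ (deriv Ai))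
    (hAi_ode : ∀ z : ℂ, deriv (deriv Ai) z = z * Ai z)
    (hAi_0 : Ai 0 = (3 : ℂ) ^ (-(2 : ℂ) / 3) / Complex.Gamma (2 / 3))
    (hAi_0' : deriv Ai 0 = -(3 : ℂ) ^ (-(1 : ℂ) / 3) / Complex.Gamma (1 / 3))
    (hAi_zeros : ∀ z : ℂ, Ai z = 0 → ∃ x : ℝ, x < 0 ∧ z = (x : ℂ)) :
    ∀ j k l : ℕ, k < l →
      (j : ℂ) * airyI Ai (j - 1) k l + (k : ℂ) * airyI Ai (j + 1) (k - 1) (l - 1) -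
          (l : ℂ) * airyI Ai j (k + 1) (l + 1) = 0 := by
  obtain ⟨a, ha, hA⟩ : ∃ a : ℝ, 0 < a ∧ Ai 0 = a := by
    refine ⟨(3 : ℝ) ^ (-(2 : ℝ) / 3) / Real.Gamma (2 / 3),
      div_pos (by positivity) (Real.Gamma_pos_of_pos (by norm_num)), ?_⟩
    rw [hAi_0, Complex.ofReal_div, Complex.ofReal_cpow (by norm_num), ← Complex.Gamma_ofReal]
    push_cast
    rfl
  obtain ⟨b, hb, hA'⟩ : ∃ b : ℝ, b < 0 ∧ deriv Ai 0 = b := by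
    refine ⟨-((3 : ℝ) ^ (-(1 : ℝ) / 3) / Real.Gamma (1 / 3)),
      neg_neg_of_pos (div_pos (by positivity) (Real.Gamma_pos_of_pos (by norm_num))), ?_⟩
    rw [hAi_0', neg_div, Complex.ofReal_neg, Complex.ofReal_div,
      Complex.ofReal_cpow (by norm_num), ← Complex.Gamma_ofReal]
    push_cast
    rfl
  have ne_zero : ∀ y : ℝ, Ai (Complex.I * y) ≠ 0 := fun y h => by
    obtain ⟨x, hx, hxy⟩ := hAi_zeros _ h
    have := congrArg Complex.re hxy
    simp at this
    exact hx.ne this.symm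
  obtain ⟨K, hK, hgrow⟩ := airy_growth_imaginary_axis hAi_d1 hAi_d2 hAi_ode ha hb hA hA'
    (σ := 1) (by norm_num)
  obtain ⟨K', hK', hgrow'⟩ := airy_growth_imaginary_axis hAi_d1 hAi_d2 hAi_ode ha hb hA hA'
    (σ := -1) (by norm_num)
  have integrable : ∀ j k l : ℕ, k < l → MeasureTheory.Integrable fun y : ℝ =>
      (Complex.I * y) ^ j * (deriv Ai (Complex.I * y)) ^ k / (Ai (Complex.I * y)) ^ l := by
    intro j k l hkl
    have c1 := hAi_d1.continuous
    have c2 := hAi_d2.continuous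
    refine integrable_of_isBigO_exp_neg_abs
      (Continuous.div (by fun_prop) (by fun_prop) fun y => pow_ne_zero _ (ne_zero y))
      (b := 1 / 8) (by norm_num) ?_ ?_
    · simpa using isBigO_airy_quotient hK hgrow (by norm_num) j k hkl
    · simpa using isBigO_airy_quotient hK' hgrow' (by norm_num) j k hkl
  intro j k l hkl
  have int₁ := (integrable (j - 1) k l hkl).const_mul (j : ℂ)
  have int₂ : MeasureTheory.Integrable fun y : ℝ => (k : ℂ) * ((Complex.I * y) ^ (j + 1) *
      (deriv Ai (Complex.I * y)) ^ (k - 1) / (Ai (Complex.I * y)) ^ (l - 1)) := by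
    rcases Nat.eq_zero_or_pos k with rfl | hk
    · simp
    · exact (integrable (j + 1) (k - 1) (l - 1) (by omega)).const_mul (k : ℂ)
  have int₃ := (integrable j (k + 1) (l + 1) (by omega)).const_mul (l : ℂ)
  have zero := MeasureTheory.integral_eq_zero_of_hasDerivAt_of_integrable
    (hasDerivAt_airy_quotient hAi_d1 hAi_d2 hAi_ode ne_zero j k (by omega))
    (((int₁.add int₂).sub int₃).const_mul Complex.I) (integrable j k l hkl)
  have split := MeasureTheory.integral_sub (int₁.add int₂) int₃
  simp only [Pi.add_apply] at split
  rw [MeasureTheory.integral_const_mul, mul_eq_zero, or_iff_right Complex.I_ne_zero,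
    split, MeasureTheory.integral_add int₁ int₂,
    MeasureTheory.integral_const_mul, MeasureTheory.integral_const_mul,
    MeasureTheory.integral_const_mul] at zero
  simp only [airyI]
  linear_combination (1 / (2 * (Real.pi : ℂ))) * zero
end

section
/- For all integers j ≥ 0 and ℓ > k ≥ 1: if k = 1 then I(j, 1, ℓ) = (j/(ℓ−1))·I(j−1, 0, ℓ−1), and if k ≥ 2 then I(j, k, ℓ) = (j/(ℓ−1))·I(j−1, k−1, ℓ−1) + ((k−1)/(ℓ−1))·I(j+1, k−2, ℓ−2), where by convention I(j', k', ℓ') = 0 whenever j' < 0 or k' < 0. -/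
/-- A function on `[0, ∞)` starting at a nonnegative value whose derivative is at least `c * y ^ n`
is bounded below by `c / (n + 1) * y ^ (n + 1)`. -/
lemma le_of_pow_le_hasDerivAt {f f' : ℝ → ℝ} {c : ℝ} {n : ℕ} (hf : ∀ y, HasDerivAt f (f' y) y)
    (h0 : 0 ≤ f 0) (hf' : ∀ y, 0 ≤ y → c * y ^ n ≤ f' y) {y : ℝ} (hy : 0 ≤ y) :
    c / (n + 1) * y ^ (n + 1) ≤ f y := by
  have hd : ∀ x, HasDerivAt (fun x => f x - c / (n + 1) * x ^ (n + 1)) (f' x - c * x ^ n) x := by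
    intro x
    refine ((hf x).sub ((hasDerivAt_pow (n + 1) x).const_mul (c / (n + 1)))).congr_deriv ?_
    have : (n : ℝ) + 1 ≠ 0 := by positivity
    push_cast
    field_simp
  have hm : MonotoneOn (fun x => f x - c / (n + 1) * x ^ (n + 1)) (Set.Ici 0) := by
    refine monotoneOn_of_deriv_nonneg (convex_Ici 0)
      (fun x _ => (hd x).continuousAt.continuousWithinAt)
      (fun x _ => (hd x).differentiableAt.differentiableWithinAt) fun x hx => ?_
    rw [interior_Ici] at hx
    rw [(hd x).deriv]
    linarith [hf' x (le_of_lt hx)]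
  have h := hm Set.self_mem_Ici (Set.mem_Ici.2 hy) hy
  simp only [ne_eq, Nat.add_eq_zero_iff, one_ne_zero, and_false, not_false_eq_true, zero_pow,
    mul_zero, sub_zero] at h
  linarith

/-- The variant of `le_of_pow_le_hasDerivAt` for a nonnegative derivative. -/
lemma le_of_nonneg_hasDerivAt {f f' : ℝ → ℝ} (hf : ∀ y, HasDerivAt f (f' y) y)
    (hf' : ∀ y, 0 ≤ y → 0 ≤ f' y) {y : ℝ} (hy : 0 ≤ y) : f 0 ≤ f y := by
  have h := le_of_pow_le_hasDerivAt (c := 0) (n := 0) (fun x => (hf x).sub_const (f 0))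
    (by simp) (by simpa using hf') hy
  simpa using h

/-- The system of real differential equations satisfied by `P = |w|²`, `P₁ = P'`, `S = |w'|²` and
`Q = -Re (w̄ w')` along the imaginary axis, for a solution `w` of the Airy equation. -/
structure AirySystem (P P₁ S Q : ℝ → ℝ) : Prop where
  deriv_P : ∀ y, HasDerivAt P (P₁ y) y
  deriv_P₁ : ∀ y, HasDerivAt P₁ (2 * S y) y
  deriv_S : ∀ y, HasDerivAt S (2 * y * Q y) y
  deriv_Q : ∀ y, HasDerivAt Q (y * P y) y
  P_zero : 0 < P 0
  P₁_zero : P₁ 0 = 0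
  Q_zero : 0 ≤ Q 0
  S_nonneg : ∀ y, 0 ≤ S y

namespace AirySystem

variable {P P₁ S Q : ℝ → ℝ}

lemma comp_neg (h : AirySystem P P₁ S Q) :
    AirySystem (fun y => P (-y)) (fun y => -P₁ (-y)) (fun y => S (-y)) (fun y => Q (-y)) where
  deriv_P y := by
    simpa [Function.comp_def] using (h.deriv_P (-y)).scomp y (hasDerivAt_neg y)
  deriv_P₁ y := by
    simpa [Function.comp_def, Pi.neg_def] using ((h.deriv_P₁ (-y)).scomp y (hasDerivAt_neg y)).neg
  deriv_S y := by
    simpa [Function.comp_def] using (h.deriv_S (-y)).scomp y (hasDerivAt_neg y)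
  deriv_Q y := by
    simpa [Function.comp_def] using (h.deriv_Q (-y)).scomp y (hasDerivAt_neg y)
  P_zero := by simpa using h.P_zero
  P₁_zero := by simpa using h.P₁_zero
  Q_zero := by simpa using h.Q_zero
  S_nonneg y := h.S_nonneg (-y)

lemma P₁_nonneg (h : AirySystem P P₁ S Q) {y : ℝ} (hy : 0 ≤ y) : 0 ≤ P₁ y := by
  have := le_of_nonneg_hasDerivAt h.deriv_P₁ (fun x _ => by linarith [h.S_nonneg x]) hy
  rwa [h.P₁_zero] at this

lemma P_zero_le (h : AirySystem P P₁ S Q) {y : ℝ} (hy : 0 ≤ y) : P 0 ≤ P y :=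
  le_of_nonneg_hasDerivAt h.deriv_P (fun _ hx => h.P₁_nonneg hx) hy

lemma P_pos (h : AirySystem P P₁ S Q) {y : ℝ} (hy : 0 ≤ y) : 0 < P y :=
  h.P_zero.trans_le (h.P_zero_le hy)

lemma exists_pow_le (h : AirySystem P P₁ S Q) (n : ℕ) :
    ∃ c : ℝ, 0 < c ∧ ∀ y, 0 ≤ y → c * y ^ (6 * n) ≤ P y := by
  induction n with
  | zero => exact ⟨P 0, h.P_zero, fun y hy => by simpa using h.P_zero_le hy⟩
  | succ n ih =>
    obtain ⟨c, hc, hP⟩ := ih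
    have hQ : ∀ y, 0 ≤ y → _ ≤ Q y := fun y hy =>
      le_of_pow_le_hasDerivAt (c := c) (n := 6 * n + 1) h.deriv_Q h.Q_zero
        (fun x hx => by
          have := mul_le_mul_of_nonneg_left (hP x hx) hx
          rw [pow_succ]; linarith) hy
    set c₁ := c / (((6 * n + 1 : ℕ) : ℝ) + 1) with hc₁
    have hS : ∀ y, 0 ≤ y → _ ≤ S y := fun y hy =>
      le_of_pow_le_hasDerivAt (c := 2 * c₁) (n := 6 * n + 3) h.deriv_S (h.S_nonneg 0)
        (fun x hx => by
          have := mul_le_mul_of_nonneg_left (hQ x hx) hx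
          rw [pow_succ]; linarith) hy
    set c₂ := 2 * c₁ / (((6 * n + 3 : ℕ) : ℝ) + 1) with hc₂
    have hP₁ : ∀ y, 0 ≤ y → _ ≤ P₁ y := fun y hy =>
      le_of_pow_le_hasDerivAt (c := 2 * c₂) (n := 6 * n + 4) h.deriv_P₁ h.P₁_zero.ge
        (fun x hx => by linarith [hS x hx]) hy
    exact ⟨_, by positivity, fun y hy =>
      le_of_pow_le_hasDerivAt (n := 6 * n + 5) h.deriv_P h.P_zero.le hP₁ hy⟩

lemma exists_one_add_sq_pow_le (h : AirySystem P P₁ S Q) (n : ℕ) :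
    ∃ c : ℝ, 0 < c ∧ ∀ y, 0 ≤ y → c * (1 + y ^ 2) ^ n ≤ P y := by
  obtain ⟨c, hc, hP⟩ := h.exists_pow_le n
  have hm : 0 < min c (P 0) := lt_min hc h.P_zero
  refine ⟨min c (P 0) / 2 ^ n, by positivity, fun y hy => ?_⟩
  rw [div_mul_eq_mul_div, mul_div_assoc, ← div_pow]
  rcases le_total y 1 with h1 | h1
  · calc min c (P 0) * ((1 + y ^ 2) / 2) ^ n ≤ min c (P 0) * 1 := by
          gcongr
          exact pow_le_one₀ (by positivity) (by nlinarith)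
      _ ≤ P y := by linarith [min_le_right c (P 0), h.P_zero_le hy]
  · calc min c (P 0) * ((1 + y ^ 2) / 2) ^ n ≤ c * (y ^ 6) ^ n := by
          gcongr
          · exact min_le_left _ _
          · have : y ^ 2 ≤ y ^ 6 := pow_le_pow_right₀ h1 (by norm_num)
            nlinarith
      _ ≤ P y := by rw [← pow_mul]; exact hP y hy

lemma S_le (h : AirySystem P P₁ S Q) {y : ℝ} (hy : 0 ≤ y) :
    S y ≤ ((S 0 + Q 0) / P 0 + 1) * (1 + y ^ 2) ^ 2 * P y := by
  have hQ0 : ∀ x, 0 ≤ x → 0 ≤ x ^ 3 * P x := fun x hx => by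
    have := (h.P_pos hx).le
    positivity
  have hQ : Q y ≤ Q 0 + y ^ 2 * P y := by
    have := le_of_nonneg_hasDerivAt
      (fun x => (((hasDerivAt_pow 2 x).mul (h.deriv_P x)).sub (h.deriv_Q x))) (fun x hx => by
        have h1 := mul_nonneg hx (h.P_pos hx).le
        have h2 := mul_nonneg (sq_nonneg x) (h.P₁_nonneg hx)
        norm_num
        linarith) hy
    simp at this
    linarith
  have hS : S y ≤ S 0 + y ^ 2 * Q y := by
    have := le_of_nonneg_hasDerivAt
      (fun x => (((hasDerivAt_pow 2 x).mul (h.deriv_Q x)).sub (h.deriv_S x))) (fun x hx => by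
        have h1 := hQ0 x hx
        norm_num
        linarith) hy
    simp at this
    linarith
  have hPy := h.P_zero_le hy
  have hP := h.P_zero
  have hS0 := h.S_nonneg 0
  have hq := h.Q_zero
  have hc : 0 ≤ (S 0 + Q 0) / P 0 := by positivity
  have h1 : S 0 + Q 0 ≤ (S 0 + Q 0) / P 0 * P y := by
    rw [div_mul_eq_mul_div, le_div_iff₀ hP]
    gcongr
  have h2 : S y ≤ (S 0 + Q 0) * (1 + y ^ 2) ^ 2 + (1 + y ^ 2) ^ 2 * P y := by
    have := mul_le_mul_of_nonneg_left hQ (sq_nonneg y)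
    nlinarith [mul_nonneg hS0 (sq_nonneg y), mul_nonneg hq (sq_nonneg y),
      mul_nonneg hS0 (sq_nonneg (y ^ 2)), mul_nonneg hq (sq_nonneg (y ^ 2)),
      mul_nonneg (h.P_pos hy).le (sq_nonneg y), h.P_pos hy]
  nlinarith [mul_le_mul_of_nonneg_right h1 (sq_nonneg (1 + y ^ 2))]

end AirySystem

section Airy

variable {Ai : ℂ → ℂ}

lemma hasDerivAt_comp_I_mul_s10 {f : ℂ → ℂ} (hf : Differentiable ℂ f) (y : ℝ) :
    HasDerivAt (fun y : ℝ => f (Complex.I * y)) (Complex.I * deriv f (Complex.I * y)) y := by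
  have h1 : HasDerivAt (fun y : ℝ => Complex.I * (y : ℂ)) Complex.I y := by
    simpa using (Complex.ofRealCLM.hasDerivAt (x := y)).const_mul Complex.I
  simpa [mul_comm, Function.comp_def] using (hf (Complex.I * y)).hasDerivAt.comp y h1

lemma hasDerivAt_re {f : ℝ → ℂ} {f' : ℂ} {y : ℝ} (h : HasDerivAt f f' y) :
    HasDerivAt (fun y => (f y).re) f'.re y := by
  simpa [Function.comp_def] using Complex.reCLM.hasFDerivAt.comp_hasDerivAt y h

lemma hasDerivAt_im {f : ℝ → ℂ} {f' : ℂ} {y : ℝ} (h : HasDerivAt f f' y) :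
    HasDerivAt (fun y => (f y).im) f'.im y := by
  simpa [Function.comp_def] using Complex.imCLM.hasFDerivAt.comp_hasDerivAt y h

lemma airySystem_of_airy_ode (hd1 : Differentiable ℂ Ai) (hd2 : Differentiable ℂ (deriv Ai))
    (hode : ∀ z : ℂ, deriv (deriv Ai) z = z * Ai z) {a b : ℝ} (ha : 0 < a) (hb : b ≤ 0)
    (h0 : Ai 0 = a) (h0' : deriv Ai 0 = b) :
    AirySystem (fun y => ‖Ai (Complex.I * y)‖ ^ 2)
      (fun y => 2 * ((Ai (Complex.I * y)).im * (deriv Ai (Complex.I * y)).re -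
        (Ai (Complex.I * y)).re * (deriv Ai (Complex.I * y)).im))
      (fun y => ‖deriv Ai (Complex.I * y)‖ ^ 2)
      (fun y => -((Ai (Complex.I * y)).re * (deriv Ai (Complex.I * y)).re +
        (Ai (Complex.I * y)).im * (deriv Ai (Complex.I * y)).im)) := by
  have hr := fun y => hasDerivAt_re (hasDerivAt_comp_I_mul_s10 hd1 y)
  have hi := fun y => hasDerivAt_im (hasDerivAt_comp_I_mul_s10 hd1 y)
  have hr' := fun y => hasDerivAt_re (hasDerivAt_comp_I_mul_s10 hd2 y)
  have hi' := fun y => hasDerivAt_im (hasDerivAt_comp_I_mul_s10 hd2 y)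
  simp only [hode] at hr' hi'
  simp only [← Complex.normSq_eq_norm_sq, Complex.normSq_apply]
  constructor
  · intro y
    refine (((hr y).mul (hr y)).add ((hi y).mul (hi y))).congr_deriv ?_
    simp
    ring
  · intro y
    refine ((((hi y).mul (hr' y)).sub ((hr y).mul (hi' y))).const_mul 2).congr_deriv ?_
    simp
    ring
  · intro y
    refine (((hr' y).mul (hr' y)).add ((hi' y).mul (hi' y))).congr_deriv ?_
    simp
    ring
  · intro y
    refine (((hr y).mul (hr' y)).add ((hi y).mul (hi' y))).neg.congr_deriv ?_
    simp
    ring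
  · simpa [h0] using ha.ne'
  · simp [h0, h0']
  · simp [h0, h0']
    exact mul_nonpos_of_nonneg_of_nonpos ha.le hb
  · intro y
    nlinarith [sq_nonneg (deriv Ai (Complex.I * y)).re, sq_nonneg (deriv Ai (Complex.I * y)).im]

variable {P₁ Q : ℝ → ℝ}

lemma exists_one_add_sq_pow_le_norm
    (h : AirySystem (fun y => ‖Ai (Complex.I * y)‖ ^ 2) P₁
      (fun y => ‖deriv Ai (Complex.I * y)‖ ^ 2) Q) (n : ℕ) :
    ∃ c : ℝ, 0 < c ∧ ∀ y : ℝ, c * (1 + y ^ 2) ^ n ≤ ‖Ai (Complex.I * y)‖ := by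
  obtain ⟨c₁, hc₁, h₁⟩ := h.exists_one_add_sq_pow_le (2 * n)
  obtain ⟨c₂, hc₂, h₂⟩ := h.comp_neg.exists_one_add_sq_pow_le (2 * n)
  have hm : 0 < min c₁ c₂ := lt_min hc₁ hc₂
  refine ⟨√(min c₁ c₂), Real.sqrt_pos.2 hm, fun y => ?_⟩
  refine le_of_sq_le_sq ?_ (norm_nonneg _)
  rw [mul_pow, Real.sq_sqrt hm.le, ← pow_mul, mul_comm n]
  rcases le_total 0 y with hy | hy
  · exact le_trans (by gcongr; exact min_le_left _ _) (h₁ y hy)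
  · have := h₂ (-y) (by linarith)
    simp only [neg_neg, neg_sq] at this
    exact le_trans (by gcongr; exact min_le_right _ _) this

lemma exists_norm_deriv_le
    (h : AirySystem (fun y => ‖Ai (Complex.I * y)‖ ^ 2) P₁
      (fun y => ‖deriv Ai (Complex.I * y)‖ ^ 2) Q) :
    ∃ C : ℝ, 0 ≤ C ∧ ∀ y : ℝ,
      ‖deriv Ai (Complex.I * y)‖ ≤ C * (1 + y ^ 2) * ‖Ai (Complex.I * y)‖ := by
  set C := (‖deriv Ai (Complex.I * (0 : ℝ))‖ ^ 2 + Q 0) / ‖Ai (Complex.I * (0 : ℝ))‖ ^ 2 + 1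
    with hCdef
  have hC : 0 ≤ C := by
    have := h.Q_zero
    positivity
  refine ⟨√C, Real.sqrt_nonneg _, fun y => le_of_sq_le_sq ?_ (by positivity)⟩
  rw [mul_pow, mul_pow, Real.sq_sqrt hC]
  rcases le_total 0 y with hy | hy
  · exact h.S_le hy
  · simpa [hCdef] using h.comp_neg.S_le (y := -y) (by linarith)

lemma exists_norm_integrand_le
    (h : AirySystem (fun y => ‖Ai (Complex.I * y)‖ ^ 2) P₁
      (fun y => ‖deriv Ai (Complex.I * y)‖ ^ 2) Q) (j : ℕ) {k l : ℕ} (hkl : k < l) :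
    ∃ K : ℝ, ∀ y : ℝ, ‖(Complex.I * y) ^ j * (deriv Ai (Complex.I * y)) ^ k /
      (Ai (Complex.I * y)) ^ l‖ ≤ K * (1 + y ^ 2)⁻¹ := by
  obtain ⟨C, hC, hd⟩ := exists_norm_deriv_le h
  obtain ⟨c, hc, hg⟩ := exists_one_add_sq_pow_le_norm h (j + k + 1)
  obtain ⟨m, rfl⟩ := Nat.exists_eq_add_of_lt hkl
  refine ⟨C ^ k / c ^ (m + 1), fun y => ?_⟩
  have hw : 1 ≤ 1 + y ^ 2 := by nlinarith [sq_nonneg y]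
  have hyw : |y| ≤ 1 + y ^ 2 := by
    nlinarith [sq_nonneg (|y| - 1), sq_abs y]
  have hA : 0 < ‖Ai (Complex.I * y)‖ := lt_of_lt_of_le (by positivity) (hg y)
  have hpow : c ^ (m + 1) * (1 + y ^ 2) ^ (j + k + 1) ≤ ‖Ai (Complex.I * y)‖ ^ (m + 1) := by
    refine le_trans ?_ (pow_le_pow_left₀ (by positivity) (hg y) (m + 1))
    rw [mul_pow]
    gcongr
    exact le_self_pow₀ (one_le_pow₀ hw) (by simp)
  rw [norm_div, norm_mul, norm_pow, norm_pow, norm_pow, norm_mul, Complex.norm_I, one_mul,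
    Complex.norm_real, Real.norm_eq_abs]
  calc |y| ^ j * ‖deriv Ai (Complex.I * y)‖ ^ k / ‖Ai (Complex.I * y)‖ ^ (k + m + 1)
      ≤ (1 + y ^ 2) ^ j * (C * (1 + y ^ 2) * ‖Ai (Complex.I * y)‖) ^ k /
        ‖Ai (Complex.I * y)‖ ^ (k + m + 1) := by
        gcongr
        exact hd y
    _ = C ^ k * (1 + y ^ 2) ^ (j + k) / ‖Ai (Complex.I * y)‖ ^ (m + 1) := by
        rw [mul_pow, mul_pow, add_assoc, pow_add _ k (m + 1)]
        field_simp
        ring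
    _ ≤ C ^ k * (1 + y ^ 2) ^ (j + k) / (c ^ (m + 1) * (1 + y ^ 2) ^ (j + k + 1)) := by
        gcongr
    _ = C ^ k / c ^ (m + 1) * (1 + y ^ 2)⁻¹ := by
        field_simp
        ring

lemma airy_ne_zero
    (h : AirySystem (fun y => ‖Ai (Complex.I * y)‖ ^ 2) P₁
      (fun y => ‖deriv Ai (Complex.I * y)‖ ^ 2) Q) (y : ℝ) : Ai (Complex.I * y) ≠ 0 := by
  obtain ⟨c, hc, hg⟩ := exists_one_add_sq_pow_le_norm h 0
  exact norm_pos_iff.1 (lt_of_lt_of_le (by positivity) (hg y))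

open MeasureTheory Filter Topology

lemma integrable_airy_integrand
    (h : AirySystem (fun y => ‖Ai (Complex.I * y)‖ ^ 2) P₁
      (fun y => ‖deriv Ai (Complex.I * y)‖ ^ 2) Q)
    (hd1 : Differentiable ℂ Ai) (hd2 : Differentiable ℂ (deriv Ai)) (j : ℕ) {k l : ℕ}
    (hkl : k < l) :
    Integrable fun y : ℝ => (Complex.I * y) ^ j * (deriv Ai (Complex.I * y)) ^ k /
      (Ai (Complex.I * y)) ^ l := by
  obtain ⟨K, hK⟩ := exists_norm_integrand_le h j hkl
  refine (integrable_inv_one_add_sq.const_mul K).mono' ?_ (.of_forall hK)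
  have h1 := hd1.continuous
  have h2 := hd2.continuous
  refine Continuous.aestronglyMeasurable (Continuous.div (by fun_prop) (by fun_prop) ?_)
  exact fun y => pow_ne_zero _ (airy_ne_zero h y)

lemma tendsto_airy_integrand
    (h : AirySystem (fun y => ‖Ai (Complex.I * y)‖ ^ 2) P₁
      (fun y => ‖deriv Ai (Complex.I * y)‖ ^ 2) Q) (j : ℕ) {k l : ℕ} (hkl : k < l)
    {F : Filter ℝ} (hF : Tendsto (fun y : ℝ => y ^ 2) F atTop) :
    Tendsto (fun y : ℝ => (Complex.I * y) ^ j * (deriv Ai (Complex.I * y)) ^ k /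
      (Ai (Complex.I * y)) ^ l) F (𝓝 0) := by
  obtain ⟨K, hK⟩ := exists_norm_integrand_le h j hkl
  refine squeeze_zero_norm hK ?_
  simpa using (tendsto_inv_atTop_zero.comp (tendsto_atTop_add_const_left F 1 hF)).const_mul K

/-- The integral of the derivative of `z ^ j * Ai' ^ k / Ai ^ (l + 1)` along the imaginary axis
vanishes. -/
lemma airyI_recurrence
    (h : AirySystem (fun y => ‖Ai (Complex.I * y)‖ ^ 2) P₁
      (fun y => ‖deriv Ai (Complex.I * y)‖ ^ 2) Q)
    (hd1 : Differentiable ℂ Ai) (hd2 : Differentiable ℂ (deriv Ai))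
    (hode : ∀ z : ℂ, deriv (deriv Ai) z = z * Ai z) (j : ℕ) {k l : ℕ} (hkl : k < l + 1) :
    (l + 1 : ℂ) * airyI Ai j (k + 1) (l + 2) =
      j * airyI Ai (j - 1) k (l + 1) + k * airyI Ai (j + 1) (k - 1) l := by
  have hi1 : Integrable fun y : ℝ => (l + 1 : ℂ) * ((Complex.I * y) ^ j *
      (deriv Ai (Complex.I * y)) ^ (k + 1) / (Ai (Complex.I * y)) ^ (l + 2)) :=
    (integrable_airy_integrand h hd1 hd2 j (by omega)).const_mul _
  have hi2 : Integrable fun y : ℝ => (j : ℂ) * ((Complex.I * y) ^ (j - 1) *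
      (deriv Ai (Complex.I * y)) ^ k / (Ai (Complex.I * y)) ^ (l + 1)) :=
    (integrable_airy_integrand h hd1 hd2 (j - 1) hkl).const_mul _
  have hi3 : Integrable fun y : ℝ => (k : ℂ) * ((Complex.I * y) ^ (j + 1) *
      (deriv Ai (Complex.I * y)) ^ (k - 1) / (Ai (Complex.I * y)) ^ l) := by
    rcases Nat.eq_zero_or_pos k with rfl | hk
    · simp
    · exact (integrable_airy_integrand h hd1 hd2 (j + 1) (by omega)).const_mul _
  have hder : ∀ y : ℝ, HasDerivAt (fun y : ℝ => (Complex.I * y) ^ j *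
      (deriv Ai (Complex.I * y)) ^ k / (Ai (Complex.I * y)) ^ (l + 1))
      (Complex.I * ((j : ℂ) * ((Complex.I * y) ^ (j - 1) *
        (deriv Ai (Complex.I * y)) ^ k / (Ai (Complex.I * y)) ^ (l + 1)) +
        (k : ℂ) * ((Complex.I * y) ^ (j + 1) *
        (deriv Ai (Complex.I * y)) ^ (k - 1) / (Ai (Complex.I * y)) ^ l) -
        (l + 1 : ℂ) * ((Complex.I * y) ^ j *
        (deriv Ai (Complex.I * y)) ^ (k + 1) / (Ai (Complex.I * y)) ^ (l + 2)))) y := by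
    intro y
    have hA := airy_ne_zero h y
    have h0 := hasDerivAt_comp_I_mul_s10 differentiable_id y
    have h1 := hasDerivAt_comp_I_mul_s10 hd1 y
    have h2 := hasDerivAt_comp_I_mul_s10 hd2 y
    rw [hode] at h2
    refine (((h0.pow j).mul (h2.pow k)).div (h1.pow (l + 1)) (pow_ne_zero _ hA)).congr_deriv ?_
    simp only [id, deriv_id, Pi.pow_apply, Pi.mul_apply, Nat.add_sub_cancel]
    push_cast
    field_simp
    ring
  have hsq : ∀ y : ℝ, y ^ 2 = |y| ^ 2 := fun y => (sq_abs y).symm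
  have key := integral_of_hasDerivAt_of_tendsto hder (((hi2.add hi3).sub hi1).const_mul _)
    (tendsto_airy_integrand h j hkl (F := atBot) (by
      rw [funext hsq]
      exact (tendsto_pow_atTop two_ne_zero).comp tendsto_abs_atBot_atTop))
    (tendsto_airy_integrand h j hkl (F := atTop) (tendsto_pow_atTop two_ne_zero))
  rw [integral_const_mul, sub_zero, mul_eq_zero, or_iff_right Complex.I_ne_zero,
    integral_sub (hi2.fun_add hi3) hi1, sub_eq_zero, integral_add hi2 hi3, integral_const_mul,
    integral_const_mul, integral_const_mul] at key
  simp only [airyI]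
  linear_combination -(1 / (2 * (Real.pi : ℂ))) * key

end Airy

theorem airyI_reduction (Ai : ℂ → ℂ)
    (hAi_d1 : Differentiable ℂ Ai)
    (hAi_d2 : Differentiable ℂ (deriv Ai))
    (hAi_ode : ∀ z : ℂ, deriv (deriv Ai) z = z * Ai z)
    (hAi_0 : Ai 0 = (3 : ℂ) ^ (-(2 : ℂ) / 3) / Complex.Gamma (2 / 3))
    (hAi_0' : deriv Ai 0 = -(3 : ℂ) ^ (-(1 : ℂ) / 3) / Complex.Gamma (1 / 3))
    (hAi_zeros : ∀ z : ℂ, Ai z = 0 → ∃ x : ℝ, x < 0 ∧ z = (x : ℂ)) :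
    (∀ j l : ℕ, 1 < l →
      airyI Ai j 1 l = ((j : ℂ) / ((l : ℂ) - 1)) * airyI Ai (j - 1) 0 (l - 1)) ∧
    (∀ j k l : ℕ, 2 ≤ k → k < l →
      airyI Ai j k l =
        ((j : ℂ) / ((l : ℂ) - 1)) * airyI Ai (j - 1) (k - 1) (l - 1) +
          (((k : ℂ) - 1) / ((l : ℂ) - 1)) * airyI Ai (j + 1) (k - 2) (l - 2)) := by
  have h0 : Ai 0 = (((3 : ℝ) ^ (-(2 : ℝ) / 3) / Real.Gamma (2 / 3) : ℝ) : ℂ) := by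
    rw [hAi_0, Complex.ofReal_div, Complex.ofReal_cpow (by norm_num), ← Complex.Gamma_ofReal]
    push_cast
    rfl
  have h0' : deriv Ai 0 = ((-((3 : ℝ) ^ (-(1 : ℝ) / 3)) / Real.Gamma (1 / 3) : ℝ) : ℂ) := by
    rw [hAi_0', Complex.ofReal_div, Complex.ofReal_neg, Complex.ofReal_cpow (by norm_num),
      ← Complex.Gamma_ofReal]
    push_cast
    rfl
  have hG := Real.Gamma_pos_of_pos (show (0 : ℝ) < 2 / 3 by norm_num)
  have hG' := Real.Gamma_pos_of_pos (show (0 : ℝ) < 1 / 3 by norm_num)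
  have hsys := airySystem_of_airy_ode hAi_d1 hAi_d2 hAi_ode (by positivity)
    (by rw [neg_div]; exact neg_nonpos.2 (by positivity)) h0 h0'
  constructor
  · intro j l hl
    obtain ⟨l, rfl⟩ := Nat.exists_eq_add_of_le' hl
    have h := airyI_recurrence hsys hAi_d1 hAi_d2 hAi_ode j (k := 0) (l := l) (by omega)
    have hne : (l : ℂ) + 1 ≠ 0 := Nat.cast_add_one_ne_zero l
    have hcast : ((l + 2 : ℕ) : ℂ) - 1 = l + 1 := by push_cast; ring
    simp only [Nat.succ_eq_add_one, Nat.reduceAdd, hcast, Nat.add_succ_sub_one]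
    field_simp
    simpa [mul_comm (airyI Ai j _ _)] using h
  · intro j k l hk hl
    obtain ⟨k, rfl⟩ := Nat.exists_eq_add_of_le' hk
    obtain ⟨l, rfl⟩ := Nat.exists_eq_add_of_le' (show 2 ≤ l by omega)
    have h := airyI_recurrence hsys hAi_d1 hAi_d2 hAi_ode j (k := k + 1) (l := l) (by omega)
    have hne : (l : ℂ) + 1 ≠ 0 := Nat.cast_add_one_ne_zero l
    have hcast : ((l + 2 : ℕ) : ℂ) - 1 = l + 1 := by push_cast; ring
    have hcast' : ((k + 2 : ℕ) : ℂ) - 1 = k + 1 := by push_cast; ring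
    simp only [hcast, hcast', Nat.add_succ_sub_one, Nat.add_sub_cancel]
    field_simp
    simpa [mul_comm (airyI Ai j _ _)] using h
end

section
/- One has I(0, 2, 4) = (1/3)·I(1, 0, 2), i.e. (1/(2π)) ∫_ℝ Ai'(iy)²/Ai(iy)⁴ dy = (1/3)·(1/(2π)) ∫_ℝ iy/Ai(iy)² dy. -/
/-- A real function with nonnegative derivative on `[x, y]` satisfies `h x ≤ h y`. -/
lemma le_of_hasDerivAt_nonneg {h h' : ℝ → ℝ} (hd : ∀ y, HasDerivAt h (h' y) y)
    {x y : ℝ} (hxy : x ≤ y) (hn : ∀ t, x ≤ t → t ≤ y → 0 ≤ h' t) : h x ≤ h y := by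
  refine monotoneOn_of_deriv_nonneg (convex_Icc x y)
    (fun t _ => (hd t).continuousAt.continuousWithinAt)
    (fun t _ => (hd t).differentiableAt.differentiableWithinAt) (fun t ht => ?_)
    (Set.left_mem_Icc.2 hxy) (Set.right_mem_Icc.2 hxy) hxy
  rw [interior_Icc] at ht
  rw [(hd t).deriv]
  exact hn t ht.1.le ht.2.le

/-- Growth of the positive linear system `u' = A`, `A' = 2P`, `P' = 2yV`, `V' = yu`. -/
lemma positive_system_growth {u A P V : ℝ → ℝ}
    (hu : ∀ y, HasDerivAt u (A y) y) (hA : ∀ y, HasDerivAt A (2 * P y) y)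
    (hP : ∀ y, HasDerivAt P (2 * y * V y) y) (hV : ∀ y, HasDerivAt V (y * u y) y)
    (hu0 : 0 < u 0) (hA0 : A 0 = 0) (hP0 : 0 ≤ P 0) (hV0 : 0 ≤ V 0)
    (hu_nonneg : ∀ y, 0 ≤ u y) (hP_nonneg : ∀ y, 0 ≤ P y) :
    ∃ c > 0, ∃ C, ∀ y, 0 ≤ y → c * (1 + y ^ 6) ≤ u y ∧ P y ≤ C * (1 + y ^ 4) * u y := by
  have hA_nonneg : ∀ y, 0 ≤ y → 0 ≤ A y := fun y hy => by
    rw [← hA0]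
    exact le_of_hasDerivAt_nonneg hA hy fun t _ _ => by linarith [hP_nonneg t]
  have hu_mono : ∀ x y, 0 ≤ x → x ≤ y → u x ≤ u y := fun x y hx hxy =>
    le_of_hasDerivAt_nonneg hu hxy fun t ht _ => hA_nonneg t (hx.trans ht)
  have hV_mono : ∀ x y, 0 ≤ x → x ≤ y → V x ≤ V y := fun x y hx hxy =>
    le_of_hasDerivAt_nonneg hV hxy fun t ht _ => mul_nonneg (hx.trans ht) (hu_nonneg t)
  have hpow : ∀ (n : ℕ) (k y : ℝ),
      HasDerivAt (fun t : ℝ => k * t ^ (n + 1)) (k * ((n + 1 : ℕ) * y ^ n)) y := fun n k y => by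
    simpa using (hasDerivAt_pow (n + 1) y).const_mul k
  have hV_low : ∀ y, 0 ≤ y → u 0 / 2 * y ^ 2 ≤ V y := fun y hy => by
    have := le_of_hasDerivAt_nonneg (fun t => (hV t).sub (hpow 1 (u 0 / 2) t)) hy
      fun t ht _ => by
        have := mul_le_mul_of_nonneg_left (hu_mono 0 t le_rfl ht) ht
        push_cast; linarith
    simp at this; linarith
  have hP_low : ∀ y, 0 ≤ y → u 0 / 4 * y ^ 4 ≤ P y := fun y hy => by
    have := le_of_hasDerivAt_nonneg (fun t => (hP t).sub (hpow 3 (u 0 / 4) t)) hy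
      fun t ht _ => by
        have := mul_le_mul_of_nonneg_left (hV_low t ht) ht
        push_cast; linarith
    simp at this; linarith
  have hA_low : ∀ y, 0 ≤ y → u 0 / 10 * y ^ 5 ≤ A y := fun y hy => by
    have := le_of_hasDerivAt_nonneg (fun t => (hA t).sub (hpow 4 (u 0 / 10) t)) hy
      fun t ht _ => by
        have := hP_low t ht
        push_cast; linarith
    simp at this; linarith
  have hu_low : ∀ y, 0 ≤ y → u 0 + u 0 / 60 * y ^ 6 ≤ u y := fun y hy => by
    have := le_of_hasDerivAt_nonneg (fun t => (hu t).sub (hpow 5 (u 0 / 60) t)) hy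
      fun t ht _ => by
        have := hA_low t ht
        push_cast; linarith
    simp at this; linarith
  have hV_up : ∀ y, 0 ≤ y → V y ≤ V 0 + y ^ 2 * u y := fun y hy => by
    have := le_of_hasDerivAt_nonneg (fun t => (hpow 0 (y * u y) t).sub (hV t)) hy
      fun t ht hty => by
        have := mul_le_mul hty (hu_mono t y ht hty) (hu_nonneg t) hy
        push_cast; linarith
    simp at this; nlinarith
  have hP_up : ∀ y, 0 ≤ y → P y ≤ P 0 + 2 * y ^ 2 * V y := fun y hy => by
    have := le_of_hasDerivAt_nonneg (fun t => (hpow 0 (2 * y * V y) t).sub (hP t)) hy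
      fun t ht hty => by
        have := mul_le_mul hty (hV_mono t y ht hty) (hV0.trans (hV_mono 0 t le_rfl ht)) hy
        push_cast; linarith
    simp at this; nlinarith
  refine ⟨u 0 / 60, by positivity, P 0 / u 0 + 2 * (V 0 / u 0) + 2, fun y hy => ⟨?_, ?_⟩⟩
  · linarith [hu_low y hy]
  · have huy := hu_mono 0 y le_rfl hy
    have h1 : P 0 ≤ P 0 / u 0 * u y := by
      calc P 0 = P 0 / u 0 * u 0 := by field_simp
        _ ≤ _ := by gcongr
    have h2 : V 0 ≤ V 0 / u 0 * u y := by
      calc V 0 = V 0 / u 0 * u 0 := by field_simp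
        _ ≤ _ := by gcongr
    have h3 : 2 * y ^ 2 ≤ 2 * (1 + y ^ 4) := by nlinarith [sq_nonneg (y ^ 2 - 1)]
    have hv : 0 ≤ V 0 / u 0 * u y := hV0.trans h2
    have hp : 0 ≤ P 0 / u 0 * u y := hP0.trans h1
    calc P y ≤ P 0 + 2 * y ^ 2 * V y := hP_up y hy
      _ ≤ P 0 + 2 * y ^ 2 * (V 0 + y ^ 2 * u y) := by gcongr; exact hV_up y hy
      _ = P 0 + 2 * y ^ 2 * V 0 + 2 * y ^ 4 * u y := by ring
      _ ≤ P 0 / u 0 * u y + 2 * (1 + y ^ 4) * (V 0 / u 0 * u y) + 2 * y ^ 4 * u y := by gcongr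
      _ ≤ _ := by nlinarith [mul_nonneg hp (by positivity : 0 ≤ y ^ 4), hu_nonneg y]

/-- Solutions of `w'' = -i y w` with `w 0 > 0` and `w' 0 = i b`, `b ≤ 0`, grow on `[0, ∞)`. -/
lemma rotated_airy_growth_s12 {w w' : ℝ → ℂ} {a b : ℝ}
    (hw : ∀ y, HasDerivAt w (w' y) y)
    (hw' : ∀ y : ℝ, HasDerivAt w' (-(Complex.I * y * w y)) y)
    (h0 : w 0 = a) (h0' : w' 0 = Complex.I * b) (ha : 0 < a) (hb : b ≤ 0) :
    ∃ c > 0, ∃ C, ∀ y, 0 ≤ y →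
      c * (1 + y ^ 6) ≤ ‖w y‖ ^ 2 ∧ ‖w' y‖ ^ 2 ≤ C * (1 + y ^ 4) * ‖w y‖ ^ 2 := by
  have hre {f : ℝ → ℂ} {f' : ℂ} {y : ℝ} (h : HasDerivAt f f' y) :
      HasDerivAt (fun t => (f t).re) f'.re y :=
    Complex.reCLM.hasFDerivAt.comp_hasDerivAt y h
  have him {f : ℝ → ℂ} {f' : ℂ} {y : ℝ} (h : HasDerivAt f f' y) :
      HasDerivAt (fun t => (f t).im) f'.im y :=
    Complex.imCLM.hasFDerivAt.comp_hasDerivAt y h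
  have hp := fun y => hre (hw y)
  have hq := fun y => him (hw y)
  have hr := fun y => hre (hw' y)
  have hs := fun y => him (hw' y)
  simp only [Complex.sq_norm, Complex.normSq_apply]
  refine positive_system_growth
    (A := fun y => 2 * ((w y).re * (w' y).re + (w y).im * (w' y).im))
    (V := fun y => (w y).im * (w' y).re - (w y).re * (w' y).im)
    (fun y => ?_) (fun y => ?_) (fun y => ?_) (fun y => ?_) ?_ ?_ ?_ ?_
    (fun y => add_nonneg (mul_self_nonneg _) (mul_self_nonneg _))
    (fun y => add_nonneg (mul_self_nonneg _) (mul_self_nonneg _))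
  · exact (((hp y).mul (hp y)).add ((hq y).mul (hq y))).congr_deriv (by ring)
  · exact ((((hp y).mul (hr y)).add ((hq y).mul (hs y))).const_mul 2).congr_deriv
      (by simp; ring)
  · exact (((hr y).mul (hr y)).add ((hs y).mul (hs y))).congr_deriv (by simp; ring)
  · exact (((hq y).mul (hr y)).sub ((hp y).mul (hs y))).congr_deriv (by simp; ring)
  · simp [h0, ha.ne']
  · simp [h0, h0']
  · exact add_nonneg (mul_self_nonneg _) (mul_self_nonneg _)
  · simp [h0, h0']; nlinarith

theorem airyI_0_2_4 (Ai : ℂ → ℂ)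
    (hAi_d1 : Differentiable ℂ Ai)
    (hAi_d2 : Differentiable ℂ (deriv Ai))
    (hAi_ode : ∀ z : ℂ, deriv (deriv Ai) z = z * Ai z)
    (hAi_0 : Ai 0 = (3 : ℂ) ^ (-(2 : ℂ) / 3) / Complex.Gamma (2 / 3))
    (hAi_0' : deriv Ai 0 = -(3 : ℂ) ^ (-(1 : ℂ) / 3) / Complex.Gamma (1 / 3))
    (hAi_zeros : ∀ z : ℂ, Ai z = 0 → ∃ x : ℝ, x < 0 ∧ z = (x : ℂ)) :
    airyI Ai 0 2 4 = (1 / 3) * airyI Ai 1 0 2 := by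
  obtain ⟨a, ha, h0⟩ : ∃ a : ℝ, 0 < a ∧ Ai 0 = a := by
    refine ⟨(3 : ℝ) ^ (-(2 : ℝ) / 3) / Real.Gamma (2 / 3), ?_, ?_⟩
    · have := Real.Gamma_pos_of_pos (show (0 : ℝ) < 2 / 3 by norm_num)
      positivity
    · rw [hAi_0, Complex.ofReal_div, Complex.ofReal_cpow (by norm_num), ← Complex.Gamma_ofReal]
      push_cast; rfl
  obtain ⟨b, hb, h0'⟩ : ∃ b : ℝ, b ≤ 0 ∧ deriv Ai 0 = b := by
    refine ⟨-(3 : ℝ) ^ (-(1 : ℝ) / 3) / Real.Gamma (1 / 3), ?_, ?_⟩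
    · have := Real.Gamma_pos_of_pos (show (0 : ℝ) < 1 / 3 by norm_num)
      rw [neg_div, neg_nonpos]
      positivity
    · rw [hAi_0', Complex.ofReal_div, Complex.ofReal_neg, Complex.ofReal_cpow (by norm_num),
        ← Complex.Gamma_ofReal]
      push_cast; rfl
  have hline : ∀ y : ℝ, HasDerivAt (fun t : ℝ => Complex.I * (t : ℂ)) Complex.I y := fun y => by
    simpa using (Complex.ofRealCLM.hasDerivAt (x := y)).const_mul Complex.I
  have hd1 : ∀ y : ℝ, HasDerivAt (fun t : ℝ => Ai (Complex.I * t))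
      (Complex.I * deriv Ai (Complex.I * y)) y := fun y =>
    ((hAi_d1 _).hasDerivAt.comp y (hline y)).congr_deriv (by ring)
  have hd2 : ∀ y : ℝ, HasDerivAt (fun t : ℝ => deriv Ai (Complex.I * t))
      (Complex.I * (Complex.I * y * Ai (Complex.I * y))) y := fun y =>
    ((hAi_d2 _).hasDerivAt.comp y (hline y)).congr_deriv (by rw [hAi_ode]; ring)
  have hpos := rotated_airy_growth_s12 (w := fun y => Ai (Complex.I * y))
    (w' := fun y => Complex.I * deriv Ai (Complex.I * y)) hd1
    (fun y => ((hd2 y).const_mul Complex.I).congr_deriv (by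
      linear_combination Complex.I * y * Ai (Complex.I * y) * Complex.I_mul_I))
    (by simpa using h0) (by simpa using h0') ha hb
  have hneg_line : ∀ {f : ℝ → ℂ} {f' : ℂ} (y : ℝ), HasDerivAt f f' (-y) →
      HasDerivAt (fun t => starRingEnd ℂ (f (-t))) (-starRingEnd ℂ f') y := fun {f f'} y h =>
    ((h.scomp y (hasDerivAt_neg y)).star).congr_deriv (by simp)
  have hneg := rotated_airy_growth_s12 (w := fun y => starRingEnd ℂ (Ai (Complex.I * (-y : ℝ))))
    (w' := fun y => -starRingEnd ℂ (Complex.I * deriv Ai (Complex.I * (-y : ℝ))))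
    (fun y => hneg_line y (hd1 (-y)))
    (fun y => (hneg_line y ((hd2 (-y)).const_mul Complex.I)).neg.congr_deriv (by
      simp
      linear_combination Complex.I * y * starRingEnd ℂ (Ai (-(Complex.I * y))) * Complex.I_mul_I))
    (by simp [h0]) (by simp [h0']) ha hb
  obtain ⟨c, hc, C, hC⟩ : ∃ c > 0, ∃ C, ∀ y : ℝ, c * (1 + y ^ 6) ≤ ‖Ai (Complex.I * y)‖ ^ 2 ∧
      ‖deriv Ai (Complex.I * y)‖ ^ 2 ≤ C * (1 + y ^ 4) * ‖Ai (Complex.I * y)‖ ^ 2 := by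
    obtain ⟨c₁, hc₁, C₁, h₁⟩ := hpos
    obtain ⟨c₂, hc₂, C₂, h₂⟩ := hneg
    simp only [norm_neg, RCLike.norm_conj, norm_mul, Complex.norm_I, one_mul] at h₁ h₂
    refine ⟨min c₁ c₂, lt_min hc₁ hc₂, max C₁ C₂, fun y => ?_⟩
    rcases le_total 0 y with hy | hy
    · refine ⟨le_trans ?_ (h₁ y hy).1, (h₁ y hy).2.trans ?_⟩
      · gcongr; exact min_le_left _ _
      · gcongr; exact le_max_left _ _
    · have h := h₂ (-y) (neg_nonneg.2 hy)
      rw [neg_neg, Even.neg_pow (by decide), Even.neg_pow (by decide)] at h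
      refine ⟨le_trans ?_ h.1, h.2.trans ?_⟩
      · gcongr; exact min_le_right _ _
      · gcongr; exact le_max_right _ _
  have hne : ∀ y : ℝ, Ai (Complex.I * y) ≠ 0 := fun y h => by
    have := (hC y).1
    rw [h] at this
    have : 0 < c * (1 + y ^ 6) := by positivity
    simp at *; linarith
  have hcont1 : Continuous fun y : ℝ => Ai (Complex.I * y) :=
    continuous_iff_continuousAt.2 fun y => (hd1 y).continuousAt
  have hcont2 : Continuous fun y : ℝ => deriv Ai (Complex.I * y) :=
    continuous_iff_continuousAt.2 fun y => (hd2 y).continuousAt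
  have hint {f : ℝ → ℂ} (hf : Continuous f) {K : ℝ} (hK : ∀ y, ‖f y‖ ≤ K * (1 + y ^ 2)⁻¹) :
      MeasureTheory.Integrable f :=
    (integrable_inv_one_add_sq.const_mul K).mono' hf.aestronglyMeasurable (.of_forall hK)
  have hinv : ∀ y : ℝ, (‖Ai (Complex.I * y)‖ ^ 2)⁻¹ ≤ (c * (1 + y ^ 6))⁻¹ := fun y =>
    inv_anti₀ (by positivity) (hC y).1
  have hC0 : 0 ≤ C := by
    by_contra! h
    have h1 := (hC 0).2
    have h2 : 0 < ‖Ai (Complex.I * (0 : ℝ))‖ ^ 2 := by have := hne 0; positivity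
    nlinarith [sq_nonneg ‖deriv Ai (Complex.I * (0 : ℝ))‖]
  have hb0 : ∀ y : ℝ, (‖Ai (Complex.I * y)‖ ^ 2)⁻¹ ≤ 3 / c * (1 + y ^ 2)⁻¹ := fun y => by
    refine (hinv y).trans ?_
    rw [← div_eq_mul_inv, div_div, inv_eq_one_div, div_le_div_iff₀ (by positivity) (by positivity)]
    have : 1 + y ^ 2 ≤ 3 * (1 + y ^ 6) := by
      nlinarith [sq_nonneg (y ^ 2 - 1), sq_nonneg (y ^ 3 - y), sq_nonneg y]
    nlinarith
  have hb1 : ∀ y : ℝ, ‖Complex.I * (y : ℂ) / Ai (Complex.I * y) ^ 2‖ ≤ 3 / c * (1 + y ^ 2)⁻¹ :=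
    fun y => by
    rw [norm_div, norm_mul, Complex.norm_I, one_mul, Complex.norm_real, norm_pow,
      Real.norm_eq_abs, div_eq_mul_inv]
    refine (mul_le_mul_of_nonneg_left (hinv y) (abs_nonneg y)).trans ?_
    rw [← div_eq_mul_inv, ← div_eq_mul_inv, div_div, div_le_div_iff₀ (by positivity) (by positivity)]
    have : |y| * (1 + y ^ 2) ≤ 3 * (1 + y ^ 6) := by
      have h1 : |y| ≤ (1 + y ^ 2) / 2 := by nlinarith [sq_nonneg (|y| - 1), sq_abs y]
      have h2 : y ^ 4 ≤ 1 + y ^ 6 := by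
        nlinarith [sq_nonneg (y ^ 2 - 1), sq_nonneg (y ^ 3 - y), sq_nonneg y]
      nlinarith [sq_nonneg (y ^ 2 - 1), sq_nonneg y]
    nlinarith
  have hb2 : ∀ y : ℝ, ‖deriv Ai (Complex.I * y) ^ 2 / Ai (Complex.I * y) ^ 4‖ ≤
      3 * C / c * (1 + y ^ 2)⁻¹ := fun y => by
    have hu : 0 < ‖Ai (Complex.I * y)‖ ^ 2 := by have := hne y; positivity
    rw [norm_div, norm_pow, norm_pow]
    calc _ ≤ C * (1 + y ^ 4) * ‖Ai (Complex.I * y)‖ ^ 2 / ‖Ai (Complex.I * y)‖ ^ 4 := by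
          gcongr; exact (hC y).2
      _ = C * (1 + y ^ 4) * (‖Ai (Complex.I * y)‖ ^ 2)⁻¹ := by
          have := hne y
          field_simp
      _ ≤ C * (1 + y ^ 4) * (c * (1 + y ^ 6))⁻¹ := by gcongr ?_ * ?_; exact hinv y
      _ ≤ _ := by
          rw [← div_eq_mul_inv, ← div_eq_mul_inv, div_div,
            div_le_div_iff₀ (by positivity) (by positivity)]
          have h2 : y ^ 4 ≤ 1 + y ^ 6 := by
            nlinarith [sq_nonneg (y ^ 2 - 1), sq_nonneg (y ^ 3 - y), sq_nonneg y]
          have : (1 + y ^ 4) * (1 + y ^ 2) ≤ 3 * (1 + y ^ 6) := by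
            nlinarith [mul_nonneg (sq_nonneg (y ^ 2 - 1)) (by positivity : 0 ≤ 1 + y ^ 2)]
          nlinarith [mul_le_mul_of_nonneg_left this (mul_nonneg hC0 hc.le)]
  have hi1 : MeasureTheory.Integrable
      (fun y : ℝ => Complex.I * (y : ℂ) / Ai (Complex.I * y) ^ 2) := hint (Continuous.div (by fun_prop) (hcont1.pow 2) fun y => pow_ne_zero _ (hne y)) hb1
  have hi2 : MeasureTheory.Integrable
      (fun y : ℝ => deriv Ai (Complex.I * y) ^ 2 / Ai (Complex.I * y) ^ 4) := hint ((hcont2.pow 2).div (hcont1.pow 4) fun y => pow_ne_zero _ (hne y)) hb2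
  have hF : ∀ y : ℝ, HasDerivAt
      (fun t : ℝ => deriv Ai (Complex.I * t) / Ai (Complex.I * t) ^ 3)
      (Complex.I * (Complex.I * (y : ℂ) / Ai (Complex.I * y) ^ 2 -
        3 * (deriv Ai (Complex.I * y) ^ 2 / Ai (Complex.I * y) ^ 4))) y := fun y =>
    ((hd2 y).div ((hd1 y).pow 3) (pow_ne_zero 3 (hne y))).congr_deriv (by
      have := hne y
      simp only [Pi.pow_apply]
      push_cast
      field_simp)
  have hiF : MeasureTheory.Integrable
      (fun t : ℝ => deriv Ai (Complex.I * t) / Ai (Complex.I * t) ^ 3) := by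
    refine hint (K := 3 * C / c + 3 / c)
      (hcont2.div (hcont1.pow 3) fun y => pow_ne_zero _ (hne y)) fun y => ?_
    have h1 := hb2 y
    have h2 := hb0 y
    rw [norm_div, norm_pow, norm_pow] at h1
    rw [norm_div, norm_pow, add_mul]
    refine le_trans ?_ (add_le_add h1 h2)
    have := norm_pos_iff.2 (hne y)
    set p := ‖deriv Ai (Complex.I * y)‖
    set q := ‖Ai (Complex.I * y)‖
    have e1 : p / q ^ 3 = p / q ^ 2 * q⁻¹ := by field_simp
    have e2 : p ^ 2 / q ^ 4 + (q ^ 2)⁻¹ = (p / q ^ 2) ^ 2 + q⁻¹ ^ 2 := by field_simp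
    rw [e1, e2]
    nlinarith [sq_nonneg (p / q ^ 2 - q⁻¹), sq_nonneg (p / q ^ 2), sq_nonneg q⁻¹]
  have hzero := MeasureTheory.integral_eq_zero_of_hasDerivAt_of_integrable hF
    ((hi1.sub (hi2.const_mul 3)).const_mul Complex.I) hiF
  rw [MeasureTheory.integral_const_mul, MeasureTheory.integral_sub hi1 (hi2.const_mul 3),
    MeasureTheory.integral_const_mul] at hzero
  have hz := (mul_eq_zero.1 hzero).resolve_left Complex.I_ne_zero
  simp only [airyI, pow_zero, one_mul, pow_one, mul_one]
  linear_combination (-(1 / 3) * (1 / (2 * (Real.pi : ℂ)))) * hz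
end

section
/- One has I(1, 2, 4) = (1/3)·I(2, 0, 2), i.e. (1/(2π)) ∫_ℝ (iy)·Ai'(iy)²/Ai(iy)⁴ dy = (1/3)·(1/(2π)) ∫_ℝ (iy)²/Ai(iy)² dy. -/
theorem nonneg_of_hasDerivAt_of_nonneg {f f' : ℝ → ℝ} (hf : ∀ y, HasDerivAt f (f' y) y)
    (hf' : ∀ y, 0 ≤ y → 0 ≤ f' y) (h0 : 0 ≤ f 0) {y : ℝ} (hy : 0 ≤ y) : 0 ≤ f y := by
  have hmono : MonotoneOn f (Set.Ici 0) := by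
    refine monotoneOn_of_deriv_nonneg (convex_Ici 0)
      (fun x _ => (hf x).continuousAt.continuousWithinAt)
      (fun x _ => (hf x).differentiableAt.differentiableWithinAt) ?_
    intro x hx
    rw [interior_Ici] at hx
    rw [(hf x).deriv]
    exact hf' x (le_of_lt hx)
  exact h0.trans (hmono Set.self_mem_Ici hy hy)

/-- If `c * y ^ m ≤ f' y` on `[0, ∞)` and `0 ≤ f 0`, then integrating preserves the bound. -/
theorem mul_pow_le_of_hasDerivAt {f f' : ℝ → ℝ} (hf : ∀ y, HasDerivAt f (f' y) y) (h0 : 0 ≤ f 0)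
    (c : ℝ) (m : ℕ) (h : ∀ y, 0 ≤ y → c * y ^ m ≤ f' y) {y : ℝ} (hy : 0 ≤ y) :
    c / (m + 1) * y ^ (m + 1) ≤ f y := by
  have hd : ∀ y, HasDerivAt (fun y => f y - c / (m + 1) * y ^ (m + 1)) (f' y - c * y ^ m) y := by
    intro y
    have h1 := (hf y).sub ((hasDerivAt_pow (m + 1) y).const_mul (c / (m + 1)))
    refine h1.congr_deriv ?_
    have : (m : ℝ) + 1 ≠ 0 := by positivity
    push_cast
    field_simp
  have := nonneg_of_hasDerivAt_of_nonneg hd (fun y hy => sub_nonneg.2 (h y hy))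
    (by simpa using h0) hy
  linarith

/-- The linear system satisfied by the quadratic quantities `N = |u|²`, `P = N'`, `G = |u'|²` and
`M` attached to a solution of the Airy equation along a half of the imaginary axis. -/
structure AirySystem_s13 (N P G M : ℝ → ℝ) : Prop where
  hN : ∀ y, HasDerivAt N (P y) y
  hP : ∀ y, HasDerivAt P (2 * G y) y
  hG : ∀ y, HasDerivAt G (2 * y * M y) y
  hM : ∀ y, HasDerivAt M (y * N y) y
  N_nonneg : ∀ y, 0 ≤ N y
  G_nonneg : ∀ y, 0 ≤ G y
  N_zero : 0 < N 0
  P_zero : 0 ≤ P 0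
  M_zero : 0 ≤ M 0

namespace AirySystem_s13

variable {N P G M : ℝ → ℝ}

theorem P_nonneg (h : AirySystem_s13 N P G M) {y : ℝ} (hy : 0 ≤ y) : 0 ≤ P y :=
  nonneg_of_hasDerivAt_of_nonneg h.hP (fun y _ => mul_nonneg zero_le_two (h.G_nonneg y)) h.P_zero hy

theorem N_zero_le (h : AirySystem_s13 N P G M) {y : ℝ} (hy : 0 ≤ y) : N 0 ≤ N y := by
  have := nonneg_of_hasDerivAt_of_nonneg (fun y => (h.hN y).sub_const (N 0))
    (fun y hy => h.P_nonneg hy) (by simp) hy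
  linarith

theorem mul_pow_le_N (h : AirySystem_s13 N P G M) {c : ℝ} (hc : 0 < c) (m : ℕ)
    (hcN : ∀ y, 0 ≤ y → c * y ^ m ≤ N y) :
    ∃ c' : ℝ, 0 < c' ∧ ∀ y, 0 ≤ y → c' * y ^ (m + 6) ≤ N y := by
  have h1 : ∀ y, 0 ≤ y → _ ≤ M y := fun y hy =>
    mul_pow_le_of_hasDerivAt h.hM h.M_zero c (m + 1) (fun y hy => by
      have := mul_le_mul_of_nonneg_left (hcN y hy) hy
      calc c * y ^ (m + 1) = y * (c * y ^ m) := by ring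
        _ ≤ _ := this) hy
  have h2 : ∀ y, 0 ≤ y → _ ≤ G y := fun y hy =>
    mul_pow_le_of_hasDerivAt h.hG (h.G_nonneg 0) (2 * (c / ((m + 1 : ℕ) + 1))) (m + 3)
      (fun y hy => by
        have := mul_le_mul_of_nonneg_left (h1 y hy) (by positivity : 0 ≤ 2 * y)
        refine le_trans (le_of_eq ?_) this
        ring) hy
  have h3 : ∀ y, 0 ≤ y → _ ≤ P y := fun y hy =>
    mul_pow_le_of_hasDerivAt h.hP h.P_zero
      (2 * (2 * (c / ((m + 1 : ℕ) + 1)) / ((m + 3 : ℕ) + 1))) (m + 4)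
      (fun y hy => by
        have := mul_le_mul_of_nonneg_left (h2 y hy) (zero_le_two (α := ℝ))
        refine le_trans (le_of_eq ?_) this
        ring) hy
  exact ⟨_, by positivity, fun y hy =>
    mul_pow_le_of_hasDerivAt h.hN (h.N_nonneg 0) _ (m + 5) h3 hy⟩

theorem exists_mul_pow_le_N (h : AirySystem_s13 N P G M) :
    ∃ c : ℝ, 0 < c ∧ ∀ y, 0 ≤ y → c * (1 + y ^ 2) ^ 6 ≤ N y := by
  obtain ⟨c₁, hc₁, h₁⟩ := h.mul_pow_le_N h.N_zero 0 (fun y hy => by simpa using h.N_zero_le hy)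
  obtain ⟨c₂, hc₂, h₂⟩ := h.mul_pow_le_N hc₁ _ h₁
  refine ⟨min (N 0) c₂ / 64, by have := lt_min h.N_zero hc₂; positivity, fun y hy => ?_⟩
  have hmin : 0 < min (N 0) c₂ := lt_min h.N_zero hc₂
  rcases le_total y 1 with hy1 | hy1
  · have : (1 + y ^ 2) ^ 6 ≤ 2 ^ 6 := by
      gcongr
      nlinarith
    calc min (N 0) c₂ / 64 * (1 + y ^ 2) ^ 6 ≤ min (N 0) c₂ / 64 * 2 ^ 6 := by gcongr
      _ = min (N 0) c₂ := by ring
      _ ≤ N 0 := min_le_left _ _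
      _ ≤ N y := h.N_zero_le hy
  · have : (1 + y ^ 2) ^ 6 ≤ (2 * y ^ 2) ^ 6 := by
      gcongr
      nlinarith
    calc min (N 0) c₂ / 64 * (1 + y ^ 2) ^ 6 ≤ min (N 0) c₂ / 64 * (2 * y ^ 2) ^ 6 := by gcongr
      _ = min (N 0) c₂ * y ^ 12 := by ring
      _ ≤ c₂ * y ^ 12 := by gcongr; exact min_le_right _ _
      _ ≤ N y := h₂ y hy

theorem exists_G_le (h : AirySystem_s13 N P G M) :
    ∃ K : ℝ, 0 ≤ K ∧ ∀ y, 0 ≤ y → G y ≤ K * (1 + y ^ 2) ^ 2 * N y := by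
  have hN0 := h.N_zero
  set k := M 0 / N 0 with hk
  set g := G 0 / N 0 with hg
  have hk0 : 0 ≤ k := div_nonneg h.M_zero hN0.le
  have hg0 : 0 ≤ g := div_nonneg (h.G_nonneg 0) hN0.le
  have h1 : ∀ y, 0 ≤ y → 0 ≤ N y * (k + y ^ 2 / 2) - M y := fun y hy => by
    refine nonneg_of_hasDerivAt_of_nonneg (f := fun y => N y * (k + y ^ 2 / 2) - M y)
      (f' := fun y => P y * (k + y ^ 2 / 2)) (fun y => ?_) (fun y hy => ?_) ?_ hy
    · refine (((h.hN y).mul (((hasDerivAt_pow 2 y).div_const 2).const_add k)).sub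
        (h.hM y)).congr_deriv ?_
      norm_num
      ring
    · exact mul_nonneg (h.P_nonneg hy) (by positivity)
    · simp [hk, mul_div_cancel₀ _ hN0.ne']
  have h2 : ∀ y, 0 ≤ y → 0 ≤ N y * (g + k * y ^ 2 + y ^ 4 / 4) - G y := fun y hy => by
    refine nonneg_of_hasDerivAt_of_nonneg (f := fun y => N y * (g + k * y ^ 2 + y ^ 4 / 4) - G y)
      (f' := fun y => P y * (g + k * y ^ 2 + y ^ 4 / 4) + 2 * y * (N y * (k + y ^ 2 / 2) - M y))
      (fun y => ?_) (fun y hy => ?_) ?_ hy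
    · refine (((h.hN y).mul ((((hasDerivAt_pow 2 y).const_mul k).const_add g).add
        ((hasDerivAt_pow 4 y).div_const 4))).sub (h.hG y)).congr_deriv ?_
      norm_num
      ring
    · exact add_nonneg (mul_nonneg (h.P_nonneg hy) (by positivity))
        (mul_nonneg (by positivity) (h1 y hy))
    · simp [hg, mul_div_cancel₀ _ hN0.ne']
  refine ⟨g + k + 1, by positivity, fun y hy => ?_⟩
  have hle : g + k * y ^ 2 + y ^ 4 / 4 ≤ (g + k + 1) * (1 + y ^ 2) ^ 2 := by
    have e : (g + k + 1) * (1 + y ^ 2) ^ 2 - (g + k * y ^ 2 + y ^ 4 / 4)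
        = g * (2 * y ^ 2 + y ^ 4) + k * (1 + y ^ 2 + y ^ 4) + (1 + 2 * y ^ 2 + 3 / 4 * y ^ 4) := by
      ring
    have : 0 ≤ (g + k + 1) * (1 + y ^ 2) ^ 2 - (g + k * y ^ 2 + y ^ 4 / 4) := by
      rw [e]; positivity
    linarith
  have := mul_le_mul_of_nonneg_right hle (h.N_nonneg y)
  linarith [h2 y hy]

end AirySystem_s13

theorem airySystem_of_ode {A : ℂ → ℂ} (h1 : Differentiable ℂ A) (h2 : Differentiable ℂ (deriv A))
    (hode : ∀ z : ℂ, deriv (deriv A) z = z * A z) {a b : ℝ} (ha : A 0 = a) (hb : deriv A 0 = b)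
    (ha0 : 0 < a) (hb0 : b ≤ 0) {s : ℝ} (hs : s * s = 1) :
    AirySystem_s13 (fun y : ℝ => Complex.normSq (A (Complex.I * (s * y : ℝ))))
      (fun y : ℝ => -2 * s * (starRingEnd ℂ (A (Complex.I * (s * y : ℝ))) *
        deriv A (Complex.I * (s * y : ℝ))).im)
      (fun y : ℝ => Complex.normSq (deriv A (Complex.I * (s * y : ℝ))))
      (fun y : ℝ => -(starRingEnd ℂ (A (Complex.I * (s * y : ℝ))) *
        deriv A (Complex.I * (s * y : ℝ))).re) := by
  have hz : ∀ y : ℝ, HasDerivAt (fun y : ℝ => Complex.I * ((s * y : ℝ) : ℂ)) (Complex.I * s) y := by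
    intro y
    simpa using (((hasDerivAt_id y).const_mul s).ofReal_comp).const_mul Complex.I
  have hu : ∀ y : ℝ, HasDerivAt (fun y : ℝ => A (Complex.I * (s * y : ℝ)))
      (deriv A (Complex.I * (s * y : ℝ)) * (Complex.I * s)) y := fun y =>
    (h1 _).hasDerivAt.comp y (hz y)
  have hd : ∀ y : ℝ, HasDerivAt (fun y : ℝ => deriv A (Complex.I * (s * y : ℝ)))
      (-(y * A (Complex.I * (s * y : ℝ)))) y := fun y => by
    have := (h2 _).hasDerivAt.comp y (hz y)
    refine this.congr_deriv ?_
    rw [hode]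
    have hs' : (s : ℂ) * s = 1 := by exact_mod_cast hs
    push_cast
    linear_combination (A (Complex.I * (s * y)) * y * s * s) * Complex.I_mul_I
      - A (Complex.I * (s * y)) * y * hs'
  have re : ∀ {f : ℝ → ℂ} {f' : ℂ} {y : ℝ}, HasDerivAt f f' y →
      HasDerivAt (fun y => (f y).re) f'.re y := fun h =>
    (Complex.reCLM.hasFDerivAt.comp_hasDerivAt _ h)
  have im : ∀ {f : ℝ → ℂ} {f' : ℂ} {y : ℝ}, HasDerivAt f f' y →
      HasDerivAt (fun y => (f y).im) f'.im y := fun h =>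
    (Complex.imCLM.hasFDerivAt.comp_hasDerivAt _ h)
  refine ⟨fun y => ?_, fun y => ?_, fun y => ?_, fun y => ?_, fun y => Complex.normSq_nonneg _,
    fun y => Complex.normSq_nonneg _, ?_, ?_, ?_⟩
  · simp only [Complex.normSq_apply]
    refine (((re (hu y)).mul (re (hu y))).add ((im (hu y)).mul (im (hu y)))).congr_deriv ?_
    simp
    ring
  · simp only [Complex.mul_im, Complex.conj_re, Complex.conj_im]
    refine ((((re (hu y)).mul (im (hd y))).add ((im (hu y)).neg.mul (re (hd y)))).const_mul
      (-2 * s)).congr_deriv ?_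
    simp [Complex.normSq_apply]
    linear_combination (2 * ((deriv A (Complex.I * (s * y))).re ^ 2 +
      (deriv A (Complex.I * (s * y))).im ^ 2)) * hs
  · simp only [Complex.normSq_apply]
    refine (((re (hd y)).mul (re (hd y))).add ((im (hd y)).mul (im (hd y)))).congr_deriv ?_
    simp
    ring
  · simp only [Complex.mul_re, Complex.conj_re, Complex.conj_im]
    refine (((re (hu y)).mul (re (hd y))).sub ((im (hu y)).neg.mul (im (hd y)))).neg.congr_deriv ?_
    simp [Complex.normSq_apply]
    ring
  · simp [ha, ha0.ne']
  · simp [ha, hb]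
  · simp [ha, hb]
    nlinarith

theorem integrable_of_norm_le_inv_one_add_sq {f : ℝ → ℂ} (hf : Continuous f) (C : ℝ)
    (h : ∀ y, ‖f y‖ ≤ C * (1 + y ^ 2)⁻¹) : MeasureTheory.Integrable f :=
  (integrable_inv_one_add_sq.const_mul C).mono' hf.aestronglyMeasurable (.of_forall h)

/-- Growth of a solution of the Airy equation with `A 0 > 0` and `A' 0 ≤ 0` along the imaginary
axis, together with a polynomial bound for its logarithmic derivative. -/
theorem airy_imaginary_axis_bounds {A : ℂ → ℂ} (h1 : Differentiable ℂ A)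
    (h2 : Differentiable ℂ (deriv A)) (hode : ∀ z : ℂ, deriv (deriv A) z = z * A z) {a b : ℝ}
    (ha : A 0 = a) (hb : deriv A 0 = b) (ha0 : 0 < a) (hb0 : b ≤ 0) :
    ∃ c K : ℝ, 0 < c ∧ 0 ≤ K ∧ ∀ y : ℝ, c * (1 + y ^ 2) ^ 6 ≤ ‖A (Complex.I * y)‖ ^ 2 ∧
      ‖deriv A (Complex.I * y)‖ ^ 2 ≤ K * (1 + y ^ 2) ^ 2 * ‖A (Complex.I * y)‖ ^ 2 := by
  have hp := airySystem_of_ode h1 h2 hode ha hb ha0 hb0 (s := 1) (by norm_num)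
  have hm := airySystem_of_ode h1 h2 hode ha hb ha0 hb0 (s := -1) (by norm_num)
  obtain ⟨c₁, hc₁, hN₁⟩ := hp.exists_mul_pow_le_N
  obtain ⟨c₂, hc₂, hN₂⟩ := hm.exists_mul_pow_le_N
  obtain ⟨K₁, hK₁, hG₁⟩ := hp.exists_G_le
  obtain ⟨K₂, hK₂, hG₂⟩ := hm.exists_G_le
  simp only [Complex.normSq_eq_norm_sq] at hN₁ hN₂ hG₁ hG₂
  refine ⟨min c₁ c₂, max K₁ K₂, lt_min hc₁ hc₂, le_max_of_le_left hK₁, fun y => ?_⟩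
  rcases le_total 0 y with hy | hy
  · have e1 := hN₁ y hy
    have e2 := hG₁ y hy
    rw [one_mul] at e1 e2
    refine ⟨le_trans ?_ e1, e2.trans ?_⟩
    · gcongr; exact min_le_left _ _
    · gcongr; exact le_max_left _ _
  · have e1 := hN₂ (-y) (by linarith)
    have e2 := hG₂ (-y) (by linarith)
    rw [neg_one_mul, neg_neg, neg_sq] at e1 e2
    refine ⟨le_trans ?_ e1, e2.trans ?_⟩
    · gcongr; exact min_le_right _ _
    · gcongr; exact le_max_right _ _

theorem airyI_1_2_4 (Ai : ℂ → ℂ)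
    (hAi_d1 : Differentiable ℂ Ai)
    (hAi_d2 : Differentiable ℂ (deriv Ai))
    (hAi_ode : ∀ z : ℂ, deriv (deriv Ai) z = z * Ai z)
    (hAi_0 : Ai 0 = (3 : ℂ) ^ (-(2 : ℂ) / 3) / Complex.Gamma (2 / 3))
    (hAi_0' : deriv Ai 0 = -(3 : ℂ) ^ (-(1 : ℂ) / 3) / Complex.Gamma (1 / 3))
    (hAi_zeros : ∀ z : ℂ, Ai z = 0 → ∃ x : ℝ, x < 0 ∧ z = (x : ℂ)) :
    airyI Ai 1 2 4 = (1 / 3) * airyI Ai 2 0 2 := by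
  have ha : Ai 0 = (((3 : ℝ) ^ (-(2 : ℝ) / 3) / Real.Gamma (2 / 3) : ℝ) : ℂ) := by
    rw [hAi_0, Complex.ofReal_div, Complex.ofReal_cpow (by norm_num), ← Complex.Gamma_ofReal]
    push_cast
    rfl
  have hb : deriv Ai 0 = ((-(3 : ℝ) ^ (-(1 : ℝ) / 3) / Real.Gamma (1 / 3) : ℝ) : ℂ) := by
    rw [hAi_0', Complex.ofReal_div, Complex.ofReal_neg, Complex.ofReal_cpow (by norm_num),
      ← Complex.Gamma_ofReal]
    push_cast
    rfl
  have hΓ₁ : 0 < Real.Gamma (1 / 3) := Real.Gamma_pos_of_pos (by norm_num)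
  have hΓ₂ : 0 < Real.Gamma (2 / 3) := Real.Gamma_pos_of_pos (by norm_num)
  obtain ⟨c, K, hc, hK, hbd⟩ := airy_imaginary_axis_bounds hAi_d1 hAi_d2 hAi_ode ha hb
    (by positivity) (div_nonpos_of_nonpos_of_nonneg (neg_nonpos.2 (by positivity)) hΓ₁.le)
  set u : ℝ → ℂ := fun y => Ai (Complex.I * y) with hu
  set d : ℝ → ℂ := fun y => deriv Ai (Complex.I * y) with hd
  have hu0 : ∀ y, u y ≠ 0 := fun y h0 => by
    have h1 := (hbd y).1
    have h2 : Ai (Complex.I * y) = 0 := h0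
    rw [h2, norm_zero] at h1
    have : 0 < c * (1 + y ^ 2) ^ 6 := by positivity
    linarith
  have hucont : Continuous u := hAi_d1.continuous.comp (by fun_prop)
  have hdcont : Continuous d := hAi_d2.continuous.comp (by fun_prop)
  -- a weight of at most three factors `1 + y ^ 2` is absorbed by the growth of `u`
  have hdecay : ∀ y, (1 + y ^ 2) ^ 3 / ‖u y‖ ^ 2 ≤ c⁻¹ * (1 + y ^ 2)⁻¹ := fun y => by
    have hpos : 0 < ‖u y‖ := norm_pos_iff.2 (hu0 y)
    have h1 : (1 : ℝ) ≤ 1 + y ^ 2 := by nlinarith [sq_nonneg y]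
    rw [← mul_inv, ← one_div, div_le_div_iff₀ (by positivity) (by positivity)]
    calc (1 + y ^ 2) ^ 3 * (c * (1 + y ^ 2)) = c * (1 + y ^ 2) ^ 4 := by ring
      _ ≤ c * (1 + y ^ 2) ^ 6 := by (gcongr; norm_num)
      _ ≤ 1 * ‖u y‖ ^ 2 := by rw [one_mul]; exact (hbd y).1
  have hint : ∀ (f : ℝ → ℂ) (C : ℝ), Continuous f → 0 ≤ C →
      (∀ y, ‖f y‖ ≤ C * ((1 + y ^ 2) ^ 3 / ‖u y‖ ^ 2)) → MeasureTheory.Integrable f :=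
    fun f C hf hC h => integrable_of_norm_le_inv_one_add_sq hf (C * c⁻¹) fun y =>
      (h y).trans (by rw [mul_assoc]; exact mul_le_mul_of_nonneg_left (hdecay y) hC)
  have habs : ∀ y : ℝ, |y| ≤ 1 + y ^ 2 := fun y => by
    rw [← sq_abs]; nlinarith [sq_nonneg (|y| - 1), abs_nonneg y]
  have hone : ∀ y : ℝ, (1 : ℝ) ≤ 1 + y ^ 2 := fun y => by nlinarith [sq_nonneg y]
  have hI1 : MeasureTheory.Integrable fun y : ℝ => (Complex.I * y) ^ 1 * d y ^ 2 / u y ^ 4 := by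
    refine hint _ K ((by fun_prop : Continuous fun y : ℝ => (Complex.I * y) ^ 1 * d y ^ 2).div
      (hucont.pow 4) fun y => pow_ne_zero _ (hu0 y)) hK fun y => ?_
    have hpos : 0 < ‖u y‖ := norm_pos_iff.2 (hu0 y)
    simp only [norm_div, norm_mul, norm_pow, Complex.norm_I, Complex.norm_real, Real.norm_eq_abs,
      one_mul, pow_one]
    calc |y| * ‖d y‖ ^ 2 / ‖u y‖ ^ 4
        ≤ (1 + y ^ 2) * (K * (1 + y ^ 2) ^ 2 * ‖u y‖ ^ 2) / ‖u y‖ ^ 4 := by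
          gcongr
          · exact habs y
          · exact (hbd y).2
      _ = K * ((1 + y ^ 2) ^ 3 / ‖u y‖ ^ 2) := by field_simp
  have hI2 : MeasureTheory.Integrable fun y : ℝ => (Complex.I * y) ^ 2 * d y ^ 0 / u y ^ 2 := by
    refine hint _ 1 ((by fun_prop : Continuous fun y : ℝ => (Complex.I * y) ^ 2 * d y ^ 0).div
      (hucont.pow 2) fun y => pow_ne_zero _ (hu0 y)) zero_le_one fun y => ?_
    have hpos : 0 < ‖u y‖ := norm_pos_iff.2 (hu0 y)
    simp only [norm_div, norm_mul, norm_pow, Complex.norm_I, Complex.norm_real, Real.norm_eq_abs,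
      one_mul, pow_zero, mul_one, sq_abs]
    gcongr
    calc y ^ 2 ≤ (1 + y ^ 2) ^ 1 := by linarith
      _ ≤ (1 + y ^ 2) ^ 3 := pow_le_pow_right₀ (hone y) (by norm_num)
  have hF1 : MeasureTheory.Integrable fun y : ℝ => Complex.I * y * d y / u y ^ 3 := by
    refine hint _ (K + 1) ((by fun_prop : Continuous fun y : ℝ => Complex.I * y * d y).div
      (hucont.pow 3) fun y => pow_ne_zero _ (hu0 y)) (by positivity) fun y => ?_
    have hpos : 0 < ‖u y‖ := norm_pos_iff.2 (hu0 y)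
    simp only [norm_div, norm_mul, norm_pow, Complex.norm_I, Complex.norm_real, Real.norm_eq_abs,
      one_mul]
    have hdu : ‖d y‖ * ‖u y‖ ≤ (K + 1) * (1 + y ^ 2) ^ 2 * ‖u y‖ ^ 2 := by
      have e1 : ‖d y‖ ^ 2 ≤ K * (1 + y ^ 2) ^ 2 * ‖u y‖ ^ 2 := (hbd y).2
      have e2 : 1 * ‖u y‖ ^ 2 ≤ (1 + y ^ 2) ^ 2 * ‖u y‖ ^ 2 := by
        gcongr
        exact one_le_pow₀ (hone y)
      nlinarith [sq_nonneg (‖d y‖ - ‖u y‖), sq_nonneg ‖d y‖, sq_nonneg ‖u y‖]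
    calc |y| * ‖d y‖ / ‖u y‖ ^ 3 = |y| * (‖d y‖ * ‖u y‖) / ‖u y‖ ^ 4 := by field_simp
      _ ≤ (1 + y ^ 2) * ((K + 1) * (1 + y ^ 2) ^ 2 * ‖u y‖ ^ 2) / ‖u y‖ ^ 4 := by
          gcongr
          exact habs y
      _ = (K + 1) * ((1 + y ^ 2) ^ 3 / ‖u y‖ ^ 2) := by field_simp
  have hF2 : MeasureTheory.Integrable fun y : ℝ => 1 / 2 / u y ^ 2 := by
    refine hint _ 1 (continuous_const.div (hucont.pow 2) fun y => pow_ne_zero _ (hu0 y))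
      zero_le_one fun y => ?_
    have hpos : 0 < ‖u y‖ := norm_pos_iff.2 (hu0 y)
    rw [norm_div, norm_pow, one_mul]
    gcongr
    have := one_le_pow₀ (hone y) (n := 3)
    norm_num
    linarith
  have hz : ∀ y : ℝ, HasDerivAt (fun y : ℝ => Complex.I * (y : ℂ)) Complex.I y := fun y => by
    simpa using ((hasDerivAt_id y).ofReal_comp).const_mul Complex.I
  have hu' : ∀ y, HasDerivAt u (d y * Complex.I) y := fun y =>
    (hAi_d1 _).hasDerivAt.comp y (hz y)
  have hd' : ∀ y : ℝ, HasDerivAt d (Complex.I * y * u y * Complex.I) y := fun y => by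
    have := (hAi_d2 (Complex.I * y)).hasDerivAt.comp y (hz y)
    rwa [hAi_ode] at this
  have hderiv : ∀ y : ℝ, HasDerivAt
      (fun y : ℝ => Complex.I * y * d y / u y ^ 3 + 1 / 2 / u y ^ 2)
      (Complex.I * ((Complex.I * y) ^ 2 * d y ^ 0 / u y ^ 2
        - 3 * ((Complex.I * y) ^ 1 * d y ^ 2 / u y ^ 4))) y := fun y => by
    have h0 := hu0 y
    refine ((((hz y).mul (hd' y)).div ((hu' y).pow 3) (pow_ne_zero _ h0)).add
      ((hasDerivAt_const y (1 / 2 : ℂ)).div ((hu' y).pow 2) (pow_ne_zero _ h0))).congr_deriv ?_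
    simp
    field_simp
    ring
  have hzero := MeasureTheory.integral_eq_zero_of_hasDerivAt_of_integrable hderiv
    ((hI2.sub (hI1.const_mul 3)).const_mul Complex.I) (hF1.add hF2)
  rw [MeasureTheory.integral_const_mul, MeasureTheory.integral_sub hI2 (hI1.const_mul 3),
    MeasureTheory.integral_const_mul] at hzero
  have hrel := (mul_eq_zero.1 hzero).resolve_left Complex.I_ne_zero
  unfold airyI
  linear_combination (-(1 / 3) * (1 / (2 * (Real.pi : ℂ)))) * hrel
end

section
/- One has I(0, 4, 6) = (1/5)·I(2, 0, 2), i.e. (1/(2π)) ∫_ℝ Ai'(iy)⁴/Ai(iy)⁶ dy = (1/5)·(1/(2π)) ∫_ℝ (iy)²/Ai(iy)² dy. -/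
/-- A function on the line with nonnegative derivative on `[0, ∞)` is bounded below there by its
value at `0`. -/
lemma le_of_hasDerivAt_nonneg_s14 {g g' : ℝ → ℝ} (hg : ∀ y, 0 ≤ y → HasDerivAt g (g' y) y)
    (h : ∀ y, 0 ≤ y → 0 ≤ g' y) {y : ℝ} (hy : 0 ≤ y) : g 0 ≤ g y := by
  have hm : MonotoneOn g (Set.Ici 0) := by
    apply monotoneOn_of_deriv_nonneg (convex_Ici 0)
    · exact fun x hx => (hg x hx).continuousAt.continuousWithinAt
    · exact fun x hx => (hg x (interior_subset hx)).differentiableAt.differentiableWithinAt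
    · intro x hx
      rw [interior_Ici] at hx
      rw [(hg x (le_of_lt hx)).deriv]
      exact h x (le_of_lt hx)
  exact hm Set.self_mem_Ici hy hy

/-- The function `a + i b` and its derivative `g = α + i β` satisfy the Airy equation along the
imaginary axis, `dg/dy = -i y (a + i b)`, with initial data for which `Re (conj (a + i b) * g)`
vanishes and `Im (conj (a + i b) * g)` is nonpositive. -/
structure ImaginaryAiry (a b α β : ℝ → ℝ) : Prop where
  da : ∀ y, HasDerivAt a (α y) y
  db : ∀ y, HasDerivAt b (β y) y
  dα : ∀ y, HasDerivAt α (y * b y) y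
  dβ : ∀ y, HasDerivAt β (-(y * a y)) y
  pos : 0 < a 0 ^ 2 + b 0 ^ 2
  re_zero : a 0 * α 0 + b 0 * β 0 = 0
  im_zero : 0 ≤ b 0 * α 0 - a 0 * β 0

namespace ImaginaryAiry

variable {a b α β : ℝ → ℝ}

lemma hasDerivAt_normSq (h : ImaginaryAiry a b α β) (y : ℝ) :
    HasDerivAt (fun y => a y ^ 2 + b y ^ 2) (2 * (a y * α y + b y * β y)) y := by
  refine HasDerivAt.congr_deriv (((h.da y).pow 2).add ((h.db y).pow 2)) ?_
  push_cast; ring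

lemma hasDerivAt_re (h : ImaginaryAiry a b α β) (y : ℝ) :
    HasDerivAt (fun y => a y * α y + b y * β y) (α y ^ 2 + β y ^ 2) y := by
  refine HasDerivAt.congr_deriv (((h.da y).mul (h.dα y)).add ((h.db y).mul (h.dβ y))) ?_
  ring

lemma hasDerivAt_im (h : ImaginaryAiry a b α β) (y : ℝ) :
    HasDerivAt (fun y => b y * α y - a y * β y) (y * (a y ^ 2 + b y ^ 2)) y := by
  refine HasDerivAt.congr_deriv (((h.db y).mul (h.dα y)).sub ((h.da y).mul (h.dβ y))) ?_
  ring

lemma hasDerivAt_normSq_deriv (h : ImaginaryAiry a b α β) (y : ℝ) :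
    HasDerivAt (fun y => α y ^ 2 + β y ^ 2) (2 * y * (b y * α y - a y * β y)) y := by
  refine HasDerivAt.congr_deriv (((h.dα y).pow 2).add ((h.dβ y).pow 2)) ?_
  push_cast; ring

lemma re_nonneg (h : ImaginaryAiry a b α β) {y : ℝ} (hy : 0 ≤ y) :
    0 ≤ a y * α y + b y * β y := by
  have := le_of_hasDerivAt_nonneg_s14 (fun y _ => h.hasDerivAt_re y) (fun y _ => by positivity) hy
  simpa only [h.re_zero] using this

lemma normSq_zero_le (h : ImaginaryAiry a b α β) {y : ℝ} (hy : 0 ≤ y) :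
    a 0 ^ 2 + b 0 ^ 2 ≤ a y ^ 2 + b y ^ 2 :=
  le_of_hasDerivAt_nonneg_s14 (fun y _ => h.hasDerivAt_normSq y)
    (fun _ hy => by linarith [h.re_nonneg hy]) hy

lemma exists_pow_le_normSq (h : ImaginaryAiry a b α β) (k : ℕ) :
    ∃ c > 0, ∀ y, 0 ≤ y → c * y ^ (3 * k) ≤ a y ^ 2 + b y ^ 2 := by
  induction k with
  | zero => exact ⟨_, h.pos, fun y hy => by simpa using h.normSq_zero_le hy⟩
  | succ k ih =>
    obtain ⟨c, hc, hN⟩ := ih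
    set d : ℝ := c / (3 * k + 2) with hd
    have hd0 : 0 < d := by positivity
    have hdc : d * (3 * k + 2) = c := by rw [hd]; field_simp
    have hJ : ∀ y, 0 ≤ y → d * y ^ (3 * k + 2) ≤ b y * α y - a y * β y := by
      intro y hy
      have := le_of_hasDerivAt_nonneg_s14
        (fun y _ => (h.hasDerivAt_im y).sub ((hasDerivAt_pow (3 * k + 2) y).const_mul d))
        (fun y hy => by
          have h1 := mul_le_mul_of_nonneg_left (hN y hy) hy
          have h2 : d * (((3 * k + 2 : ℕ) : ℝ) * y ^ (3 * k + 2 - 1)) = y * (c * y ^ (3 * k)) := by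
            rw [← hdc, show 3 * k + 2 - 1 = 3 * k + 1 from rfl, pow_succ]
            push_cast; ring
          linarith) hy
      have h3 := h.im_zero
      simp at this
      linarith
    set e : ℝ := 4 * d ^ 2 / (6 * k + 5) with he
    have he0 : 0 < e := by positivity
    have hed : e * (6 * k + 5) = 4 * d ^ 2 := by rw [he]; field_simp
    have hE : ∀ y, 0 ≤ y → e * y ^ (6 * k + 5) ≤
        4 * (a y ^ 2 + b y ^ 2) * (a y * α y + b y * β y) := by
      intro y hy
      have := le_of_hasDerivAt_nonneg_s14
        (fun y _ => (((h.hasDerivAt_normSq y).const_mul 4).mul (h.hasDerivAt_re y)).sub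
          ((hasDerivAt_pow (6 * k + 5) y).const_mul e))
        (fun y hy => by
          have h1 : (d * y ^ (3 * k + 2)) ^ 2 ≤ (b y * α y - a y * β y) ^ 2 :=
            pow_le_pow_left₀ (by positivity) (hJ y hy) 2
          have h2 : e * (((6 * k + 5 : ℕ) : ℝ) * y ^ (6 * k + 5 - 1)) =
              4 * (d * y ^ (3 * k + 2)) ^ 2 := by
            rw [show 6 * k + 5 - 1 = (3 * k + 2) * 2 by omega, pow_mul]
            push_cast
            linear_combination (y ^ (3 * k + 2)) ^ 2 * hed
          rw [h2]
          nlinarith [sq_nonneg (a y * α y + b y * β y)]) hy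
      have h3 := h.re_zero
      simp [h3] at this
      linarith
    set r : ℝ := e / (6 * k + 6) with hr
    have hr0 : 0 < r := by positivity
    have hre : r * (6 * k + 6) = e := by rw [hr]; field_simp
    refine ⟨√r, Real.sqrt_pos.2 hr0, fun y hy => ?_⟩
    have := le_of_hasDerivAt_nonneg_s14
        (fun y _ => ((h.hasDerivAt_normSq y).pow 2).sub
          ((hasDerivAt_pow (6 * k + 6) y).const_mul r))
        (fun y hy => by
          have h1 := hE y hy
          have h2 : r * (((6 * k + 6 : ℕ) : ℝ) * y ^ (6 * k + 6 - 1)) = e * y ^ (6 * k + 5) := by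
            rw [show 6 * k + 6 - 1 = 6 * k + 5 from rfl, ← hre]
            push_cast; ring
          rw [h2]
          push_cast
          simp only [pow_one]
          linarith) hy
    simp at this
    have h4 : (√r * y ^ (3 * (k + 1))) ^ 2 ≤ (a y ^ 2 + b y ^ 2) ^ 2 := by
      rw [mul_pow, Real.sq_sqrt hr0.le, ← pow_mul, show 3 * (k + 1) * 2 = 6 * k + 6 by ring]
      nlinarith [sq_nonneg (a 0 ^ 2 + b 0 ^ 2)]
    exact le_of_sq_le_sq h4 (by positivity)

lemma exists_normSq_deriv_le (h : ImaginaryAiry a b α β) :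
    ∃ C, 0 < C ∧ ∀ y, 0 ≤ y → α y ^ 2 + β y ^ 2 ≤ (C * (1 + y ^ 2)) ^ 2 * (a y ^ 2 + b y ^ 2) := by
  have hN : ∀ y, 0 ≤ y → 0 < a y ^ 2 + b y ^ 2 := fun y hy => h.pos.trans_le (h.normSq_zero_le hy)
  set R : ℝ → ℝ := fun y => (α y ^ 2 + β y ^ 2) / (a y ^ 2 + b y ^ 2) with hR
  have hR0 : ∀ y, 0 ≤ R y := fun y => by positivity
  have hmain : ∀ y, 0 ≤ y → √(1 + R y) ≤ √(1 + R 0) + y ^ 2 / 2 := by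
    intro y hy
    have := le_of_hasDerivAt_nonneg_s14
      (fun y hy => ((hasDerivAt_pow 2 y).div_const 2).sub
        ((((h.hasDerivAt_normSq_deriv y).div (h.hasDerivAt_normSq y) (hN y hy).ne').const_add
          1).sqrt (by have := hR0 y; simp only [hR] at this; positivity)))
      (fun y hy => by
        have hNy := hN y hy
        have hEy := h.re_nonneg hy
        have hRy := hR0 y
        have hs : 0 < √(1 + R y) := by positivity
        have hJ : b y * α y - a y * β y ≤ √(1 + R y) * (a y ^ 2 + b y ^ 2) := by
          rw [← div_le_iff₀ hNy]
          apply Real.le_sqrt_of_sq_le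
          rw [div_pow, div_le_iff₀ (by positivity)]
          have : (1 + R y) * (a y ^ 2 + b y ^ 2) ^ 2 = (a y ^ 2 + b y ^ 2) ^ 2 +
              (α y ^ 2 + β y ^ 2) * (a y ^ 2 + b y ^ 2) := by
            simp only [hR]; field_simp
          rw [this]
          nlinarith [sq_nonneg (a y * α y + b y * β y), sq_nonneg (a y ^ 2 + b y ^ 2)]
        change 0 ≤ _ - _ / (2 * √(1 + R y))
        rw [sub_nonneg, div_le_iff₀ (by positivity), div_le_iff₀ (by positivity)]
        have h1 := mul_le_mul_of_nonneg_left hJ (mul_nonneg (mul_nonneg zero_le_two hy) hNy.le)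
        have h2 : 0 ≤ (α y ^ 2 + β y ^ 2) * (2 * (a y * α y + b y * β y)) := by positivity
        push_cast
        simp only [pow_one]
        linarith) hy
    simp at this
    simp only [hR]
    linarith
  have h1 : 1 ≤ √(1 + R 0) := Real.one_le_sqrt.2 (by linarith [hR0 0])
  refine ⟨√(1 + R 0), by linarith, fun y hy => ?_⟩
  have h2 : √(1 + R y) ≤ √(1 + R 0) * (1 + y ^ 2) := by
    nlinarith [hmain y hy, sq_nonneg y]
  have h3 := (Real.sqrt_le_left (by positivity)).1 h2
  rw [← div_le_iff₀ (hN y hy)]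
  change R y ≤ _
  linarith

lemma exists_bounds (h : ImaginaryAiry a b α β) :
    (∃ C > 0, ∀ y, 0 ≤ y →
      α y ^ 2 + β y ^ 2 ≤ (C * (1 + y ^ 2)) ^ 2 * (a y ^ 2 + b y ^ 2)) ∧
    ∃ c > 0, ∀ y, 0 ≤ y → (1 + y ^ 2) ^ 6 ≤ c * (a y ^ 2 + b y ^ 2) := by
  refine ⟨h.exists_normSq_deriv_le, ?_⟩
  obtain ⟨c, hc, H⟩ := h.exists_pow_le_normSq 4
  have h0 := h.pos
  refine ⟨64 * ((a 0 ^ 2 + b 0 ^ 2)⁻¹ + c⁻¹), by positivity, fun y hy => ?_⟩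
  have hN := h.normSq_zero_le hy
  have hN0 := h0.trans_le hN
  have h1 : 1 ≤ (a 0 ^ 2 + b 0 ^ 2)⁻¹ * (a y ^ 2 + b y ^ 2) := by
    rw [inv_mul_eq_div, one_le_div h0]; exact hN
  have h2 : y ^ 12 ≤ c⁻¹ * (a y ^ 2 + b y ^ 2) := by
    rw [inv_mul_eq_div, le_div_iff₀ hc, mul_comm]; exact H y hy
  have h3 : (1 + y ^ 2) ^ 6 ≤ 2 ^ (6 - 1) * (1 ^ 6 + (y ^ 2) ^ 6) :=
    add_pow_le zero_le_one (sq_nonneg y) 6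
  rw [← pow_mul] at h3
  norm_num at h3
  have h4 : 0 ≤ y ^ 12 := by positivity
  linarith

end ImaginaryAiry

/-- On the imaginary axis the logarithmic derivative of a suitable solution of the Airy equation
grows at most polynomially, while the solution grows faster than any prescribed polynomial. -/
lemma airy_imaginary_bounds {f : ℂ → ℂ} (h1 : Differentiable ℂ f)
    (h2 : Differentiable ℂ (deriv f)) (hode : ∀ z, deriv (deriv f) z = z * f z)
    {p q : ℝ} (hp : 0 < p) (hq : q < 0) (h0 : f 0 = p) (h0' : deriv f 0 = q) :
    ∃ C > 0, ∀ y : ℝ, ‖deriv f (Complex.I * y)‖ ≤ C * (1 + y ^ 2) * ‖f (Complex.I * y)‖ ∧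
      (1 + y ^ 2) ^ 6 ≤ C * ‖f (Complex.I * y)‖ ^ 2 := by
  have hline : ∀ y : ℝ, HasDerivAt (fun y : ℝ => Complex.I * (y : ℂ)) Complex.I y := fun y => by
    simpa using (Complex.ofRealCLM.hasDerivAt (x := y)).const_mul Complex.I
  have d1 : ∀ y : ℝ, HasDerivAt (fun y : ℝ => f (Complex.I * y))
      (Complex.I * deriv f (Complex.I * y)) y := fun y => by
    simpa [mul_comm, Function.comp_def] using (h1 _).hasDerivAt.comp y (hline y)
  have d2 : ∀ y : ℝ, HasDerivAt (fun y : ℝ => Complex.I * deriv f (Complex.I * y))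
      (-Complex.I * y * f (Complex.I * y)) y := fun y => by
    refine (((h2 _).hasDerivAt.comp y (hline y)).const_mul Complex.I).congr_deriv ?_
    rw [hode]
    linear_combination Complex.I * y * f (Complex.I * y) * Complex.I_mul_I
  set F : ℝ → ℂ := fun y => f (Complex.I * y) with hF
  set G : ℝ → ℂ := fun y => Complex.I * deriv f (Complex.I * y) with hG
  have hre : ∀ {u : ℝ → ℂ} {u' : ℂ} {y : ℝ}, HasDerivAt u u' y →
      HasDerivAt (fun y => (u y).re) u'.re y :=
    fun hu => Complex.reCLM.hasFDerivAt.comp_hasDerivAt _ hu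
  have him : ∀ {u : ℝ → ℂ} {u' : ℂ} {y : ℝ}, HasDerivAt u u' y →
      HasDerivAt (fun y => (u y).im) u'.im y :=
    fun hu => Complex.imCLM.hasFDerivAt.comp_hasDerivAt _ hu
  have hneg : ∀ {u : ℝ → ℝ} {u' : ℝ} {y : ℝ}, HasDerivAt u u' (-y) →
      HasDerivAt (fun y => u (-y)) (-u') y := fun {u u' y} hu => by
    simpa [Function.comp_def] using hu.comp y (hasDerivAt_neg y)
  have hpos : ImaginaryAiry (fun y => (F y).re) (fun y => (F y).im) (fun y => (G y).re)
      (fun y => (G y).im) := by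
    refine ⟨fun y => hre (d1 y), fun y => him (d1 y),
      fun y => (hre (d2 y)).congr_deriv (by simp [hF]),
      fun y => (him (d2 y)).congr_deriv (by simp [hF]), ?_, ?_, ?_⟩
    · simpa [hF, h0] using pow_pos hp 2
    · simp [hF, hG, h0, h0']
    · simp [hF, hG, h0, h0']
      nlinarith
  have hnegative : ImaginaryAiry (fun y => (F (-y)).re) (fun y => -(F (-y)).im)
      (fun y => -(G (-y)).re) (fun y => (G (-y)).im) := by
    refine ⟨fun y => hneg (hpos.da (-y)), fun y => (hneg (hpos.db (-y))).neg.congr_deriv (by simp),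
      fun y => (hneg (hpos.dα (-y))).neg.congr_deriv (by simp),
      fun y => (hneg (hpos.dβ (-y))).congr_deriv (by simp), ?_, ?_, ?_⟩
    · simpa using hpos.pos
    · have := hpos.re_zero
      simp only [neg_zero]
      linarith
    · simpa using hpos.im_zero
  obtain ⟨⟨C₁, hC₁, H₁⟩, c₁, hc₁, K₁⟩ := hpos.exists_bounds
  obtain ⟨⟨C₂, hC₂, H₂⟩, c₂, hc₂, K₂⟩ := hnegative.exists_bounds
  have hsq : ∀ z : ℂ, z.re ^ 2 + z.im ^ 2 = ‖z‖ ^ 2 := fun z => by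
    rw [Complex.sq_norm, Complex.normSq_apply]; ring
  have hGn : ∀ y, ‖G y‖ = ‖deriv f (Complex.I * y)‖ := fun y => by simp [hG]
  simp only [neg_sq, hsq] at H₁ K₁ H₂ K₂
  have key : ∀ y : ℝ, ∀ D > 0, ‖G y‖ ^ 2 ≤ (D * (1 + y ^ 2)) ^ 2 * ‖F y‖ ^ 2 →
      ‖G y‖ ≤ D * (1 + y ^ 2) * ‖F y‖ := fun y D hD h => by
    rw [← mul_pow] at h
    exact le_of_sq_le_sq h (by positivity)
  refine ⟨C₁ + C₂ + c₁ + c₂, by positivity, fun y => ?_⟩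
  rw [← hGn]
  change _ ≤ _ * ‖F y‖ ∧ _ ≤ _ * ‖F y‖ ^ 2
  have e1 : ∀ D ≤ C₁ + C₂ + c₁ + c₂, D * (1 + y ^ 2) * ‖F y‖ ≤
      (C₁ + C₂ + c₁ + c₂) * (1 + y ^ 2) * ‖F y‖ := fun D hD => by gcongr
  have e2 : ∀ D ≤ C₁ + C₂ + c₁ + c₂, D * ‖F y‖ ^ 2 ≤
      (C₁ + C₂ + c₁ + c₂) * ‖F y‖ ^ 2 := fun D hD => by gcongr
  rcases le_total 0 y with hy | hy
  · exact ⟨(key y C₁ hC₁ (H₁ y hy)).trans (e1 _ (by linarith)),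
      (K₁ y hy).trans (e2 _ (by linarith))⟩
  · have H := H₂ (-y) (by linarith)
    have K := K₂ (-y) (by linarith)
    rw [neg_neg, neg_sq] at H K
    exact ⟨(key y C₂ hC₂ H).trans (e1 _ (by linarith)), K.trans (e2 _ (by linarith))⟩

open Filter Topology in
theorem airyI_0_4_6 (Ai : ℂ → ℂ)
    (hAi_d1 : Differentiable ℂ Ai)
    (hAi_d2 : Differentiable ℂ (deriv Ai))
    (hAi_ode : ∀ z : ℂ, deriv (deriv Ai) z = z * Ai z)
    (hAi_0 : Ai 0 = (3 : ℂ) ^ (-(2 : ℂ) / 3) / Complex.Gamma (2 / 3))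
    (hAi_0' : deriv Ai 0 = -(3 : ℂ) ^ (-(1 : ℂ) / 3) / Complex.Gamma (1 / 3))
    (hAi_zeros : ∀ z : ℂ, Ai z = 0 → ∃ x : ℝ, x < 0 ∧ z = (x : ℂ)) :
    airyI Ai 0 4 6 = (1 / 5) * airyI Ai 2 0 2 := by
  obtain ⟨p, hp, hp0⟩ : ∃ p : ℝ, 0 < p ∧ Ai 0 = p := by
    refine ⟨3 ^ (-(2 : ℝ) / 3) / Real.Gamma (2 / 3),
      div_pos (by positivity) (Real.Gamma_pos_of_pos (by norm_num)), ?_⟩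
    rw [hAi_0, Complex.ofReal_div, Complex.ofReal_cpow (by norm_num), ← Complex.Gamma_ofReal]
    push_cast
    rfl
  obtain ⟨q, hq, hq0⟩ : ∃ q : ℝ, q < 0 ∧ deriv Ai 0 = q := by
    refine ⟨-3 ^ (-(1 : ℝ) / 3) / Real.Gamma (1 / 3),
      div_neg_of_neg_of_pos (neg_lt_zero.2 (by positivity))
        (Real.Gamma_pos_of_pos (by norm_num)), ?_⟩
    rw [hAi_0', Complex.ofReal_div, Complex.ofReal_neg, Complex.ofReal_cpow (by norm_num),
      ← Complex.Gamma_ofReal]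
    push_cast
    rfl
  obtain ⟨C, hC, hb⟩ := airy_imaginary_bounds hAi_d1 hAi_d2 hAi_ode hp hq hp0 hq0
  have hA : ∀ y : ℝ, Ai (Complex.I * y) ≠ 0 := fun y h => by
    have := (hb y).2
    rw [h] at this
    norm_num at this
    have : 0 < (1 + y ^ 2) ^ 6 := by positivity
    linarith
  set T : ℕ → ℕ → ℝ → ℂ := fun j k y =>
    (Complex.I * y) ^ j * deriv Ai (Complex.I * y) ^ k / Ai (Complex.I * y) ^ (k + 2) with hT
  have hterm : ∀ j k : ℕ, j + k ≤ 5 → ∀ y : ℝ, ‖T j k y‖ ≤ C ^ (k + 1) * (1 + y ^ 2)⁻¹ := by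
    intro j k hjk y
    obtain ⟨h1, h2⟩ := hb y
    have hn : 0 < ‖Ai (Complex.I * y)‖ := norm_pos_iff.2 (hA y)
    have hu : 1 ≤ 1 + y ^ 2 := by nlinarith [sq_nonneg y]
    have hy : |y| ≤ 1 + y ^ 2 := by nlinarith [sq_abs y, sq_nonneg (|y| - 1), abs_nonneg y]
    simp only [hT, norm_div, norm_mul, norm_pow, Complex.norm_I, one_mul, Complex.norm_real,
      Real.norm_eq_abs]
    rw [div_le_iff₀ (by positivity)]
    calc |y| ^ j * ‖deriv Ai (Complex.I * y)‖ ^ k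
        ≤ (1 + y ^ 2) ^ j * (C * (1 + y ^ 2) * ‖Ai (Complex.I * y)‖) ^ k := by gcongr
      _ = C ^ k * ‖Ai (Complex.I * y)‖ ^ k * (1 + y ^ 2) ^ (j + k) := by
        rw [mul_pow, mul_pow]
        ring
      _ ≤ C ^ k * ‖Ai (Complex.I * y)‖ ^ k * (1 + y ^ 2) ^ 5 := by gcongr
      _ = C ^ k * ‖Ai (Complex.I * y)‖ ^ k * ((1 + y ^ 2)⁻¹ * (1 + y ^ 2) ^ 6) := by
        field_simp
      _ ≤ C ^ k * ‖Ai (Complex.I * y)‖ ^ k *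
          ((1 + y ^ 2)⁻¹ * (C * ‖Ai (Complex.I * y)‖ ^ 2)) := by gcongr
      _ = _ := by ring
  have hcont : ∀ j k : ℕ, Continuous (T j k) := fun j k => by
    have hA0 := hAi_d1.continuous
    have hA1 := hAi_d2.continuous
    exact Continuous.div (by fun_prop) (by fun_prop) fun y => pow_ne_zero _ (hA y)
  have hint : ∀ j k : ℕ, j + k ≤ 5 → MeasureTheory.Integrable (T j k) := fun j k hjk =>
    (integrable_inv_one_add_sq.const_mul (C ^ (k + 1))).mono'
      (hcont j k).aestronglyMeasurable (Eventually.of_forall (hterm j k hjk))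
  have hsq : Tendsto (fun y : ℝ => 1 + y ^ 2) (cocompact ℝ) atTop := by
    refine tendsto_atTop_add_const_left _ _ ?_
    simpa only [Function.comp_def, Real.norm_eq_abs, sq_abs] using
      (tendsto_pow_atTop two_ne_zero).comp (tendsto_norm_cocompact_atTop (E := ℝ))
  have hlim : ∀ j k : ℕ, j + k ≤ 5 → Tendsto (T j k) (cocompact ℝ) (𝓝 0) := fun j k hjk =>
    squeeze_zero_norm (hterm j k hjk)
      (by simpa using (tendsto_inv_atTop_zero.comp hsq).const_mul (C ^ (k + 1)))
  have hline : ∀ y : ℝ, HasDerivAt (fun y : ℝ => Complex.I * (y : ℂ)) Complex.I y := fun y => by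
    simpa using (Complex.ofRealCLM.hasDerivAt (x := y)).const_mul Complex.I
  have hderiv : ∀ y : ℝ, HasDerivAt (fun y => T 0 3 y + T 1 1 y + T 0 0 y / 2)
      (Complex.I * (T 2 0 y - 5 * T 0 4 y)) y := by
    intro y
    have d0 := (hAi_d1 (Complex.I * y)).hasDerivAt.comp y (hline y)
    have d1 := (hAi_d2 (Complex.I * y)).hasDerivAt.comp y (hline y)
    rw [hAi_ode] at d1
    have hmono : ∀ j k : ℕ, HasDerivAt (T j k) _ y := fun j k =>
      (((hline y).pow j).mul (d1.pow k)).div (d0.pow (k + 2)) (pow_ne_zero _ (hA y))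
    refine (((hmono 0 3).add (hmono 1 1)).add ((hmono 0 0).div_const 2)).congr_deriv ?_
    have := hA y
    simp [hT]
    field_simp
    ring
  have hlim' : Tendsto (fun y => T 0 3 y + T 1 1 y + T 0 0 y / 2) (cocompact ℝ) (𝓝 0) := by
    simpa using ((hlim 0 3 (by norm_num)).add (hlim 1 1 (by norm_num))).add
      ((hlim 0 0 (by norm_num)).div_const 2)
  have h04 := hint 0 4 (by norm_num)
  have h20 := hint 2 0 (by norm_num)
  have hzero := MeasureTheory.integral_of_hasDerivAt_of_tendsto hderiv
    ((h20.sub (h04.const_mul 5)).const_mul Complex.I)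
    (hlim'.mono_left atBot_le_cocompact) (hlim'.mono_left atTop_le_cocompact)
  rw [MeasureTheory.integral_const_mul, MeasureTheory.integral_sub h20 (h04.const_mul 5),
    MeasureTheory.integral_const_mul, sub_zero] at hzero
  have hfinal := (mul_eq_zero.1 hzero).resolve_left Complex.I_ne_zero
  change _ * ∫ y, T 0 4 y = _ * (_ * ∫ y, T 2 0 y)
  linear_combination (-(1 / 5) * (1 / (2 * (Real.pi : ℂ)))) * hfinal
end
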